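/- arXiv:2407.18260 — 3 statements merged into one kernel-verified Lean document; each statement's English description precedes it below -/
import Mathlib

section
/- Let G be a finite group and 𝒫 a set of real-valued generalised characters of G satisfying: (i) Ind_H^G τ ∈ 𝒫 for every subgroup H ≤ G and every real-valued generalised character τ of H of degree 0 and trivial determinant that factors through a quotient of H that is either cyclic or isomorphic to C₂×C₂, D₈, or D_{2p} for some odd prime p; (ii) if τᵢ ∈ 𝒫 and nᵢ ∈ ℤ then Σᵢ nᵢτᵢ ∈ 𝒫. Then 𝒫 contains every permutation character of G of degree 0 and trivial determinant. -/
open scoped Classical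

noncomputable section

/-- The complex conjugate of a complex-valued function. -/
def conjFun {G : Type} (f : G → ℂ) : G → ℂ := fun g => starRingEnd ℂ (f g)

/-- Induction of class functions from a subgroup `H` of `G` to `G`. -/
def indChar {G : Type} [Group G] [Fintype G] (H : Subgroup G) (f : ↥H → ℂ) : G → ℂ :=
  fun g => (Nat.card H : ℂ)⁻¹ *
    ∑ x : G, if h : x⁻¹ * g * x ∈ H then f ⟨x⁻¹ * g * x, h⟩ else 0

/-- The determinant (linear) character of a finite-dimensional complex representation. -/
def detRep {G : Type} [Group G] (V : FDRep ℂ G) : G → ℂ := fun g => LinearMap.det (V.ρ g)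

/-- `f` is the character of some finite-dimensional complex representation of `G`. -/
def IsChar {G : Type} [Group G] (f : G → ℂ) : Prop := ∃ V : FDRep ℂ G, V.character = f

/-- A generalised (virtual) character: a `ℤ`-linear combination of characters. -/
def IsGenChar {G : Type} [Group G] (f : G → ℂ) : Prop :=
  f ∈ Submodule.span ℤ {f : G → ℂ | IsChar f}

/-- A generalised character has trivial determinant: writing `f = χ_V - χ_W`,
`det V ⊗ conj (det W)` is the trivial character. -/
def HasTrivialDet {G : Type} [Group G] (f : G → ℂ) : Prop :=
  ∃ V W : FDRep ℂ G, f = V.character - W.character ∧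
    ∀ g, detRep V g * starRingEnd ℂ (detRep W g) = 1

/-- A permutation character: a `ℤ`-linear combination of characters `Ind_H^G 1_H`. -/
def IsPermChar {G : Type} [Group G] [Fintype G] (f : G → ℂ) : Prop :=
  f ∈ Submodule.span ℤ {f : G → ℂ | ∃ H : Subgroup G, f = indChar H 1}

/-- `𝒮_G`: permutation characters of `G` of degree `0` and trivial determinant. -/
def SG (G : Type) [Group G] [Fintype G] : Set (G → ℂ) :=
  {f | IsPermChar f ∧ f 1 = 0 ∧ HasTrivialDet f}

/-- `Q` is isomorphic to `C₂ × C₂`, to `D₈`, or to `D_{2p}` for an odd prime `p`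
(`DihedralGroup m` is the dihedral group of order `2m`). -/
def IsTargetGroup (Q : Type) [Group Q] : Prop :=
  Nonempty (Q ≃* Multiplicative (ZMod 2 × ZMod 2)) ∨ Nonempty (Q ≃* DihedralGroup 4) ∨
    ∃ p : ℕ, Odd p ∧ p.Prime ∧ Nonempty (Q ≃* DihedralGroup p)

/-- `𝒫_G`: the smallest set of generalised characters of `G` containing `τ + τ̄` for every
generalised character `τ` of degree 0, containing `Ind_H^G (τ - 1 - det τ)` for every degree-2
character `τ` of a subgroup `H` factoring through a quotient of `H` isomorphic to `C₂ × C₂`,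
`D₈` or `D_{2p}` (`p` an odd prime), and closed under `ℤ`-linear combinations. -/
inductive memP (G : Type) [Group G] [Fintype G] : (G → ℂ) → Prop
  | conj_add (τ : G → ℂ) (hτ : IsGenChar τ) (hdeg : τ 1 = 0) : memP G (τ + conjFun τ)
  | ind (H : Subgroup G) (N : Subgroup ↥H) [hN : N.Normal] (V : FDRep ℂ ↥H)
      (hdeg : V.character 1 = 2) (htarget : IsTargetGroup (↥H ⧸ N))
      (hfactors : ∀ n : ↥H, n ∈ N → V.ρ n = 1) :
      memP G (indChar H (V.character - 1 - detRep V))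
  | zero : memP G 0
  | add (f₁ f₂ : G → ℂ) (h₁ : memP G f₁) (h₂ : memP G f₂) : memP G (f₁ + f₂)
  | neg (f : G → ℂ) (h : memP G f) : memP G (-f)

/-- `𝒫_G` as a set. -/
def PG (G : Type) [Group G] [Fintype G] : Set (G → ℂ) := {f | memP G f}

end

section Determinants

open Polynomial

theorem Multiset.eq_of_map_eval_sum_eq {s t : Multiset ℂ}
    (h : ∀ P : ℂ[X], (s.map fun z => P.eval z).sum = (t.map fun z => P.eval z).sum) : s = t := by
  ext z
  set S : Finset ℂ := (s + t).toFinset.erase z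
  set P : ℂ[X] := ∏ w ∈ S, (X - C w)
  have hz : P.eval z ≠ 0 := by
    rw [eval_prod, Finset.prod_ne_zero_iff]
    intro w hw
    simpa [sub_eq_zero] using (Finset.ne_of_mem_erase hw).symm
  have key : ∀ u : Multiset ℂ, u ≤ s + t →
      (u.map fun w => P.eval w).sum = u.count z * P.eval z := by
    intro u hu
    have : ∀ w ∈ u, P.eval w = if z = w then P.eval z else 0 := by
      intro w hw
      split_ifs with hwz
      · rw [hwz]
      · rw [eval_prod]
        refine Finset.prod_eq_zero (i := w) ?_ (by simp)
        exact Finset.mem_erase.2 ⟨fun e => hwz e.symm,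
          Multiset.mem_toFinset.2 (Multiset.mem_of_le hu hw)⟩
    rw [Multiset.map_congr rfl this]
    clear this hu
    induction u using Multiset.induction_on with
    | empty => simp
    | cons a u ih =>
      rw [Multiset.map_cons, Multiset.sum_cons, ih, Multiset.count_cons]
      split_ifs <;> simp; ring
  have := h P
  rw [key s (Multiset.le_add_right _ _), key t (Multiset.le_add_left _ _)] at this
  exact_mod_cast mul_right_cancel₀ hz this

theorem LinearMap.exists_eigenbasis_of_pow_eq_one {V : Type} [AddCommGroup V] [Module ℂ V]
    [FiniteDimensional ℂ V] (f : V →ₗ[ℂ] V) {N : ℕ} (hN : N ≠ 0) (hf : f ^ N = 1) :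
    ∃ (ι : Type) (b : Module.Basis ι ℂ V) (d : ι → ℂ), ∀ i, f (b i) = d i • b i := by
  have hss : Module.End.IsSemisimple f := by
    refine Module.End.isSemisimple_of_squarefree_aeval_eq_zero (p := X ^ N - 1) ?_ (by simp [hf])
    exact ((X_pow_sub_one_separable_iff).2 (by exact_mod_cast hN)).squarefree
  have hI : DirectSum.IsInternal fun μ : ℂ => Module.End.eigenspace f μ :=
    DirectSum.isInternal_submodule_of_iSupIndep_of_iSup_eq_top
      (Module.End.eigenspaces_iSupIndep f) hss.iSup_eigenspace_eq_top
  let b := hI.collectedBasis fun μ => Module.finBasis ℂ (Module.End.eigenspace f μ)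
  exact ⟨_, b, fun i => i.1, fun i => Module.End.mem_eigenspace_iff.1 (hI.collectedBasis_mem _ i)⟩

theorem Matrix.exists_eigenvalues_of_pow_eq_one {n : Type} [Fintype n] (A : Matrix n n ℂ)
    {N : ℕ} (hN : N ≠ 0) (hA : A ^ N = 1) :
    ∃ s : Multiset ℂ, A.det = s.prod ∧ ∀ k, (A ^ k).trace = (s.map fun z => z ^ k).sum := by
  obtain ⟨ι, b, d, hd⟩ := LinearMap.exists_eigenbasis_of_pow_eq_one (Matrix.toLin' A) hN
    (by rw [← Matrix.toLin'_pow, hA, Matrix.toLin'_one]; rfl)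
  have : Finite ι := Module.Finite.finite_basis b
  have := Fintype.ofFinite ι
  have hpow : ∀ k : ℕ, LinearMap.toMatrix b b (Matrix.toLin' A ^ k) =
      Matrix.diagonal fun i => d i ^ k := by
    intro k
    have hk : ∀ i, (Matrix.toLin' A ^ k) (b i) = d i ^ k • b i := by
      intro i
      induction k with
      | zero => simp
      | succ k ih => rw [pow_succ', Module.End.mul_apply, ih, map_smul, hd, smul_smul, pow_succ]
    ext i j
    rw [LinearMap.toMatrix_apply, hk, map_smul, Module.Basis.repr_self, Matrix.diagonal_apply]
    simp only [Finsupp.smul_apply, Finsupp.single_apply, smul_eq_mul]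
    by_cases h : j = i
    · simp [h]
    · simp [h, Ne.symm h]
  refine ⟨Finset.univ.val.map d, ?_, fun k => ?_⟩
  · have := hpow 1
    simp only [pow_one] at this
    rw [← LinearMap.det_toLin', ← LinearMap.det_toMatrix b, this, Matrix.det_diagonal]
    rfl
  · rw [← Matrix.trace_toLin'_eq, Matrix.toLin'_pow, LinearMap.trace_eq_matrix_trace ℂ b,
      hpow, Matrix.trace_diagonal, Multiset.map_map]
    rfl

/-- For matrices of finite order, the traces of all powers determine the determinant. -/
theorem Matrix.det_eq_of_trace_pow_eq {m n : Type} [Fintype m] [Fintype n]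
    {A : Matrix m m ℂ} {B : Matrix n n ℂ} {N : ℕ} (hN : N ≠ 0) (hA : A ^ N = 1) (hB : B ^ N = 1)
    (h : ∀ k, (A ^ k).trace = (B ^ k).trace) : A.det = B.det := by
  obtain ⟨s, hs, hs'⟩ := A.exists_eigenvalues_of_pow_eq_one hN hA
  obtain ⟨t, ht, ht'⟩ := B.exists_eigenvalues_of_pow_eq_one hN hB
  have : s = t := by
    refine Multiset.eq_of_map_eval_sum_eq fun P => ?_
    have key : ∀ u : Multiset ℂ, (u.map fun z => P.eval z).sum =
        ∑ k ∈ P.support, P.coeff k * (u.map fun z => z ^ k).sum := by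
      intro u
      induction u using Multiset.induction_on with
      | empty => simp
      | cons a u ih =>
        simp only [Multiset.map_cons, Multiset.sum_cons, ih, mul_add, Finset.sum_add_distrib]
        rw [Polynomial.eval_eq_sum, Polynomial.sum_def]
    simp only [key, ← hs', ← ht', h]
  rw [hs, ht, this]

end Determinants

/-- `f` and `d` are the trace and the determinant of a complex matrix representation. -/
def IsTraceDet {G : Type} [Group G] (f d : G → ℂ) : Prop :=
  ∃ (ι : Type) (_ : Fintype ι) (_ : DecidableEq ι) (ρ : G →* Matrix ι ι ℂ),
    (∀ g, (ρ g).trace = f g) ∧ ∀ g, (ρ g).det = d g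

/-- `f` is a generalised character with determinant character `d`. -/
def HasDet {G : Type} [Group G] (f d : G → ℂ) : Prop :=
  ∃ f₁ d₁ f₂ d₂ : G → ℂ, IsTraceDet f₁ d₁ ∧ IsTraceDet f₂ d₂ ∧ f = f₁ - f₂ ∧ d * d₂ = d₁

section HasDet

variable {G H : Type} [Group G] [Group H]

theorem IsTraceDet.zero : IsTraceDet (0 : G → ℂ) 1 :=
  ⟨Fin 0, inferInstance, inferInstance, 1, by simp, by simp⟩

theorem IsTraceDet.add {f d f' d' : G → ℂ} (h : IsTraceDet f d) (h' : IsTraceDet f' d') :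
    IsTraceDet (f + f') (d * d') := by
  obtain ⟨ι, _, _, ρ, h1, h2⟩ := h
  obtain ⟨ι', _, _, ρ', h1', h2'⟩ := h'
  refine ⟨ι ⊕ ι', inferInstance, inferInstance,
    { toFun := fun g => Matrix.fromBlocks (ρ g) 0 0 (ρ' g)
      map_one' := by simp
      map_mul' := fun x y => by simp [Matrix.fromBlocks_multiply] }, ?_, ?_⟩
  · intro g
    simp [Matrix.trace, ← h1, ← h1']
  · intro g
    simp [Matrix.det_fromBlocks_zero₂₁, h2, h2']

theorem IsTraceDet.comp {f d : G → ℂ} (h : IsTraceDet f d) (φ : H →* G) :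
    IsTraceDet (f ∘ φ) (d ∘ φ) := by
  obtain ⟨ι, _, _, ρ, h1, h2⟩ := h
  exact ⟨ι, inferInstance, inferInstance, ρ.comp φ, by simp [h1], by simp [h2]⟩

theorem IsTraceDet.ofLinear (χ : G →* ℂ) : IsTraceDet (χ : G → ℂ) χ :=
  ⟨Unit, inferInstance, inferInstance,
    { toFun := fun g => Matrix.of fun _ _ => χ g
      map_one' := by ext; simp
      map_mul' := fun x y => by ext; simp [Matrix.mul_apply] },
    by simp [Matrix.trace], by simp⟩

theorem IsTraceDet.det_ne_zero {f d : G → ℂ} (h : IsTraceDet f d) (g : G) : d g ≠ 0 := by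
  obtain ⟨ι, _, _, ρ, -, h2⟩ := h
  intro h0
  have h3 : (ρ g).det * (ρ g⁻¹).det = 1 := by
    rw [← Matrix.det_mul, ← map_mul, mul_inv_cancel, map_one, Matrix.det_one]
  rw [h2, h0, zero_mul] at h3
  exact zero_ne_one h3

theorem IsTraceDet.det_eq [Finite G] {f d d' : G → ℂ} (h : IsTraceDet f d)
    (h' : IsTraceDet f d') : d = d' := by
  obtain ⟨ι, _, D, ρ, h1, h2⟩ := h
  obtain ⟨ι', _, D', ρ', h1', h2'⟩ := h'
  obtain rfl : D = fun a b => Classical.propDecidable (a = b) := Subsingleton.elim _ _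
  obtain rfl : D' = fun a b => Classical.propDecidable (a = b) := Subsingleton.elim _ _
  funext g
  rw [← h2, ← h2']
  refine Matrix.det_eq_of_trace_pow_eq (N := Nat.card G) Nat.card_pos.ne' ?_ ?_ fun k => ?_
  · rw [← map_pow, pow_card_eq_one', map_one]
  · rw [← map_pow, pow_card_eq_one', map_one]
  · rw [← map_pow, ← map_pow, h1, h1']

theorem IsTraceDet.hasDet {f d : G → ℂ} (h : IsTraceDet f d) : HasDet f d :=
  ⟨f, d, 0, 1, h, .zero, by simp, by simp⟩

theorem HasDet.zero : HasDet (0 : G → ℂ) 1 := IsTraceDet.zero.hasDet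

theorem HasDet.one : HasDet (1 : G → ℂ) 1 := (IsTraceDet.ofLinear (1 : G →* ℂ)).hasDet

theorem HasDet.add {f d f' d' : G → ℂ} (h : HasDet f d) (h' : HasDet f' d') :
    HasDet (f + f') (d * d') := by
  obtain ⟨f₁, d₁, f₂, d₂, h1, h2, rfl, h3⟩ := h
  obtain ⟨f₁', d₁', f₂', d₂', h1', h2', rfl, h3'⟩ := h'
  refine ⟨_, _, _, _, h1.add h1', h2.add h2', by abel, ?_⟩
  rw [← h3, ← h3']
  ring

theorem HasDet.neg {f d : G → ℂ} (h : HasDet f d) : HasDet (-f) d⁻¹ := by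
  obtain ⟨f₁, d₁, f₂, d₂, h1, h2, rfl, h3⟩ := h
  refine ⟨_, _, _, _, h2, h1, by abel, ?_⟩
  rw [← h3]
  funext g
  have : d g ≠ 0 := fun h0 => h1.det_ne_zero g (by rw [← h3]; simp [h0])
  simp [this]

theorem HasDet.sub {f d f' d' : G → ℂ} (h : HasDet f d) (h' : HasDet f' d') :
    HasDet (f - f') (d * d'⁻¹) := by
  rw [sub_eq_add_neg]
  exact h.add h'.neg

theorem HasDet.nsmul {f d : G → ℂ} (h : HasDet f d) (n : ℕ) : HasDet (n • f) (d ^ n) := by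
  induction n with
  | zero => simpa using HasDet.zero
  | succ n ih => rw [succ_nsmul, pow_succ]; exact ih.add h

theorem HasDet.zsmul {f d : G → ℂ} (h : HasDet f d) (n : ℤ) : HasDet (n • f) (d ^ n) := by
  cases n with
  | ofNat n => simpa using h.nsmul n
  | negSucc n => rw [negSucc_zsmul, zpow_negSucc]; exact (h.nsmul (n + 1)).neg

theorem HasDet.comp {f d : G → ℂ} (h : HasDet f d) (φ : H →* G) : HasDet (f ∘ φ) (d ∘ φ) := by
  obtain ⟨f₁, d₁, f₂, d₂, h1, h2, rfl, rfl⟩ := h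
  exact ⟨_, _, _, _, h1.comp φ, h2.comp φ, rfl, rfl⟩

theorem HasDet.det_eq [Finite G] {f d d' : G → ℂ} (h : HasDet f d) (h' : HasDet f d') :
    d = d' := by
  obtain ⟨f₁, d₁, f₂, d₂, h1, h2, rfl, h3⟩ := h
  obtain ⟨f₁', d₁', f₂', d₂', h1', h2', h4, h3'⟩ := h'
  have h5 : f₁ + f₂' = f₁' + f₂ := by
    rw [sub_eq_sub_iff_add_eq_add] at h4; exact h4
  have h6 := (h1.add h2').det_eq (h5 ▸ h1'.add h2)
  rw [← h3, ← h3'] at h6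
  funext g
  have := congrFun h6 g
  simp only [Pi.mul_apply] at this
  have e1 := h2.det_ne_zero g
  have e2 := h2'.det_ne_zero g
  apply mul_right_cancel₀ (mul_ne_zero e1 e2)
  linear_combination this

theorem FDRep.isTraceDet (V : FDRep ℂ G) : IsTraceDet V.character (detRep V) := by
  let b := Module.finBasis ℂ V
  refine ⟨Fin (Module.finrank ℂ V), inferInstance, inferInstance,
    { toFun := fun g => LinearMap.toMatrix b b (V.ρ g)
      map_one' := by rw [map_one]; exact LinearMap.toMatrix_one b
      map_mul' := fun x y => by rw [map_mul]; exact LinearMap.toMatrix_mul b _ _ }, ?_, ?_⟩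
  · intro g
    exact (LinearMap.trace_eq_matrix_trace ℂ b (V.ρ g)).symm
  · intro g
    exact LinearMap.det_toMatrix b (V.ρ g)

theorem IsTraceDet.exists_fdRep {f d : G → ℂ} (h : IsTraceDet f d) :
    ∃ V : FDRep ℂ G, V.character = f ∧ detRep V = d := by
  obtain ⟨ι, _, _, ρ, h1, h2⟩ := h
  let r : Representation ℂ G (ι → ℂ) :=
    { toFun := fun g => Matrix.toLin' (ρ g)
      map_one' := by rw [map_one]; exact Matrix.toLin'_one
      map_mul' := fun x y => by rw [map_mul]; exact Matrix.toLin'_mul _ _ }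
  refine ⟨FDRep.of r, ?_, ?_⟩
  · funext g
    rw [← h1]
    exact Matrix.trace_toLin'_eq (ρ g)
  · funext g
    rw [← h2]
    exact LinearMap.det_toLin' (ρ g)

theorem HasDet.isGenChar {f d : G → ℂ} (h : HasDet f d) : IsGenChar f := by
  obtain ⟨f₁, d₁, f₂, d₂, h1, h2, rfl, -⟩ := h
  obtain ⟨V, rfl, -⟩ := h1.exists_fdRep
  obtain ⟨W, rfl, -⟩ := h2.exists_fdRep
  exact Submodule.sub_mem _ (Submodule.subset_span ⟨V, rfl⟩) (Submodule.subset_span ⟨W, rfl⟩)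

theorem detRep_mul_conj [Finite G] (V : FDRep ℂ G) (g : G) :
    detRep V g * starRingEnd ℂ (detRep V g) = 1 := by
  have h : detRep V g ^ Nat.card G = 1 := by
    have h1 : detRep V g ^ Nat.card G = LinearMap.det (V.ρ (g ^ Nat.card G)) := by
      simp only [detRep, map_pow]
    rw [h1, pow_card_eq_one', map_one, map_one]
  have h2 := Complex.norm_eq_one_of_pow_eq_one h Nat.card_pos.ne'
  rw [Complex.mul_conj, Complex.normSq_eq_norm_sq, h2]
  simp

theorem hasTrivialDet_iff [Finite G] {f : G → ℂ} : HasTrivialDet f ↔ HasDet f 1 := by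
  constructor
  · rintro ⟨V, W, rfl, h⟩
    refine ⟨_, _, _, _, V.isTraceDet, W.isTraceDet, rfl, ?_⟩
    funext g
    have h1 := h g
    have h2 := detRep_mul_conj W g
    simp only [Pi.mul_apply, Pi.one_apply]
    linear_combination (detRep V g) * h2 - (detRep W g) * h1
  · rintro ⟨f₁, d₁, f₂, d₂, h1, h2, rfl, h3⟩
    obtain ⟨V, rfl, rfl⟩ := h1.exists_fdRep
    obtain ⟨W, rfl, rfl⟩ := h2.exists_fdRep
    refine ⟨V, W, rfl, fun g => ?_⟩
    rw [← h3]
    simpa using detRep_mul_conj W g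

end HasDet

theorem sum_quotient {G : Type} [Group G] [Fintype G] (L : Subgroup G)
    [Fintype (G ⧸ L)] (F : G ⧸ L → ℂ) :
    ∑ x : G, F x = (Nat.card L : ℂ) * ∑ ω : G ⧸ L, F ω := by
  rw [Fintype.sum_equiv (Subgroup.groupEquivQuotientProdSubgroup (s := L)) (fun x : G => F x)
    (fun p => F p.1) fun x => rfl, Fintype.sum_prod_type]
  simp [Finset.mul_sum]

theorem sum_comp_surjective {G K : Type} [Group G] [Group K] [Fintype G] [Fintype K]
    {p : G →* K} (hp : Function.Surjective p) (F : K → ℂ) :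
    ∑ x : G, F (p x) = (Nat.card p.ker : ℂ) * ∑ y : K, F y := by
  rw [← Fintype.sum_equiv (QuotientGroup.quotientKerEquivOfSurjective p hp).toEquiv
    (fun ω => F (QuotientGroup.quotientKerEquivOfSurjective p hp ω)) F fun x => rfl]
  exact sum_quotient p.ker fun ω => F (QuotientGroup.quotientKerEquivOfSurjective p hp ω)

section Induction

variable {G H K : Type} [Group G] [Group H] [Group K] [Finite G] [Finite H] [Finite K]

/-- Induction of class functions along a homomorphism `φ : H → G`. -/
noncomputable def indHom (φ : H →* G) (f : H → ℂ) : G → ℂ :=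
  letI := Fintype.ofFinite G
  letI := Fintype.ofFinite H
  fun g => (Nat.card H : ℂ)⁻¹ * ∑ x : G, ∑ h : H, if φ h = x⁻¹ * g * x then f h else 0

theorem indHom_apply [Fintype G] [Fintype H] (φ : H →* G) (f : H → ℂ) (g : G) :
    indHom φ f g =
      (Nat.card H : ℂ)⁻¹ * ∑ x : G, ∑ h : H, if φ h = x⁻¹ * g * x then f h else 0 := by
  unfold indHom
  congr!

theorem natCard_ne_zero_complex (G : Type) [Group G] [Finite G] : (Nat.card G : ℂ) ≠ 0 :=
  Nat.cast_ne_zero.mpr Nat.card_pos.ne'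

theorem indHom_add (φ : H →* G) (f f' : H → ℂ) :
    indHom φ (f + f') = indHom φ f + indHom φ f' := by
  have := Fintype.ofFinite G
  have := Fintype.ofFinite H
  funext g
  simp only [indHom_apply, Pi.add_apply, ← mul_add, ← Finset.sum_add_distrib]
  congr 1
  refine Finset.sum_congr rfl fun x _ => Finset.sum_congr rfl fun h _ => ?_
  split_ifs <;> simp

/-- Induction along a homomorphism as an additive map. -/
noncomputable def indAddHom (φ : H →* G) : (H → ℂ) →+ (G → ℂ) :=
  AddMonoidHom.mk' (indHom φ) (indHom_add φ)

theorem indHom_sub (φ : H →* G) (f f' : H → ℂ) :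
    indHom φ (f - f') = indHom φ f - indHom φ f' := map_sub (indAddHom φ) f f'

theorem indHom_zero (φ : H →* G) : indHom φ 0 = 0 := map_zero (indAddHom φ)

theorem indHom_neg (φ : H →* G) (f : H → ℂ) : indHom φ (-f) = -indHom φ f :=
  map_neg (indAddHom φ) f

theorem indHom_comp (φ : H →* K) (ψ : K →* G) (f : H → ℂ) :
    indHom ψ (indHom φ f) = indHom (ψ.comp φ) f := by
  have := Fintype.ofFinite G
  have := Fintype.ofFinite H
  have := Fintype.ofFinite K
  funext g
  simp only [indHom_apply]
  have key : ∀ x : G, (∑ k : K, if ψ k = x⁻¹ * g * x then (Nat.card H : ℂ)⁻¹ *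
      ∑ y : K, ∑ h : H, (if φ h = y⁻¹ * k * y then f h else 0) else 0) =
      ∑ y : K, (Nat.card H : ℂ)⁻¹ *
        ∑ h : H, if ψ (φ h) = (x * ψ y)⁻¹ * g * (x * ψ y) then f h else 0 := by
    intro x
    simp only [← Finset.mul_sum, ← mul_ite_zero]
    congr 1
    calc _ = ∑ k : K, ∑ y : K, ∑ h : H,
          if k = y * φ h * y⁻¹ then (if ψ k = x⁻¹ * g * x then f h else 0) else 0 := by
          refine Finset.sum_congr rfl fun k _ => ?_
          split_ifs with hk
          · refine Finset.sum_congr rfl fun y _ => Finset.sum_congr rfl fun h _ => ?_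
            congr 1
            rw [eq_iff_iff]
            constructor <;> (intro e; rw [e]; group)
          · simp
      _ = _ := by
          rw [Finset.sum_comm]
          refine Finset.sum_congr rfl fun y _ => ?_
          rw [Finset.sum_comm]
          refine Finset.sum_congr rfl fun h _ => ?_
          rw [Finset.sum_ite_eq' , if_pos (Finset.mem_univ _)]
          congr 1
          simp only [map_mul, map_inv, eq_iff_iff]
          constructor
          · intro e
            have : ψ (φ h) = (ψ y)⁻¹ * (x⁻¹ * g * x) * ψ y := by rw [← e]; group
            rw [this]; group
          · intro e
            rw [e]; group
  simp only [key]
  rw [Finset.sum_comm]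
  simp only [← Finset.mul_sum]
  have key2 : ∀ y : K, (∑ x : G, ∑ h : H,
      if ψ (φ h) = (x * ψ y)⁻¹ * g * (x * ψ y) then f h else 0) =
      ∑ x : G, ∑ h : H, if ψ (φ h) = x⁻¹ * g * x then f h else 0 := fun y =>
    Fintype.sum_equiv (Equiv.mulRight (ψ y)) _ _ fun x => rfl
  simp only [key2, Finset.sum_const, Finset.card_univ, nsmul_eq_mul, MonoidHom.comp_apply]
  have := natCard_ne_zero_complex K
  rw [Nat.card_eq_fintype_card] at *
  field_simp

theorem indHom_conj_comp (φ : H →* G) (t : G) (f : H → ℂ) :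
    indHom ((MulAut.conj t).toMonoidHom.comp φ) f = indHom φ f := by
  have := Fintype.ofFinite G
  have := Fintype.ofFinite H
  funext g
  simp only [indHom_apply]
  congr 1
  refine Fintype.sum_equiv (Equiv.mulRight t) _ _ fun x => Finset.sum_congr rfl fun h _ => ?_
  congr 1
  simp only [MonoidHom.comp_apply, MulEquiv.toMonoidHom_eq_coe, MonoidHom.coe_coe,
    MulAut.conj_apply, Equiv.coe_mulRight, eq_iff_iff]
  constructor
  · intro e
    have : φ h = t⁻¹ * (x⁻¹ * g * x) * t := by rw [← e]; group
    rw [this]; group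
  · intro e
    rw [e]; group

theorem indHom_comp_equiv (e : K ≃* H) (φ : H →* G) (f : H → ℂ) :
    indHom (φ.comp e.toMonoidHom) (f ∘ e) = indHom φ f := by
  have := Fintype.ofFinite G
  have := Fintype.ofFinite H
  have := Fintype.ofFinite K
  funext g
  simp only [indHom_apply]
  rw [Nat.card_congr e.toEquiv]
  congr 1
  exact Finset.sum_congr rfl fun x _ => Fintype.sum_equiv e.toEquiv _ _ fun k => rfl

theorem indHom_subtype_apply [Fintype G] (L : Subgroup G) (f : L → ℂ) (g : G) :
    indHom L.subtype f g = (Nat.card L : ℂ)⁻¹ *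
      ∑ x : G, if h : x⁻¹ * g * x ∈ L then f ⟨x⁻¹ * g * x, h⟩ else 0 := by
  rw [indHom_apply]
  congr 1
  refine Finset.sum_congr rfl fun x _ => ?_
  split_ifs with hx
  · rw [Fintype.sum_eq_single ⟨x⁻¹ * g * x, hx⟩]
    · simp
    · intro h hh
      rw [if_neg]
      rintro e
      exact hh (Subtype.ext e)
  · refine Finset.sum_eq_zero fun h _ => if_neg ?_
    rintro e
    exact hx (e ▸ h.2)

theorem indHom_eq_indHom_range {φ : H →* G} (hφ : Function.Injective φ) (f : H → ℂ) :
    indHom φ f = indHom φ.range.subtype (f ∘ (MonoidHom.ofInjective hφ).symm) := by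
  rw [← indHom_comp_equiv (MonoidHom.ofInjective hφ) φ.range.subtype]
  congr 1
  funext h
  simp

theorem indHom_mul_comp (φ : H →* G) (a : H → ℂ) (f : G → ℂ)
    (hf : ∀ x g, f (x⁻¹ * g * x) = f g) :
    indHom φ (a * (f ∘ φ)) = indHom φ a * f := by
  have := Fintype.ofFinite G
  have := Fintype.ofFinite H
  funext g
  simp only [indHom_apply, Pi.mul_apply]
  rw [mul_assoc, Finset.sum_mul]
  congr 1
  refine Finset.sum_congr rfl fun x _ => ?_
  rw [Finset.sum_mul]
  refine Finset.sum_congr rfl fun h _ => ?_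
  split_ifs with e
  · simp [e, hf]
  · simp

/-- The pullback of two group homomorphisms. -/
abbrev pullback (p : G →* K) (φ : H →* K) : Subgroup (G × H) :=
  (p.comp (MonoidHom.fst G H)).eqLocus (φ.comp (MonoidHom.snd G H))

theorem indHom_comp_surjective {p : G →* K} (hp : Function.Surjective p) (φ : H →* K)
    (f : H → ℂ) :
    indHom φ f ∘ p = indHom ((MonoidHom.fst G H).comp (pullback p φ).subtype)
      (f ∘ (MonoidHom.snd G H).comp (pullback p φ).subtype) := by
  have := Fintype.ofFinite G
  have := Fintype.ofFinite H
  have := Fintype.ofFinite K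
  have key : ∀ F : G → H → ℂ, ∑ w : pullback p φ, F w.1.1 w.1.2 =
      ∑ h : H, ∑ a : G, if p a = φ h then F a h else 0 := by
    intro F
    rw [← Finset.sum_subtype (Finset.univ.filter fun w : G × H => p w.1 = φ w.2)
      (f := fun w => F w.1 w.2) (p := fun w => w ∈ pullback p φ)
      (fun w => by
        simp only [Finset.mem_filter, Finset.mem_univ, true_and]
        exact Iff.rfl), Finset.sum_filter,
      Fintype.sum_prod_type_right]
  have hcard : (Nat.card (pullback p φ) : ℂ) = Nat.card p.ker * Nat.card H := by
    have := key fun _ _ => 1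
    simp only [Finset.sum_const, Finset.card_univ, nsmul_eq_mul, mul_one] at this
    rw [Nat.card_eq_fintype_card, this]
    have h2 : ∀ h : H, (∑ a : G, if p a = φ h then (1 : ℂ) else 0) = Nat.card p.ker := fun h => by
      rw [sum_comp_surjective hp fun y => if y = φ h then (1 : ℂ) else 0]
      simp
    simp only [h2]
    simp [mul_comm]
  funext g
  simp only [Function.comp_apply, indHom_apply]
  rw [hcard]
  have h3 : ∀ x : G, (∑ w : pullback p φ,
      if (MonoidHom.fst G H).comp (pullback p φ).subtype w = x⁻¹ * g * x then
        f ((MonoidHom.snd G H).comp (pullback p φ).subtype w) else 0) =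
      ∑ h : H, if φ h = (p x)⁻¹ * p g * p x then f h else 0 := by
    intro x
    refine (key fun a h => if a = x⁻¹ * g * x then f h else 0).trans ?_
    refine Finset.sum_congr rfl fun h _ => ?_
    rw [Fintype.sum_eq_single (x⁻¹ * g * x)]
    · simp only [map_mul, map_inv, if_true]
      congr 1
      exact propext eq_comm
    · intro a ha
      simp [ha]
  simp only [h3]
  rw [sum_comp_surjective hp fun y => ∑ h : H, if φ h = y⁻¹ * p g * y then f h else 0]
  have h4 := natCard_ne_zero_complex p.ker
  have h5 := natCard_ne_zero_complex H
  field_simp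

end Induction

section Permutation

variable {G H : Type} [Group G] [Group H] [Finite G] [Finite H]

/-- The permutation character of a `G`-set. -/
noncomputable def fixCount (G X : Type) [Group G] [MulAction G X] (g : G) : ℂ :=
  Nat.card {x : X // g • x = x}

theorem fixCount_eq_sum {G X : Type} [Group G] [MulAction G X] [Fintype X] (g : G) :
    fixCount G X g = ∑ x : X, if g • x = x then 1 else 0 := by
  rw [fixCount, Nat.card_eq_fintype_card, Fintype.card_subtype]
  simp

theorem indHom_subtype_one (L : Subgroup G) : indHom L.subtype 1 = fixCount G (G ⧸ L) := by
  have := Fintype.ofFinite G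
  have := Fintype.ofFinite (G ⧸ L)
  funext g
  rw [indHom_subtype_apply, fixCount_eq_sum]
  have := sum_quotient L fun ω => if g • ω = ω then (1 : ℂ) else 0
  rw [inv_mul_eq_iff_eq_mul₀ (natCard_ne_zero_complex L)]
  refine Eq.trans ?_ (this.trans (by congr!))
  refine Finset.sum_congr rfl fun x _ => ?_
  have h1 : g • (x : G ⧸ L) = x ↔ x⁻¹ * g * x ∈ L := by
    rw [MulAction.Quotient.smul_coe, eq_comm, QuotientGroup.eq, smul_eq_mul, mul_assoc]
  simp only [h1, Pi.one_apply, dite_eq_ite]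

/-- The group of permutation characters. -/
def permGroup (G : Type) [Group G] [Finite G] : AddSubgroup (G → ℂ) :=
  AddSubgroup.closure {f | ∃ L : Subgroup G, f = indHom L.subtype 1}

theorem indHom_subtype_one_mem (L : Subgroup G) : indHom L.subtype 1 ∈ permGroup G :=
  AddSubgroup.subset_closure ⟨L, rfl⟩

theorem fixCount_mem_permGroup (X : Type) [MulAction G X] [Finite X] :
    fixCount G X ∈ permGroup G := by
  have := Fintype.ofFinite X
  have := Fintype.ofFinite (MulAction.orbitRel.Quotient G X)
  have key : fixCount G X = ∑ ω : MulAction.orbitRel.Quotient G X,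
      fixCount G (G ⧸ MulAction.stabilizer G ω.out) := by
    funext g
    have := fun ω : MulAction.orbitRel.Quotient G X =>
      Fintype.ofFinite (G ⧸ MulAction.stabilizer G ω.out)
    simp only [Finset.sum_apply, fixCount_eq_sum]
    refine Eq.trans ?_ ((Fintype.sum_sigma' fun (ω : MulAction.orbitRel.Quotient G X)
      (q : G ⧸ MulAction.stabilizer G ω.out) => if g • q = q then (1 : ℂ) else 0).trans
        (by congr!))
    refine (Fintype.sum_equiv (MulAction.selfEquivSigmaOrbitsQuotientStabilizer G X).symm _ _
      ?_).symm
    rintro ⟨ω, q⟩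
    obtain ⟨a, rfl⟩ := QuotientGroup.mk_surjective q
    have h1 : (MulAction.selfEquivSigmaOrbitsQuotientStabilizer G X).symm ⟨ω, a⟩ = a • ω.out :=
      rfl
    have h2 : g • (a : G ⧸ MulAction.stabilizer G ω.out) = a ↔
        g • a • ω.out = a • ω.out := by
      rw [MulAction.Quotient.smul_coe, eq_comm, QuotientGroup.eq, MulAction.mem_stabilizer_iff,
        smul_eq_mul, mul_smul, mul_smul, inv_smul_eq_iff]
    simp only [h1, h2]
  rw [key]
  refine AddSubgroup.sum_mem _ fun ω _ => ?_
  rw [← indHom_subtype_one]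
  exact indHom_subtype_one_mem _

theorem permGroup.comp {f : G → ℂ} (hf : f ∈ permGroup G) (φ : H →* G) :
    f ∘ φ ∈ permGroup H := by
  induction hf using AddSubgroup.closure_induction with
  | mem f h =>
    obtain ⟨L, rfl⟩ := h
    let _ := MulAction.compHom (G ⧸ L) φ
    rw [indHom_subtype_one]
    exact fixCount_mem_permGroup (G := H) (G ⧸ L)
  | zero => exact zero_mem _
  | add f f' _ _ h h' => exact add_mem h h'
  | neg f _ h => exact neg_mem h

theorem permGroup.ind {f : H → ℂ} (hf : f ∈ permGroup H) {φ : H →* G}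
    (hφ : Function.Injective φ) : indHom φ f ∈ permGroup G := by
  induction hf using AddSubgroup.closure_induction with
  | mem f h =>
    obtain ⟨L, rfl⟩ := h
    rw [indHom_comp, indHom_eq_indHom_range (φ := φ.comp L.subtype)
      (hφ.comp L.subtype_injective)]
    exact indHom_subtype_one_mem _
  | zero => rw [indHom_zero]; exact zero_mem _
  | add f f' _ _ h h' => rw [indHom_add]; exact add_mem h h'
  | neg f _ h => rw [indHom_neg]; exact neg_mem h

theorem HasDet.conj_eq {G : Type} [Group G] {f d : G → ℂ} (h : HasDet f d) (x g : G) :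
    f (x⁻¹ * g * x) = f g := by
  obtain ⟨f₁, d₁, f₂, d₂, ⟨_, _, _, ρ, h1, -⟩, ⟨_, _, _, ρ', h1', -⟩, rfl, -⟩ := h
  simp only [Pi.sub_apply, ← h1, ← h1', map_mul]
  rw [Matrix.trace_mul_comm, ← mul_assoc, Matrix.trace_mul_comm (ρ' x⁻¹ * ρ' g),
    ← mul_assoc, ← map_mul, ← map_mul, mul_inv_cancel, one_mul, ← map_mul,
    mul_inv_cancel, map_one, one_mul]

theorem hasDet_fixCount {G : Type} [Group G] (X : Type) [Fintype X] [DecidableEq X]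
    [MulAction G X] :
    HasDet (fixCount G X)
      fun g => ((Equiv.Perm.sign (MulAction.toPermHom G X g) : ℤ) : ℂ) := by
  refine IsTraceDet.hasDet ⟨X, inferInstance, inferInstance,
    Matrix.permMatrixHom.comp (MulAction.toPermHom G X), fun g => ?_, fun g => ?_⟩
  · refine (Matrix.trace_permutation (MulAction.toPermHom G X g)⁻¹).trans ?_
    rw [fixCount, ← Nat.card_coe_set_eq]
    congr 1
    refine Nat.card_congr (Equiv.subtypeEquivRight fun x => ?_)
    rw [← map_inv]
    exact inv_smul_eq_iff.trans eq_comm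
  · refine (Matrix.det_permutation (MulAction.toPermHom G X g)⁻¹).trans ?_
    rw [Equiv.Perm.sign_inv]

theorem permGroup.exists_int {f : G → ℂ} (hf : f ∈ permGroup G) (g : G) : ∃ n : ℤ, f g = n := by
  induction hf using AddSubgroup.closure_induction with
  | mem f h =>
    obtain ⟨L, rfl⟩ := h
    rw [indHom_subtype_one]
    exact ⟨_, (Int.cast_natCast _).symm⟩
  | zero => exact ⟨0, by simp⟩
  | add f f' _ _ h h' =>
    obtain ⟨n, hn⟩ := h
    obtain ⟨n', hn'⟩ := h'
    exact ⟨n + n', by simp [hn, hn']⟩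
  | neg f _ h =>
    obtain ⟨n, hn⟩ := h
    exact ⟨-n, by simp [hn]⟩

theorem inv_out_mul_out_mem {G : Type} [Group G] (L : Subgroup G) (g : G) (j : G ⧸ L) :
    (Quotient.out (g • j))⁻¹ * g * Quotient.out j ∈ L := by
  rw [mul_assoc, ← QuotientGroup.eq, QuotientGroup.out_eq', ← smul_eq_mul,
    ← MulAction.Quotient.smul_coe, QuotientGroup.out_eq']

/-- The cocycle describing multiplication by `g` on coset representatives of `L`. -/
noncomputable def cosetCocycle (L : Subgroup G) (g : G) (j : G ⧸ L) : L :=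
  ⟨(Quotient.out (g • j))⁻¹ * g * Quotient.out j, inv_out_mul_out_mem L g j⟩

theorem cosetCocycle_one {G : Type} [Group G] (L : Subgroup G) (j : G ⧸ L) :
    cosetCocycle L 1 j = 1 := by
  apply Subtype.ext
  simp [cosetCocycle]

theorem cosetCocycle_mul {G : Type} [Group G] (L : Subgroup G) (x y : G) (j : G ⧸ L) :
    cosetCocycle L (x * y) j = cosetCocycle L x (y • j) * cosetCocycle L y j := by
  apply Subtype.ext
  simp [cosetCocycle, mul_smul, mul_assoc]

/-- The monomial matrices of the representation induced from `ρ`. -/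
noncomputable def inducedMatrix {ι : Type} (L : Subgroup G) (ρ : L → Matrix ι ι ℂ) (g : G) :
    Matrix (ι × G ⧸ L) (ι × G ⧸ L) ℂ :=
  Matrix.of fun a b => if a.2 = g • b.2 then ρ (cosetCocycle L g b.2) a.1 b.1 else 0

theorem inducedMatrix_one {G : Type} [Group G] {ι : Type} [DecidableEq ι] [Fintype ι]
    (L : Subgroup G)
    (ρ : L →* Matrix ι ι ℂ) : inducedMatrix L ρ 1 = 1 := by
  ext ⟨a, i⟩ ⟨b, j⟩
  simp only [inducedMatrix, Matrix.of_apply, one_smul, Matrix.one_apply, Prod.mk.injEq,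
    cosetCocycle_one, map_one]
  by_cases h1 : i = j <;> simp [h1]

theorem inducedMatrix_mul {G : Type} [Group G] {ι : Type} [DecidableEq ι] [Fintype ι]
    (L : Subgroup G)
    [Fintype (G ⧸ L)] (ρ : L →* Matrix ι ι ℂ) (x y : G) :
    inducedMatrix L ρ (x * y) = inducedMatrix L ρ x * inducedMatrix L ρ y := by
  ext ⟨a, i⟩ ⟨b, j⟩
  rw [Matrix.mul_apply, Fintype.sum_prod_type_right, Fintype.sum_eq_single (y • j)]
  · simp only [inducedMatrix, Matrix.of_apply, smul_smul, if_true]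
    split_ifs with h1
    · rw [cosetCocycle_mul, map_mul, Matrix.mul_apply]
    · simp
  · intro k hk
    refine Finset.sum_eq_zero fun c _ => ?_
    simp [inducedMatrix, hk]

theorem inducedMatrix_trace {ι : Type} [DecidableEq ι] [Fintype ι] (L : Subgroup G)
    [Fintype (G ⧸ L)] (ρ : L →* Matrix ι ι ℂ) (g : G) :
    (inducedMatrix L ρ g).trace = indHom L.subtype (fun h => (ρ h).trace) g := by
  have := Fintype.ofFinite G
  let τ : G → ℂ := fun x => if h : x ∈ L then (ρ ⟨x, h⟩).trace else 0
  have hτ : ∀ (x : G) (l : L), τ ((l : G)⁻¹ * x * l) = τ x := by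
    intro x l
    by_cases hx : x ∈ L
    · have hx' : (l : G)⁻¹ * x * l ∈ L := mul_mem (mul_mem (inv_mem l.2) hx) l.2
      simp only [τ, hx, hx', dite_true]
      have : (⟨(l : G)⁻¹ * x * l, hx'⟩ : L) = l⁻¹ * ⟨x, hx⟩ * l := rfl
      rw [this, map_mul, Matrix.trace_mul_comm, ← map_mul, mul_inv_cancel_left]
    · have hx' : (l : G)⁻¹ * x * l ∉ L := by
        rwa [Subgroup.mul_mem_cancel_right _ l.2, Subgroup.mul_mem_cancel_left _ (inv_mem l.2)]
      simp [τ, hx, hx']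
  have h1 := sum_quotient L fun ω => τ ((Quotient.out ω)⁻¹ * g * Quotient.out ω)
  have h2 : ∀ x : G, τ ((Quotient.out (x : G ⧸ L))⁻¹ * g * Quotient.out (x : G ⧸ L)) =
      τ (x⁻¹ * g * x) := by
    intro x
    obtain ⟨l, hl⟩ := QuotientGroup.mk_out_eq_mul L x
    rw [← hτ (x⁻¹ * g * x) l, hl]
    congr 1
    group
  simp only [h2] at h1
  rw [indHom_subtype_apply]
  change _ = _ * ∑ x : G, τ (x⁻¹ * g * x)
  rw [h1, inv_mul_cancel_left₀ (natCard_ne_zero_complex L), Matrix.trace,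
    Fintype.sum_prod_type_right]
  refine Finset.sum_congr rfl fun ω _ => ?_
  have h3 : (Quotient.out ω)⁻¹ * g * Quotient.out ω ∈ L ↔ ω = g • ω := by
    rw [mul_assoc, ← QuotientGroup.eq, QuotientGroup.out_eq', ← smul_eq_mul,
      ← MulAction.Quotient.smul_coe, QuotientGroup.out_eq']
  simp only [inducedMatrix, Matrix.of_apply, Matrix.diag_apply, τ, h3]
  split_ifs with h4
  · have h5 : cosetCocycle L g ω = ⟨(Quotient.out ω)⁻¹ * g * Quotient.out ω, h3.2 h4⟩ :=
      Subtype.ext (by simp [cosetCocycle, ← h4])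
    simp only [h5, Matrix.trace, Matrix.diag_apply]
  · simp

theorem inducedMatrix_det {G : Type} [Group G] {ι : Type} [DecidableEq ι] [Fintype ι]
    (L : Subgroup G)
    [Fintype (G ⧸ L)] (ρ : L →* Matrix ι ι ℂ) (g : G) :
    (inducedMatrix L ρ g).det = ((Equiv.Perm.sign (Equiv.prodCongr (Equiv.refl ι)
      (MulAction.toPerm g⁻¹ : Equiv.Perm (G ⧸ L))) : ℤ) : ℂ) *
        ∏ j, (ρ (cosetCocycle L g j)).det := by
  have : inducedMatrix L ρ g = (Matrix.blockDiagonal fun j => ρ (cosetCocycle L g j)).submatrix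
      (Equiv.prodCongr (Equiv.refl ι) (MulAction.toPerm g⁻¹ : Equiv.Perm (G ⧸ L))) id := by
    ext ⟨a, i⟩ ⟨b, j⟩
    simp only [inducedMatrix, Matrix.of_apply, Matrix.submatrix_apply, Equiv.prodCongr_apply,
      Prod.map_apply, Equiv.refl_apply, MulAction.toPerm_apply, id_eq,
      Matrix.blockDiagonal_apply, inv_smul_eq_iff]
    split_ifs with h
    · subst h
      simp
    · rfl
  rw [this, Matrix.det_permute, Matrix.det_blockDiagonal]

/-- Induction preserves generalised characters of degree `0` and trivial determinant. -/
theorem HasDet.indHom_subtype {L : Subgroup G} {τ : L → ℂ} (h : HasDet τ 1) (h0 : τ 1 = 0) :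
    HasDet (indHom L.subtype τ) 1 := by
  have := Fintype.ofFinite (G ⧸ L)
  obtain ⟨f₁, d₁, f₂, d₂, ⟨ι, _, _, ρ, h1, h2⟩, ⟨ι', _, _, ρ', h1', h2'⟩, rfl, h3⟩ := h
  obtain rfl : (fun g => (ρ g).trace) = f₁ := funext h1
  obtain rfl : (fun g => (ρ' g).trace) = f₂ := funext h1'
  have hcard : Fintype.card ι = Fintype.card ι' := by
    simp only [Pi.sub_apply, map_one, Matrix.trace_one, sub_eq_zero] at h0
    exact_mod_cast h0
  refine ⟨_, fun g => (inducedMatrix L ρ g).det, _, fun g => (inducedMatrix L ρ' g).det,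
    ⟨ι × G ⧸ L, inferInstance, inferInstance, ⟨⟨inducedMatrix L ρ, inducedMatrix_one L ρ⟩,
      inducedMatrix_mul L ρ⟩, inducedMatrix_trace L ρ, fun _ => rfl⟩,
    ⟨ι' × G ⧸ L, inferInstance, inferInstance, ⟨⟨inducedMatrix L ρ', inducedMatrix_one L ρ'⟩,
      inducedMatrix_mul L ρ'⟩, inducedMatrix_trace L ρ', fun _ => rfl⟩, indHom_sub _ _ _, ?_⟩
  funext g
  simp only [one_mul] at h3 ⊢
  rw [inducedMatrix_det, inducedMatrix_det]
  simp only [h2, h2', h3]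
  congr 3
  let e := Fintype.equivOfCardEq hcard
  exact Equiv.Perm.sign_eq_sign_of_equiv _ _ (Equiv.prodCongr e.symm (Equiv.refl _)) fun _ => rfl

theorem HasDet.indHom {φ : H →* G} (hφ : Function.Injective φ) {τ : H → ℂ} (h : HasDet τ 1)
    (h0 : τ 1 = 0) : HasDet (indHom φ τ) 1 := by
  rw [indHom_eq_indHom_range hφ]
  exact (h.comp (MonoidHom.ofInjective hφ).symm.toMonoidHom).indHom_subtype (by simpa using h0)

end Permutation

section Basic

variable {G H K : Type} [Group G] [Group H] [Group K] [Finite G] [Finite H] [Finite K]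

/-- Functions induced from real generalised characters of degree `0` and trivial determinant
that factor through a cyclic or a target group. -/
inductive IsBasic (G : Type) [Group G] [Finite G] : (G → ℂ) → Prop
  | mk {H Q : Type} [Group H] [Group Q] [Finite H] (φ : H →* G) (π : H →* Q) (τ : Q → ℂ)
      (hφ : Function.Injective φ) (hπ : Function.Surjective π)
      (hQ : IsCyclic Q ∨ IsTargetGroup Q) (hreal : ∀ q, starRingEnd ℂ (τ q) = τ q)
      (h0 : τ 1 = 0) (hdet : HasDet τ 1) : IsBasic G (indHom φ (τ ∘ π))

/-- The group generated by the basic functions. -/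
def basicGroup (G : Type) [Group G] [Finite G] : AddSubgroup (G → ℂ) :=
  AddSubgroup.closure {f | IsBasic G f}

theorem indHom_apply_one {φ : H →* G} (hφ : Function.Injective φ) {f : H → ℂ} (h0 : f 1 = 0) :
    indHom φ f 1 = 0 := by
  have := Fintype.ofFinite G
  have := Fintype.ofFinite H
  rw [indHom_apply]
  refine mul_eq_zero_of_right _ (Finset.sum_eq_zero fun x _ => Finset.sum_eq_zero fun h _ => ?_)
  split_ifs with e
  · rw [mul_one, inv_mul_cancel, ← map_one φ, hφ.eq_iff] at e
    rw [e, h0]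
  · rfl

theorem indHom_id {f : G → ℂ} (hf : ∀ x g, f (x⁻¹ * g * x) = f g) :
    indHom (MonoidHom.id G) f = f := by
  have := Fintype.ofFinite G
  funext g
  rw [indHom_apply]
  simp only [MonoidHom.id_apply, Finset.sum_ite_eq', Finset.mem_univ, if_true, hf]
  rw [Finset.sum_const, Finset.card_univ, nsmul_eq_mul, ← Nat.card_eq_fintype_card,
    inv_mul_cancel_left₀ (natCard_ne_zero_complex G)]

theorem basicGroup.hasDet {f : G → ℂ} (hf : f ∈ basicGroup G) : HasDet f 1 := by
  induction hf using AddSubgroup.closure_induction with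
  | mem f h =>
    obtain ⟨φ, π, τ, hφ, hπ, hQ, hreal, h0, hdet⟩ := h
    exact (hdet.comp π).indHom hφ (by simpa using h0)
  | zero => exact .zero
  | add f f' _ _ h h' => simpa using h.add h'
  | neg f _ h => simpa using h.neg

theorem basicGroup.apply_one {f : G → ℂ} (hf : f ∈ basicGroup G) : f 1 = 0 := by
  induction hf using AddSubgroup.closure_induction with
  | mem f h =>
    obtain ⟨φ, π, τ, hφ, hπ, hQ, hreal, h0, hdet⟩ := h
    exact indHom_apply_one hφ (by simpa using h0)
  | zero => rfl
  | add f f' _ _ h h' => simp [h, h']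
  | neg f _ h => simp [h]

theorem basicGroup.ind {f : H → ℂ} (hf : f ∈ basicGroup H) {ψ : H →* G}
    (hψ : Function.Injective ψ) : indHom ψ f ∈ basicGroup G := by
  induction hf using AddSubgroup.closure_induction with
  | mem f h =>
    obtain ⟨φ, π, τ, hφ, hπ, hQ, hreal, h0, hdet⟩ := h
    rw [indHom_comp]
    exact AddSubgroup.subset_closure ⟨_, π, τ, hψ.comp hφ, hπ, hQ, hreal, h0, hdet⟩
  | zero => rw [indHom_zero]; exact zero_mem _
  | add f f' _ _ h h' => rw [indHom_add]; exact add_mem h h'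
  | neg f _ h => rw [indHom_neg]; exact neg_mem h

theorem pullback_fst_injective {G H K : Type} [Group G] [Group H] [Group K]
    (p : G →* K) {φ : H →* K} (hφ : Function.Injective φ) :
    Function.Injective ((MonoidHom.fst G H).comp (pullback p φ).subtype) := by
  rintro ⟨⟨a, h⟩, hw⟩ ⟨⟨a', h'⟩, hw'⟩ e
  obtain rfl : a = a' := e
  have h1 : p a = φ h := hw
  have h2 : p a = φ h' := hw'
  have : h = h' := hφ (h1.symm.trans h2)
  subst this
  rfl

theorem pullback_snd_surjective {G H K : Type} [Group G] [Group H] [Group K]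
    {p : G →* K} (hp : Function.Surjective p) (φ : H →* K) :
    Function.Surjective ((MonoidHom.snd G H).comp (pullback p φ).subtype) := by
  intro h
  obtain ⟨a, ha⟩ := hp (φ h)
  exact ⟨⟨(a, h), ha⟩, rfl⟩

theorem basicGroup.inflate {f : K → ℂ} (hf : f ∈ basicGroup K) {p : G →* K}
    (hp : Function.Surjective p) : f ∘ p ∈ basicGroup G := by
  induction hf using AddSubgroup.closure_induction with
  | mem f h =>
    obtain ⟨φ, π, τ, hφ, hπ, hQ, hreal, h0, hdet⟩ := h
    rw [indHom_comp_surjective hp]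
    exact AddSubgroup.subset_closure (IsBasic.mk _
      (π.comp ((MonoidHom.snd _ _).comp (pullback p φ).subtype)) τ
      (pullback_fst_injective p hφ) (hπ.comp (pullback_snd_surjective hp φ)) hQ hreal h0 hdet)
  | zero => exact zero_mem _
  | add f f' _ _ h h' => exact add_mem h h'
  | neg f _ h => exact neg_mem h

theorem mem_basicGroup_of_factors {Q : Type} [Group Q] {π : G →* Q}
    (hπ : Function.Surjective π) (hQ : IsCyclic Q ∨ IsTargetGroup Q) {τ : Q → ℂ}
    (hreal : ∀ q, starRingEnd ℂ (τ q) = τ q) (h0 : τ 1 = 0) (hdet : HasDet τ 1) :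
    τ ∘ π ∈ basicGroup G := by
  have := AddSubgroup.subset_closure
    (IsBasic.mk (MonoidHom.id G) π τ Function.injective_id hπ hQ hreal h0 hdet)
  rwa [indHom_id (hdet.comp π).conj_eq] at this

/-- The complex function attached to a quadratic character. -/
def signFun (ε : G →* ℤˣ) : G → ℂ := fun g => ((ε g : ℤ) : ℂ)

theorem hasDet_signFun {G : Type} [Group G] (ε : G →* ℤˣ) : HasDet (signFun ε) (signFun ε) :=
  (IsTraceDet.ofLinear ((Int.castRingHom ℂ).toMonoidHom.comp ((Units.coeHom ℤ).comp ε))).hasDet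

theorem signFun_mul {G : Type} [Group G] (ε ε' : G →* ℤˣ) :
    signFun (ε * ε') = signFun ε * signFun ε' := by
  funext g
  simp [signFun]

theorem signFun_one {G : Type} [Group G] : signFun (1 : G →* ℤˣ) = 1 := by
  funext g
  simp [signFun]

theorem signFun_mul_self {G : Type} [Group G] (ε : G →* ℤˣ) : signFun ε * signFun ε = 1 := by
  funext g
  have : (ε g : ℤ) * (ε g : ℤ) = 1 := by
    rw [← Units.val_mul, Int.units_mul_self, Units.val_one]
  simp only [signFun, Pi.mul_apply, Pi.one_apply]
  exact_mod_cast this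

theorem signFun_inv {G : Type} [Group G] (ε : G →* ℤˣ) : (signFun ε)⁻¹ = signFun ε :=
  inv_eq_of_mul_eq_one_right (signFun_mul_self ε)

theorem signFun_injective {G : Type} [Group G] {ε ε' : G →* ℤˣ}
    (h : signFun ε = signFun ε') : ε = ε' := by
  ext g
  have := congrFun h g
  simpa [signFun] using this

end Basic

section Good

variable {G H K : Type} [Group G] [Group H] [Group K] [Finite G] [Finite H] [Finite K]

theorem isCyclic_or_isTargetGroup_of_card_dvd_four (h : Nat.card G ∣ 4) :
    IsCyclic G ∨ IsTargetGroup G := by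
  have h4 : Nat.card G = 1 ∨ Nat.card G = 2 ∨ Nat.card G = 4 := by
    have : Nat.card G ≤ 4 := Nat.le_of_dvd (by norm_num) h
    interval_cases hc : Nat.card G <;> revert h <;> decide
  rcases h4 with h1 | h2 | h4
  · have := (Nat.card_eq_one_iff_unique.mp h1).1
    exact Or.inl inferInstance
  · have : Fact (Nat.Prime 2) := ⟨Nat.prime_two⟩
    exact Or.inl (isCyclic_of_prime_card h2)
  · by_cases hc : IsCyclic G
    · exact Or.inl hc
    · have hexp : ∀ x : G, x * x = 1 := by
        intro x
        have h5 : orderOf x ∣ 4 := h4 ▸ orderOf_dvd_natCard x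
        have h6 : orderOf x ≠ 4 := fun h6 => hc (isCyclic_of_orderOf_eq_card x (h6.trans h4.symm))
        have h7 : orderOf x ∣ 2 := by
          have : orderOf x ≤ 4 := Nat.le_of_dvd (by norm_num) h5
          interval_cases orderOf x <;> revert h5 h6 <;> decide
        rw [← pow_two]
        exact orderOf_dvd_iff_pow_eq_one.mp h7
      have h8 : Monoid.exponent G ∣ 2 :=
        Monoid.exponent_dvd_of_forall_pow_eq_one fun x => by rw [pow_two, hexp]
      have : IsKleinFour G := by
        refine ⟨h4, ((Nat.dvd_prime Nat.prime_two).mp h8).resolve_left fun h9 => ?_⟩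
        have h9 := Monoid.exp_eq_one_iff.mp h9
        have := Nat.card_eq_one_iff_unique.mpr ⟨h9, ⟨1⟩⟩
        omega
      exact Or.inr (Or.inl IsKleinFour.nonempty_mulEquiv)

theorem signFun_add_sub_mem (ε ε' : G →* ℤˣ) :
    signFun ε + signFun ε' - 1 - signFun (ε * ε') ∈ basicGroup G := by
  let Q := (ε.prod ε').range
  let τ : Q → ℂ := fun q => signFun ((MonoidHom.fst ℤˣ ℤˣ).comp Q.subtype) q +
    signFun ((MonoidHom.snd ℤˣ ℤˣ).comp Q.subtype) q - 1 -
    signFun ((MonoidHom.fst ℤˣ ℤˣ).comp Q.subtype * (MonoidHom.snd ℤˣ ℤˣ).comp Q.subtype) q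
  have key : τ ∘ (ε.prod ε').rangeRestrict ∈ basicGroup G := by
    refine mem_basicGroup_of_factors (ε.prod ε').rangeRestrict_surjective
      (isCyclic_or_isTargetGroup_of_card_dvd_four ?_) ?_ ?_ ?_
    · refine (Subgroup.card_subgroup_dvd_card _).trans ?_
      rw [Nat.card_prod, Nat.card_eq_fintype_card]
      decide
    · intro q
      simp [τ, signFun]
    · simp [τ, signFun]
    · have := (((hasDet_signFun ((MonoidHom.fst ℤˣ ℤˣ).comp Q.subtype)).add
        (hasDet_signFun ((MonoidHom.snd ℤˣ ℤˣ).comp Q.subtype))).sub HasDet.one).sub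
        (hasDet_signFun ((MonoidHom.fst ℤˣ ℤˣ).comp Q.subtype *
          (MonoidHom.snd ℤˣ ℤˣ).comp Q.subtype))
      rw [signFun_inv, inv_one, mul_one, signFun_mul,
        mul_mul_mul_comm, signFun_mul_self, signFun_mul_self, one_mul] at this
      rw [← signFun_mul] at this
      exact this
  have e : signFun ε + signFun ε' - 1 - signFun (ε * ε') =
      τ ∘ (ε.prod ε').rangeRestrict := rfl
  rwa [e]

/-- Functions which agree with an integer plus a quadratic character modulo the basic group. -/
def goodGroup (G : Type) [Group G] [Finite G] : AddSubgroup (G → ℂ) where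
  carrier := {f | ∃ (n : ℤ) (ε : G →* ℤˣ), f - n • 1 - signFun ε ∈ basicGroup G}
  zero_mem' := ⟨-1, 1, by simp [signFun_one]⟩
  add_mem' := by
    rintro f f' ⟨n, ε, h⟩ ⟨n', ε', h'⟩
    refine ⟨n + n' + 1, ε * ε', ?_⟩
    convert add_mem (add_mem h h') (signFun_add_sub_mem ε ε') using 1
    simp only [add_smul, one_smul]
    abel
  neg_mem' := by
    rintro f ⟨n, ε, h⟩
    refine ⟨-n - 2, ε, ?_⟩
    have := signFun_add_sub_mem ε ε
    rw [signFun_mul, signFun_mul_self] at this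
    convert sub_mem (neg_mem h) this using 1
    simp only [sub_smul, neg_smul, two_smul]
    abel

theorem basicGroup_le_goodGroup : basicGroup G ≤ goodGroup G := fun f hf =>
  ⟨-1, 1, by simpa [signFun_one] using hf⟩

theorem signFun_mem_goodGroup (ε : G →* ℤˣ) : signFun ε ∈ goodGroup G :=
  ⟨0, ε, by simp⟩

theorem one_mem_goodGroup : (1 : G → ℂ) ∈ goodGroup G := by
  rw [← signFun_one]
  exact signFun_mem_goodGroup 1

/-- A good function of degree `0` and trivial determinant is a combination of basic ones. -/
theorem goodGroup.mem_basicGroup {f : G → ℂ} (hf : f ∈ goodGroup G) (h0 : f 1 = 0)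
    (hdet : HasDet f 1) : f ∈ basicGroup G := by
  obtain ⟨n, ε, h⟩ := hf
  have h1 := basicGroup.hasDet h
  have h2 := (hdet.sub (HasDet.one.zsmul n)).sub (hasDet_signFun ε)
  have h3 := h1.det_eq h2
  simp only [one_zpow, inv_one, one_mul, signFun_inv] at h3
  rw [← signFun_one] at h3
  obtain rfl := signFun_injective h3
  have h4 := basicGroup.apply_one h
  have h5 : n = -1 := by
    simp only [signFun_one, Pi.sub_apply, h0, Pi.smul_apply, Pi.one_apply] at h4
    have : (n : ℂ) = (-1 : ℤ) := by
      simp only [zsmul_eq_mul] at h4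
      push_cast
      linear_combination -h4
    exact_mod_cast this
  subst h5
  simpa [signFun_one] using h

theorem goodGroup.inflate {f : K → ℂ} (hf : f ∈ goodGroup K) {p : G →* K}
    (hp : Function.Surjective p) : f ∘ p ∈ goodGroup G := by
  obtain ⟨n, ε, h⟩ := hf
  exact ⟨n, ε.comp p, basicGroup.inflate h hp⟩

/-- Permutation characters of cyclic and target groups are good. -/
theorem permGroup_le_goodGroup_of_base (hG : IsCyclic G ∨ IsTargetGroup G) :
    permGroup G ≤ goodGroup G := by
  refine (AddSubgroup.closure_le _).mpr ?_
  rintro f ⟨L, rfl⟩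
  have := Fintype.ofFinite (G ⧸ L)
  obtain ⟨n, hn⟩ := permGroup.exists_int (indHom_subtype_one_mem L) 1
  refine ⟨n - 1, Equiv.Perm.sign.comp (MulAction.toPermHom G (G ⧸ L)), ?_⟩
  have h1 := hasDet_fixCount (G := G) (G ⧸ L)
  rw [← indHom_subtype_one] at h1
  have h2 := (h1.sub (HasDet.one.zsmul (n - 1))).sub
    (hasDet_signFun (Equiv.Perm.sign.comp (MulAction.toPermHom G (G ⧸ L))))
  rw [signFun_inv, one_zpow, inv_one, mul_one] at h2
  refine mem_basicGroup_of_factors (π := MonoidHom.id G) Function.surjective_id hG ?_ ?_ ?_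
  · intro q
    obtain ⟨m, hm⟩ := permGroup.exists_int (indHom_subtype_one_mem L) q
    simp [hm, signFun]
  · simp only [Pi.sub_apply, hn, signFun, map_one, Pi.smul_apply, Pi.one_apply]
    simp
  · convert h2
    exact (signFun_mul_self (Equiv.Perm.sign.comp (MulAction.toPermHom G (G ⧸ L)))).symm

end Good

section Reductions

variable {G H K : Type} [Group G] [Group H] [Group K] [Finite G] [Finite H] [Finite K]

theorem indHom_one_eq {φ : H →* G} (hφ : Function.Injective φ) {L : Subgroup G}
    (h : φ.range = L) : indHom φ 1 = indHom L.subtype 1 := by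
  subst h
  rw [indHom_eq_indHom_range hφ]
  rfl

theorem indHom_subtype_one_mem_goodGroup_of_le {N L : Subgroup G} [N.Normal] (hN : N ≤ L)
    (h : indHom (L.map (QuotientGroup.mk' N)).subtype 1 ∈ goodGroup (G ⧸ N)) :
    indHom L.subtype 1 ∈ goodGroup G := by
  have h1 := goodGroup.inflate h (QuotientGroup.mk'_surjective N)
  rw [indHom_comp_surjective (QuotientGroup.mk'_surjective N)] at h1
  have h2 : ((MonoidHom.fst G (L.map (QuotientGroup.mk' N))).comp
      (pullback (QuotientGroup.mk' N) (L.map (QuotientGroup.mk' N)).subtype).subtype).range =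
        L := by
    ext x
    constructor
    · rintro ⟨⟨⟨a, b⟩, hw⟩, rfl⟩
      obtain ⟨b, y, hy, rfl⟩ := b
      have hw' : (a : G ⧸ N) = y := hw
      rw [eq_comm, QuotientGroup.eq] at hw'
      have := mul_mem hy (hN hw')
      simpa using this
    · intro hx
      exact ⟨⟨(x, ⟨_, x, hx, rfl⟩), rfl⟩, rfl⟩
  rw [← indHom_one_eq (pullback_fst_injective _ (Subgroup.subtype_injective _)) h2]
  exact h1

theorem signFun_eq_indHom_ker_sub_one {ε : G →* ℤˣ} (hε : ε ≠ 1) :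
    signFun ε = indHom ε.ker.subtype 1 - 1 := by
  have := Fintype.ofFinite G
  have hcard : (Nat.card G : ℂ) = 2 * Nat.card ε.ker := by
    have h1 : Nat.card ε.range = 2 := by
      have h2 : ε.range ≠ ⊥ := fun h => hε (ε.range_eq_bot_iff.mp h)
      have h3 : Nat.card ε.range ∣ 2 := by
        have := Subgroup.card_subgroup_dvd_card ε.range
        rwa [Nat.card_eq_fintype_card (α := ℤˣ), Fintype.card_units_int] at this
      refine ((Nat.dvd_prime Nat.prime_two).mp h3).resolve_left fun h4 => h2 ?_
      exact Subgroup.card_eq_one.mp h4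
    have h5 := ε.ker.index_mul_card
    rw [Subgroup.index_ker, h1] at h5
    rw [← h5]
    push_cast
    ring
  funext g
  have h6 : ∀ x : G, x⁻¹ * g * x ∈ ε.ker ↔ ε g = 1 := by
    intro x
    rw [MonoidHom.mem_ker, map_mul, map_mul, map_inv, mul_comm, mul_inv_cancel_left]
  simp only [Pi.sub_apply, indHom_subtype_apply, h6, Pi.one_apply, dite_eq_ite,
    Finset.sum_const, Finset.card_univ, signFun]
  rw [← Nat.card_eq_fintype_card, nsmul_eq_mul, hcard]
  have h7 := natCard_ne_zero_complex ε.ker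
  rcases Int.units_eq_one_or (ε g) with h | h
  · generalize (Nat.card ε.ker : ℂ) = c at h7 ⊢
    rw [h, if_pos rfl, Units.val_one, Int.cast_one, mul_one, mul_comm, mul_assoc,
      mul_inv_cancel₀ h7]
    norm_num
  · rw [h, if_neg (by decide)]
    simp

theorem indHom_subtype_one_mem_goodGroup_of_ker {L K : Subgroup G} (hL : L ≤ K)
    (hK : permGroup K ≤ goodGroup K)
    (h : ∀ ε : K →* ℤˣ, indHom (ε.ker.map K.subtype).subtype 1 ∈ goodGroup G) :
    indHom L.subtype 1 ∈ goodGroup G := by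
  have h1 := hK (indHom_subtype_one_mem (L.subgroupOf K))
  have h2 : ∀ M : Subgroup K, indHom K.subtype (indHom M.subtype 1) =
      indHom (M.map K.subtype).subtype 1 := by
    intro M
    rw [indHom_comp]
    refine indHom_one_eq (φ := K.subtype.comp M.subtype)
      (K.subtype_injective.comp M.subtype_injective) ?_
    rw [MonoidHom.range_comp, Subgroup.range_subtype]
  have h3 : indHom K.subtype 1 ∈ goodGroup G := by
    have := h 1
    rwa [MonoidHom.ker_one, ← MonoidHom.range_eq_map, Subgroup.range_subtype] at this
  have h4 : ∀ ε : K →* ℤˣ, indHom K.subtype (signFun ε) ∈ goodGroup G := by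
    intro ε
    by_cases hε : ε = 1
    · rwa [hε, signFun_one]
    · rw [signFun_eq_indHom_ker_sub_one hε, indHom_sub, h2]
      exact sub_mem (h ε) h3
  obtain ⟨n, ε, h5⟩ := h1
  have h6 := basicGroup_le_goodGroup (basicGroup.ind h5 K.subtype_injective)
  have h7 : indHom K.subtype (n • 1) = n • indHom K.subtype 1 :=
    map_zsmul (indAddHom K.subtype) n 1
  rw [indHom_sub, indHom_sub, h2, h7, Subgroup.map_subgroupOf_eq_of_le hL] at h6
  have h8 := add_mem (add_mem h6 (h4 ε)) (zsmul_mem h3 n)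
  simpa using h8

end Reductions

section Frobenius

variable {G : Type} [Group G] [Finite G] {q : ℕ} [NeZero q]

/-- The additive character `i ↦ exp (2π i u / q)` as a function on a multiplicative group. -/
noncomputable def rootFun (u : ZMod q) : Multiplicative (ZMod q) → ℂ :=
  fun i => ZMod.stdAddChar (u * i.toAdd)

theorem rootFun_one (u : ZMod q) : rootFun u 1 = 1 := by simp [rootFun]

theorem rootFun_zero : rootFun (0 : ZMod q) = 1 := by
  funext i
  simp [rootFun]

theorem rootFun_neg (u : ZMod q) : rootFun (-u) = (rootFun u)⁻¹ := by
  funext i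
  simp [rootFun, AddChar.map_neg_eq_inv]

theorem conj_rootFun (u : ZMod q) (i : Multiplicative (ZMod q)) :
    starRingEnd ℂ (rootFun u i) = rootFun (-u) i := by
  simp [rootFun, AddChar.map_neg_eq_conj]

theorem hasDet_rootFun (u : ZMod q) : HasDet (rootFun u) (rootFun u) :=
  (IsTraceDet.ofLinear
    { toFun := rootFun u
      map_one' := rootFun_one u
      map_mul' := fun i j => by simp [rootFun, mul_add, AddChar.map_add_eq_mul] }).hasDet

theorem indHom_rootFun_add_neg_mem {κ : Multiplicative (ZMod q) →* G}
    (hκ : Function.Injective κ) (hC : indHom κ 1 ∈ goodGroup G) (u : ZMod q) :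
    indHom κ (rootFun u) + indHom κ (rootFun (-u)) ∈ goodGroup G := by
  have h1 : indHom κ ((rootFun u + rootFun (-u) - 1 - 1) ∘ MonoidHom.id _) ∈ basicGroup G := by
    refine AddSubgroup.subset_closure (IsBasic.mk κ (MonoidHom.id _) _ hκ
      Function.surjective_id (Or.inl inferInstance) ?_ ?_ ?_)
    · intro i
      simp only [Pi.sub_apply, Pi.add_apply, map_sub, map_add, conj_rootFun, Pi.one_apply, map_one,
        neg_neg]
      ring
    · simp [rootFun_one]
    · convert (((hasDet_rootFun u).add (hasDet_rootFun (-u))).sub HasDet.one).sub HasDet.one using 1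
      funext i
      simp only [rootFun_neg, Pi.one_apply, Pi.mul_apply, Pi.inv_apply, inv_one, mul_one]
      rw [mul_inv_cancel₀]
      simp only [rootFun]
      exact (AddChar.val_isUnit _ _).ne_zero
  simp only [MonoidHom.coe_id, Function.comp_id, indHom_sub, indHom_add] at h1
  have h2 := add_mem (add_mem (basicGroup_le_goodGroup h1) hC) hC
  simpa using h2

/-- The inclusion of the rotations into a dihedral group. -/
def dihedralRotation (q : ℕ) :
    Multiplicative (ZMod q) →* DihedralGroup q where
  toFun i := .r i.toAdd
  map_one' := rfl
  map_mul' _ _ := (DihedralGroup.r_mul_r _ _).symm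

theorem dihedralRotation_apply (q : ℕ) (i : Multiplicative (ZMod q)) :
    dihedralRotation q i = .r i.toAdd := rfl

/-- The two-dimensional representation of a dihedral group with parameter `u`. -/
noncomputable def dihedralRep (u : ZMod q) : DihedralGroup q →* Matrix (Fin 2) (Fin 2) ℂ where
  toFun
    | .r i => !![ZMod.stdAddChar (u * i), 0; 0, ZMod.stdAddChar (-(u * i))]
    | .sr i => !![0, ZMod.stdAddChar (-(u * i)); ZMod.stdAddChar (u * i), 0]
  map_one' := by
    rw [DihedralGroup.one_def]
    ext a b
    fin_cases a <;> fin_cases b <;> simp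
  map_mul' := by
    rintro (i | i) (j | j) <;>
    simp only [DihedralGroup.r_mul_r, DihedralGroup.r_mul_sr, DihedralGroup.sr_mul_r,
      DihedralGroup.sr_mul_sr, Matrix.mul_fin_two, mul_zero, zero_mul, add_zero, zero_add,
      ← AddChar.map_add_eq_mul] <;>
    ring_nf

theorem indHom_dihedralRotation_r (u i : ZMod q) :
    indHom (dihedralRotation q) (rootFun u) (.r i) =
      ZMod.stdAddChar (u * i) + ZMod.stdAddChar (-(u * i)) := by
  have h0 : (Nat.card (Multiplicative (ZMod q)) : ℂ) ≠ 0 := natCard_ne_zero_complex _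
  have h1 : (Nat.card (Multiplicative (ZMod q)) : ℂ) = q := by
    rw [Nat.card_eq_fintype_card, Fintype.card_multiplicative, ZMod.card]
  rw [h1] at h0
  rw [indHom_apply, h1, ← DihedralGroup.equivSum.symm.sum_comp, Fintype.sum_sum_type]
  have h2 : ∀ a : ZMod q, (∑ j, if dihedralRotation q j =
      (DihedralGroup.equivSum.symm (.inl a))⁻¹ *
      .r i * DihedralGroup.equivSum.symm (.inl a) then rootFun u j else 0) =
        ZMod.stdAddChar (u * i) := by
    intro a
    rw [Finset.sum_eq_single (Multiplicative.ofAdd i)]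
    · rw [if_pos]
      · rfl
      · simp [dihedralRotation_apply]
    · intro j _ hj
      rw [if_neg]
      contrapose! hj
      apply Multiplicative.toAdd.injective
      simpa [dihedralRotation_apply] using hj
    · simp
  have h3 : ∀ a : ZMod q, (∑ j, if dihedralRotation q j =
      (DihedralGroup.equivSum.symm (.inr a))⁻¹ *
      .r i * DihedralGroup.equivSum.symm (.inr a) then rootFun u j else 0) =
        ZMod.stdAddChar (-(u * i)) := by
    intro a
    rw [Finset.sum_eq_single (Multiplicative.ofAdd (-i))]
    · rw [if_pos]
      · simp [rootFun]
      · simp [dihedralRotation_apply]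
    · intro j _ hj
      rw [if_neg]
      contrapose! hj
      apply Multiplicative.toAdd.injective
      simpa [dihedralRotation_apply] using hj
    · simp
  trans (q : ℂ)⁻¹ * ((∑ _a : ZMod q, ZMod.stdAddChar (u * i)) +
    ∑ _a : ZMod q, ZMod.stdAddChar (-(u * i)))
  · congr 2
    · exact Finset.sum_congr rfl fun a _ => by convert h2 a
    · exact Finset.sum_congr rfl fun a _ => by convert h3 a
  · simp only [Finset.sum_const, Finset.card_univ, ZMod.card, nsmul_eq_mul]
    rw [← mul_add, inv_mul_cancel_left₀ h0]

theorem indHom_dihedralRotation_sr (u i : ZMod q) :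
    indHom (dihedralRotation q) (rootFun u) (.sr i) = 0 := by
  rw [indHom_apply]
  refine mul_eq_zero_of_right _ (Finset.sum_eq_zero fun x _ => Finset.sum_eq_zero fun j _ => ?_)
  rw [if_neg]
  rcases x with a | a <;> simp [dihedralRotation_apply]

theorem hasDet_indHom_dihedralRotation_sub (u : ZMod q) :
    HasDet (indHom (dihedralRotation q) (rootFun u) - indHom (dihedralRotation q) 1) 1 := by
  have h : ∀ u : ZMod q, IsTraceDet (indHom (dihedralRotation q) (rootFun u))
      (fun x => (dihedralRep (0 : ZMod q) x).det) := by
    intro u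
    refine ⟨Fin 2, inferInstance, inferInstance, dihedralRep u, ?_, ?_⟩
    · rintro (i | i)
      · rw [indHom_dihedralRotation_r]
        simp [dihedralRep, Matrix.trace_fin_two]
      · rw [indHom_dihedralRotation_sr]
        simp [dihedralRep, Matrix.trace_fin_two]
    · rintro (i | i) <;>
      simp [dihedralRep, Matrix.det_fin_two, ← AddChar.map_add_eq_mul]
  rw [← rootFun_zero]
  exact ⟨_, _, _, _, h u, h 0, rfl, one_mul _⟩

theorem indHom_rootFun_mem_of_dihedral {p : ℕ} [Fact p.Prime] (hp : Odd p)
    {φ : DihedralGroup p →* G} (hφ : Function.Injective φ) {κ : Multiplicative (ZMod p) →* G}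
    (hκ : φ.comp (dihedralRotation p) = κ) (hC : indHom κ 1 ∈ goodGroup G) (u : ZMod p) :
    indHom κ (rootFun u) ∈ goodGroup G := by
  subst hκ
  have h1 : indHom φ ((indHom (dihedralRotation p) (rootFun u) -
      indHom (dihedralRotation p) 1) ∘ MonoidHom.id _) ∈ basicGroup G := by
    refine AddSubgroup.subset_closure (IsBasic.mk φ (MonoidHom.id _) _ hφ
      Function.surjective_id (Or.inr (Or.inr (Or.inr ⟨p, hp, Fact.out, ⟨.refl _⟩⟩))) ?_ ?_
      (hasDet_indHom_dihedralRotation_sub u))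
    · have h : ∀ (u : ZMod p) x, starRingEnd ℂ (indHom (dihedralRotation p) (rootFun u) x) =
          indHom (dihedralRotation p) (rootFun u) x := by
        rintro u (i | i)
        · rw [indHom_dihedralRotation_r, map_add, AddChar.map_neg_eq_conj, Complex.conj_conj,
            add_comm]
        · rw [indHom_dihedralRotation_sr, map_zero]
      intro x
      rw [← rootFun_zero, Pi.sub_apply, map_sub, h, h]
    · rw [← rootFun_zero, Pi.sub_apply, DihedralGroup.one_def, indHom_dihedralRotation_r,
        indHom_dihedralRotation_r]
      simp
  simp only [MonoidHom.coe_id, Function.comp_id, indHom_sub, indHom_comp] at h1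
  simpa using add_mem (basicGroup_le_goodGroup h1) hC

end Frobenius

section Frobenius

variable {G : Type} [Group G] [Finite G] {q : ℕ} [Fact q.Prime]
  {κ : Multiplicative (ZMod q) →* G} {L : Subgroup G} {v : L →* (ZMod q)ˣ}

theorem sum_rootFun (i : Multiplicative (ZMod q)) :
    ∑ u : (ZMod q)ˣ, rootFun (u : ZMod q) i = if i = 1 then (q : ℂ) - 1 else -1 := by
  have h1 : ∑ u : ZMod q, rootFun u i = if i = 1 then (q : ℂ) else 0 := by
    have := AddChar.sum_mulShift i.toAdd (ZMod.isPrimitive_stdAddChar q)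
    rw [ZMod.card] at this
    simp only [rootFun]
    rw [this]
    by_cases h : i = 1
    · rw [if_pos h, if_pos (by rw [h]; rfl)]
    · rw [if_neg h, if_neg (c := i.toAdd = 0) (fun h' => h h'), Nat.cast_zero]
  have h2 : ∑ u : ZMod q, rootFun u i = 1 + ∑ u : (ZMod q)ˣ, rootFun (u : ZMod q) i := by
    rw [Fintype.sum_eq_add_sum_compl (0 : ZMod q), rootFun_zero, Pi.one_apply]
    congr 1
    refine (Finset.sum_bij (fun (u : (ZMod q)ˣ) _ => (u : ZMod q)) ?_ ?_ ?_ ?_).symm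
    · simp
    · intro a _ b _ h
      exact Units.ext h
    · intro b hb
      exact ⟨Units.mk0 b (by simpa using hb), Finset.mem_univ _, rfl⟩
    · simp
  rw [h1] at h2
  split_ifs at h2 ⊢ <;> linear_combination -h2

theorem sum_indHom_rootFun (hκ : Function.Injective κ) (hv : Function.Injective v)
    (hconj : ∀ (h : L) i, (h : G) * κ i * (h : G)⁻¹ = κ (.ofAdd (v h * i.toAdd)))
    (hbij : Function.Bijective fun x : Multiplicative (ZMod q) × L => κ x.1 * x.2) :
    ∑ u : (ZMod q)ˣ, indHom κ (rootFun (u : ZMod q)) =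
      (Nat.card L : ℂ) • (indHom L.subtype 1 - 1) := by
  have := Fintype.ofFinite G
  have hLκ : ∀ i, κ i ∈ L ↔ i = 1 := by
    refine fun i => ⟨fun h => ?_, fun h => by simp [h]⟩
    have := @hbij.1 (i, 1) (1, ⟨κ i, h⟩) (by simp)
    exact congrArg Prod.fst this
  have hsum : ∀ F : G → ℂ, ∑ x, F x = ∑ i, ∑ h : L, F (κ i * h) := by
    intro F
    rw [← Fintype.sum_prod_type', ← (Equiv.ofBijective _ hbij).sum_comp]
    rfl
  have hm := natCard_ne_zero_complex L
  have hq0 := natCard_ne_zero_complex (Multiplicative (ZMod q))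
  have hq1 : (Nat.card (Multiplicative (ZMod q)) : ℂ) = q := by
    rw [Nat.card_eq_fintype_card, Fintype.card_multiplicative, ZMod.card]
  have hcomm : ∀ (h : L) i, (h : G) * κ i = κ (.ofAdd (v h * i.toAdd)) * h := fun h i => by
    rw [← hconj, inv_mul_cancel_right]
  funext g
  obtain ⟨⟨j, h⟩, rfl⟩ := hbij.2 g
  have e1 : ∀ i (l : L), (κ i * l)⁻¹ * (κ j * h) * (κ i * l) =
      (l : G)⁻¹ * (κ (i⁻¹ * j * .ofAdd (v h * i.toAdd)) * h) * l := by
    intro i l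
    have := hcomm h i
    simp only [map_mul, map_inv]
    simp only [mul_inv_rev, mul_assoc] at this ⊢
    rw [← mul_assoc (h : G), this, mul_assoc]
  have e2 : indHom L.subtype 1 (κ j * h) =
      ∑ i : Multiplicative (ZMod q),
        if i⁻¹ * j * .ofAdd (v h * i.toAdd) = 1 then (1 : ℂ) else 0 := by
    rw [indHom_subtype_apply, hsum]
    have e3 : ∀ i (l : L), (κ i * l)⁻¹ * (κ j * h) * (κ i * l) ∈ L ↔
        i⁻¹ * j * .ofAdd (v h * i.toAdd) = 1 := by
      intro i l
      rw [e1, L.mul_mem_cancel_right l.2, L.mul_mem_cancel_left (L.inv_mem l.2),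
        L.mul_mem_cancel_right h.2, hLκ]
    simp only [Pi.one_apply, dite_eq_ite, e3, Finset.sum_const, Finset.card_univ, nsmul_eq_mul]
    rw [← Nat.card_eq_fintype_card, ← Finset.mul_sum, inv_mul_cancel_left₀ hm]
  rw [Finset.sum_apply, Pi.smul_apply, Pi.sub_apply, e2, Pi.one_apply, smul_eq_mul]
  have e4 : ∑ u : (ZMod q)ˣ, indHom κ (rootFun (u : ZMod q)) (κ j * h) = (q : ℂ)⁻¹ *
      ∑ a : Multiplicative (ZMod q), ∑ l : L, ∑ i : Multiplicative (ZMod q),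
      if κ i = (κ a * l)⁻¹ * (κ j * h) * (κ a * l) then (if i = 1 then (q : ℂ) - 1 else -1)
        else 0 := by
    simp only [indHom_apply, hsum, ← Finset.mul_sum, hq1]
    congr 1
    rw [Finset.sum_comm]
    refine Finset.sum_congr rfl fun a _ => ?_
    rw [Finset.sum_comm]
    refine Finset.sum_congr rfl fun l _ => ?_
    rw [Finset.sum_comm]
    refine Finset.sum_congr rfl fun i _ => ?_
    split_ifs with h1 h2
    · rw [sum_rootFun, if_pos h2]
    · rw [sum_rootFun, if_neg h2]
    · simp
  rw [e4]
  rw [hq1] at hq0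
  by_cases h1 : h = 1
  · subst h1
    have e8 : ∀ i : Multiplicative (ZMod q),
        i⁻¹ * j * .ofAdd ((v 1 : (ZMod q)ˣ) * i.toAdd) = j := by
      intro i
      rw [map_one, Units.val_one, one_mul, ofAdd_toAdd, mul_assoc, mul_comm j,
        inv_mul_cancel_left]
    have e5 : ∀ a (l : L), (∑ i : Multiplicative (ZMod q),
        if κ i = (κ a * l)⁻¹ * (κ j * (1 : L)) * (κ a * l) then
          (if i = 1 then (q : ℂ) - 1 else -1) else 0) = if j = 1 then (q : ℂ) - 1 else -1 := by
      intro a l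
      have e6 : (κ a * l)⁻¹ * (κ j * (1 : L)) * (κ a * l) =
          κ (.ofAdd (v l⁻¹ * j.toAdd)) := by
        rw [e1, ← hconj, e8]
        rw [Subgroup.coe_one, mul_one, Subgroup.coe_inv, inv_inv]
      rw [e6, Finset.sum_eq_single (.ofAdd (v l⁻¹ * j.toAdd))]
      · rw [if_pos rfl]
        have e9 : Multiplicative.ofAdd ((v l⁻¹ : ZMod q) * j.toAdd) = 1 ↔ j = 1 := by
          rw [ofAdd_eq_one, Units.mul_right_eq_zero]
          rfl
        rw [if_congr e9 rfl rfl]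
      · intro b _ hb
        rw [if_neg fun h => hb (hκ h)]
      · exact fun h => absurd (Finset.mem_univ _) h
    rw [Finset.sum_congr rfl fun a _ => Finset.sum_congr rfl fun l _ => e5 a l]
    rw [Finset.sum_const, Finset.sum_const, Finset.card_univ, Finset.card_univ, nsmul_eq_mul,
      nsmul_eq_mul]
    rw [Fintype.card_multiplicative, ZMod.card, ← Nat.card_eq_fintype_card,
      inv_mul_cancel_left₀ hq0]
    congr 1
    simp only [e8]
    split_ifs <;> simp
  · have e5 : ∀ a (l : L) i, κ i ≠ (κ a * l)⁻¹ * (κ j * h) * (κ a * l) := by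
      intro a l i e
      rw [e1] at e
      have e6 := hconj l i
      rw [e] at e6
      have e7 : κ ((a⁻¹ * j * .ofAdd (v h * a.toAdd))⁻¹ * .ofAdd (v l * i.toAdd)) = h := by
        rw [map_mul, map_inv, ← e6]
        group
      have e8 := (hLκ _).mp (e7 ▸ h.2)
      rw [e8, map_one] at e7
      exact h1 (Subtype.ext e7.symm)
    simp only [e5, if_false, Finset.sum_const_zero, mul_zero]
    have e6 : (v h : ZMod q) - 1 ≠ 0 := by
      intro e
      refine h1 (hv ?_)
      rw [map_one]
      exact Units.ext (sub_eq_zero.mp e)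
    rw [Finset.sum_eq_single (.ofAdd (-(((v h : ZMod q) - 1)⁻¹ * j.toAdd)))]
    · rw [if_pos, sub_self, mul_zero]
      apply Multiplicative.toAdd.injective
      simp only [toAdd_mul, toAdd_inv, toAdd_ofAdd, toAdd_one]
      field_simp
      ring
    · intro b _ hb
      rw [if_neg]
      contrapose! hb
      apply Multiplicative.toAdd.injective
      have := congrArg Multiplicative.toAdd hb
      simp only [toAdd_mul, toAdd_inv, toAdd_ofAdd, toAdd_one] at this ⊢
      field_simp
      linear_combination this
    · simp

theorem indHom_rootFun_mul_range
    (hconj : ∀ (h : L) i, (h : G) * κ i * (h : G)⁻¹ = κ (.ofAdd (v h * i.toAdd))) (h : L)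
    (u : ZMod q) : indHom κ (rootFun (u * v h)) = indHom κ (rootFun u) := by
  let e : Multiplicative (ZMod q) ≃* Multiplicative (ZMod q) :=
    AddEquiv.toMultiplicative (AddAut.mulLeft (v h))
  have h1 : (MulAut.conj (h : G)).toMonoidHom.comp κ = κ.comp e.toMonoidHom :=
    MonoidHom.ext fun i => hconj h i
  rw [← indHom_conj_comp κ (h : G), h1, ← indHom_comp_equiv e κ (rootFun u)]
  congr 1
  funext i
  change ZMod.stdAddChar (u * (v h : ZMod q) * i.toAdd) =
    ZMod.stdAddChar (u * ((v h : ZMod q) * i.toAdd))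
  rw [mul_assoc]

theorem indHom_subtype_one_mem_goodGroup_of_frobenius (hq : Odd q) (hκ : Function.Injective κ)
    (hv : Function.Injective v)
    (hconj : ∀ (h : L) i, (h : G) * κ i * (h : G)⁻¹ = κ (.ofAdd (v h * i.toAdd)))
    (hbij : Function.Bijective fun x : Multiplicative (ZMod q) × L => κ x.1 * x.2)
    (hC : indHom κ 1 ∈ goodGroup G) : indHom L.subtype 1 ∈ goodGroup G := by
  have hm := natCard_ne_zero_complex L
  let F : (ZMod q)ˣ → G → ℂ := fun u => indHom κ (rootFun (u : ZMod q))
  have hF : ∀ (u : (ZMod q)ˣ) h, F (u * v h) = F u := fun u h => by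
    simp only [F, Units.val_mul]
    exact indHom_rootFun_mul_range hconj h _
  have hF' : ∀ u u' : (ZMod q)ˣ, (u : (ZMod q)ˣ ⧸ v.range) = u' → F u = F u' := by
    intro u u' e
    obtain ⟨h, e⟩ := QuotientGroup.eq.mp e
    rw [← hF u h, e, mul_inv_cancel_left]
  have h1 : indHom L.subtype 1 - 1 = ∑ ω : (ZMod q)ˣ ⧸ v.range, F ω.out := by
    funext g
    have h2 := sum_quotient v.range fun ω => F ω.out g
    rw [Finset.sum_congr rfl fun u _ => congrFun (hF' _ u (QuotientGroup.out_eq' _)) g,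
      ← Finset.sum_apply, sum_indHom_rootFun hκ hv hconj hbij, ← Finset.sum_apply,
      ← Nat.card_congr (MonoidHom.ofInjective hv).toEquiv] at h2
    exact mul_left_cancel₀ hm h2
  suffices ∑ ω : (ZMod q)ˣ ⧸ v.range, F ω.out ∈ goodGroup G by
    rw [← h1] at this
    simpa only [sub_add_cancel] using add_mem this one_mem_goodGroup
  by_cases hs : -1 ∈ v.range
  · obtain ⟨s, hs⟩ := hs
    have hss : (s : G) * s = 1 := by
      have : s * s = 1 := hv (by rw [map_mul, hs, map_one, neg_mul_neg, one_mul])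
      exact congrArg Subtype.val this
    have hsκ : ∀ i, (s : G) * κ i = κ i⁻¹ * s := by
      intro i
      rw [← inv_mul_cancel_right ((s : G) * κ i) (s : G), hconj, hs]
      congr 2
      exact Multiplicative.toAdd.injective (neg_one_mul _)
    have hκs : ∀ i, κ i * s = s * κ i⁻¹ := fun i => by rw [hsκ, inv_inv]
    let φ : DihedralGroup q →* G :=
      { toFun := fun
          | .r i => κ (.ofAdd i)
          | .sr i => s * κ (.ofAdd i)
        map_one' := κ.map_one
        map_mul' := by
          rintro (i | i) (j | j)
          · exact κ.map_mul (.ofAdd i) (.ofAdd j)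
          · change s * κ (.ofAdd (j - i)) = κ (.ofAdd i) * (s * κ (.ofAdd j))
            rw [← mul_assoc, hκs, mul_assoc, ← map_mul, mul_comm, ofAdd_sub, div_eq_mul_inv,
              mul_comm (Multiplicative.ofAdd j)]
          · change s * κ (.ofAdd (i + j)) = s * κ (.ofAdd i) * κ (.ofAdd j)
            rw [mul_assoc, ← map_mul, ofAdd_add]
          · change κ (.ofAdd (j - i)) = s * κ (.ofAdd i) * (s * κ (.ofAdd j))
            rw [hsκ, mul_assoc, ← mul_assoc (s : G) s, hss, one_mul, ← map_mul, ofAdd_sub,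
              div_eq_mul_inv, mul_comm] }
    have hφ : Function.Injective φ := by
      refine (injective_iff_map_eq_one φ).mpr ?_
      rintro (i | i) hi
      · exact congrArg DihedralGroup.r (hκ (hi.trans κ.map_one.symm))
      · have h2 : κ (.ofAdd i)⁻¹ * s = 1 := (hsκ _).symm.trans hi
        have h3 := @hbij.1 ((.ofAdd i)⁻¹, s) (1, 1)
          (by simpa only [map_one, Subgroup.coe_one, one_mul] using h2)
        have h4 : s = 1 := (Prod.ext_iff.mp h3).2
        rw [h4, map_one] at hs
        have : Fact (2 < q) := ⟨by
          have := (Fact.out : q.Prime).two_le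
          obtain ⟨k, rfl⟩ := hq
          omega⟩
        exact absurd (congrArg Units.val hs).symm ZMod.neg_one_ne_one
    exact sum_mem fun ω _ => indHom_rootFun_mem_of_dihedral hq hφ rfl hC _
  · rw [← QuotientAddGroup.eq_zero_iff, ← QuotientAddGroup.mk'_apply, map_sum]
    refine Finset.sum_involution (fun ω _ => ((-1 : (ZMod q)ˣ) : (ZMod q)ˣ ⧸ v.range) * ω)
      ?_ ?_ (fun _ _ => Finset.mem_univ _) ?_
    · intro ω _
      have h2 : F (((-1 : (ZMod q)ˣ) : (ZMod q)ˣ ⧸ v.range) * ω).out = F (-1 * ω.out) := by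
        refine hF' _ _ ?_
        rw [QuotientGroup.out_eq', QuotientGroup.mk_mul, QuotientGroup.out_eq']
      rw [h2, ← map_add, QuotientAddGroup.mk'_apply, QuotientAddGroup.eq_zero_iff, neg_one_mul]
      exact indHom_rootFun_add_neg_mem hκ hC _
    · intro ω _ _ h2
      exact hs ((QuotientGroup.eq_one_iff _).mp (mul_eq_right.mp h2))
    · intro ω _
      rw [← mul_assoc, ← QuotientGroup.mk_mul, neg_one_mul, neg_neg, QuotientGroup.mk_one, one_mul]

end Frobenius

section PGroup

variable {G K : Type} [Group G] [Group K] [Finite G]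

/-- Permutation characters of all proper subgroups and all proper quotients are good. -/
def GoodBelow (G : Type) [Group G] [Finite G] : Prop :=
  (∀ K : Subgroup G, K ≠ ⊤ → permGroup K ≤ goodGroup K) ∧
    ∀ (N : Subgroup G) [N.Normal], N ≠ ⊥ → permGroup (G ⧸ N) ≤ goodGroup (G ⧸ N)

theorem GoodBelow.mem_of_normal_le (h : GoodBelow G) {N L : Subgroup G} [N.Normal]
    (hN : N ≠ ⊥) (hL : N ≤ L) : indHom L.subtype 1 ∈ goodGroup G :=
  indHom_subtype_one_mem_goodGroup_of_le hL (h.2 N hN (indHom_subtype_one_mem _))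

theorem hom_units_eq_one_of_odd (hK : Odd (Nat.card K)) (ε : K →* ℤˣ) : ε = 1 := by
  ext k
  have h1 : ε k ^ Nat.card K = 1 := by rw [← map_pow, pow_card_eq_one', map_one]
  obtain ⟨m, hm⟩ := hK
  rw [hm, pow_add, pow_mul, Int.units_sq, one_pow, one_mul, pow_one] at h1
  rw [h1, MonoidHom.one_apply]

theorem card_ker_hom_units (ε : K →* ℤˣ) : ε.ker.index ∣ 2 := by
  rw [Subgroup.index_ker]
  have := Subgroup.card_subgroup_dvd_card ε.range
  rwa [Nat.card_eq_fintype_card (α := ℤˣ), Fintype.card_units_int] at this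

theorem GoodBelow.mem_of_odd (h : GoodBelow G) {L K : Subgroup G} [K.Normal] (hL : L ≤ K)
    (hK : K ≠ ⊤) (hK' : K ≠ ⊥) (hodd : Odd (Nat.card K)) : indHom L.subtype 1 ∈ goodGroup G := by
  refine indHom_subtype_one_mem_goodGroup_of_ker hL (h.1 K hK) fun ε => ?_
  rw [hom_units_eq_one_of_odd hodd ε, MonoidHom.ker_one, ← MonoidHom.range_eq_map,
    Subgroup.range_subtype]
  exact h.mem_of_normal_le hK' le_rfl

/-- The action of the dihedral group of order `8` on the vertices of a square. -/
def dihedralPerm : DihedralGroup 4 →* Equiv.Perm (ZMod 4) where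
  toFun
    | .r i => ⟨fun x => x - i, fun x => x + i, fun x => by simp, fun x => by simp⟩
    | .sr i => ⟨fun x => i - x, fun x => i - x, fun x => by simp, fun x => by simp⟩
  map_one' := Equiv.ext fun x => sub_zero x
  map_mul' := by
    rintro (i | i) (j | j) <;> ext1 x <;>
    simp only [DihedralGroup.r_mul_r, DihedralGroup.r_mul_sr, DihedralGroup.sr_mul_r,
      DihedralGroup.sr_mul_sr, Equiv.Perm.mul_apply, Equiv.coe_fn_mk] <;> ring

theorem dihedralPerm_injective : Function.Injective dihedralPerm := by
  refine (injective_iff_map_eq_one _).mpr ?_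
  have h : ∀ x : DihedralGroup 4, dihedralPerm x 0 = 0 → dihedralPerm x 1 = 1 → x = 1 := by
    decide
  intro x hx
  exact h x (by rw [hx]; rfl) (by rw [hx]; rfl)

theorem nonempty_mulEquiv_dihedralGroup_of_injective {G : Type} [Group G] {X : Type}
    (hX : Nat.card X = 4)
    (hG : Nat.card G = 8) {ρ : G →* Equiv.Perm X} (hρ : Function.Injective ρ) :
    Nonempty (G ≃* DihedralGroup 4) := by
  have : Finite X := Nat.finite_of_card_ne_zero (by omega)
  have : Fact (Nat.Prime 2) := ⟨Nat.prime_two⟩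
  let e : X ≃ ZMod 4 := Finite.equivFinOfCardEq hX
  let ρ' : G →* Equiv.Perm (ZMod 4) := e.permCongrHom.toMonoidHom.comp ρ
  have hρ' : Function.Injective ρ' := e.permCongrHom.injective.comp hρ
  have hfac : 2 ^ (Nat.card (Equiv.Perm (ZMod 4))).factorization 2 = 8 := by
    have h24 : Nat.card (Equiv.Perm (ZMod 4)) = 2 ^ 3 * 3 := by
      rw [Nat.card_perm, Nat.card_zmod]
      rfl
    rw [h24, Nat.factorization_mul (by norm_num) (by norm_num), Finsupp.add_apply,
      Nat.Prime.factorization_pow Nat.prime_two,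
      Nat.factorization_eq_zero_of_not_dvd (n := 3) (by norm_num)]
    simp
  let P := Sylow.ofCard (p := 2) ρ'.range (by
    rw [hfac, ← hG]
    exact (Nat.card_congr (MonoidHom.ofInjective hρ').toEquiv).symm)
  let Q := Sylow.ofCard (p := 2) dihedralPerm.range (by
    rw [hfac, ← Nat.card_congr (MonoidHom.ofInjective dihedralPerm_injective).toEquiv,
      DihedralGroup.nat_card])
  exact ⟨((MonoidHom.ofInjective hρ').trans (P.equiv Q)).trans
    (MonoidHom.ofInjective dihedralPerm_injective).symm⟩

theorem permGroup_le_goodGroup_of_embedding {X : Type} (hX : Nat.card X ∣ 4)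
    (hG : IsPGroup 2 G) {ρ : G →* Equiv.Perm X} (hρ : Function.Injective ρ) :
    permGroup G ≤ goodGroup G := by
  have : Fact (Nat.Prime 2) := ⟨Nat.prime_two⟩
  have hX0 : Nat.card X ≠ 0 := fun h0 => by simp [h0] at hX
  have : Finite X := Nat.finite_of_card_ne_zero hX0
  obtain ⟨n, hn⟩ := IsPGroup.iff_card.mp hG
  have h1 : Nat.card G ∣ (Nat.card X).factorial := by
    rw [← Nat.card_perm]
    exact Subgroup.card_dvd_of_injective ρ hρ
  have h4 : Nat.card X ≤ 4 := Nat.le_of_dvd (by norm_num) hX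
  have hn3 : n ≤ 3 := by
    have h2 : 2 ^ n ∣ 2 ^ 3 * 3 := by
      rw [← hn]
      exact h1.trans (Nat.factorial_dvd_factorial h4)
    have h3 := (Nat.Coprime.pow_left n (by norm_num : Nat.Coprime 2 3)).dvd_of_dvd_mul_right h2
    exact (Nat.pow_dvd_pow_iff_le_right (by norm_num)).mp h3
  by_cases h8 : n = 3
  · subst h8
    have h4' : Nat.card X = 4 := by
      interval_cases hc : Nat.card X <;> simp_all
    exact permGroup_le_goodGroup_of_base (Or.inr (Or.inr (Or.inl
      (nonempty_mulEquiv_dihedralGroup_of_injective h4' hn hρ))))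
  · refine permGroup_le_goodGroup_of_base (isCyclic_or_isTargetGroup_of_card_dvd_four ?_)
    rw [hn]
    exact pow_dvd_pow 2 (by omega : n ≤ 2)

theorem GoodBelow.of_isPGroup (h : GoodBelow G) {p : ℕ} [Fact p.Prime] (hG : IsPGroup p G)
    {L : Subgroup G} (hL : L ≠ ⊤) : indHom L.subtype 1 ∈ goodGroup G := by
  obtain ⟨n, hn⟩ := IsPGroup.iff_card.mp hG
  obtain ⟨m, hm⟩ := IsPGroup.iff_card.mp (hG.to_subgroup L)
  have hp := (Fact.out : p.Prime)
  have hmn : m < n := by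
    have h1 : m ≤ n := (Nat.pow_dvd_pow_iff_le_right hp.one_lt).mp
      (hn ▸ hm ▸ Subgroup.card_subgroup_dvd_card L)
    refine h1.lt_of_ne ?_
    rintro rfl
    exact hL (Subgroup.card_eq_iff_eq_top _ |>.mp (hm.trans hn.symm))
  obtain ⟨K, hK, hLK⟩ := Sylow.exists_subgroup_card_pow_prime_le (G := G) p (n := m) (m := n - 1)
    (hn ▸ pow_dvd_pow p (Nat.sub_le n 1)) L hm (by omega)
  have hidx : K.index = p := by
    have := K.card_mul_index
    rw [hK, hn] at this
    obtain ⟨n, rfl⟩ : ∃ k, n = k + 1 := ⟨n - 1, by omega⟩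
    rw [Nat.add_sub_cancel, pow_succ] at this
    exact Nat.eq_of_mul_eq_mul_left (pow_pos hp.pos n) this
  have : K.Normal := Subgroup.normal_of_index_eq_minFac_card (by
    rw [hidx, hn, Nat.Prime.pow_minFac hp (by omega)])
  have hKtop : K ≠ ⊤ := by
    rintro rfl
    rw [Subgroup.index_top] at hidx
    exact hp.one_lt.ne hidx
  rcases hp.eq_two_or_odd' with rfl | hodd
  · refine indHom_subtype_one_mem_goodGroup_of_ker hLK (h.1 K hKtop) fun ε => ?_
    set M := ε.ker.map K.subtype with hM
    have hMi : M.index ∣ 4 := by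
      rw [hM, Subgroup.index_map_subtype, hidx]
      exact Nat.mul_dvd_mul_right (card_ker_hom_units ε) 2
    by_cases hcore : M.normalCore = ⊥
    · refine permGroup_le_goodGroup_of_embedding (X := G ⧸ M) hMi hG
        (ρ := MulAction.toPermHom G (G ⧸ M)) ?_ (indHom_subtype_one_mem _)
      rw [← MonoidHom.ker_eq_bot_iff, ← Subgroup.normalCore_eq_ker, hcore]
    · exact h.mem_of_normal_le hcore M.normalCore_le
  · by_cases hKb : K = ⊥
    · rw [hKb, Subgroup.index_bot] at hidx
      exact permGroup_le_goodGroup_of_base (Or.inl (isCyclic_of_prime_card hidx))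
        (indHom_subtype_one_mem _)
    · exact h.mem_of_odd hLK hKtop hKb (hK ▸ hodd.pow)

end PGroup

section Hyperelementary

variable {G : Type} [Group G]

theorem normal_of_le_of_isCyclic {A C : Subgroup G} [C.Normal] [IsCyclic C] (h : A ≤ C) :
    A.Normal := by
  refine ⟨fun a ha g => ?_⟩
  obtain ⟨m, hm⟩ := MonoidHom.map_cyclic (MulAut.conjNormal g : MulAut C).toMonoidHom
  have h1 := congrArg Subtype.val (hm ⟨a, h ha⟩)
  have h2 : g * a * g⁻¹ = a ^ m := h1
  rw [h2]
  exact A.zpow_mem ha m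

/-- A `p`-hyperelementary group: an extension of a `p`-group by a cyclic group of order prime
to `p`. -/
def IsHyperelementary (p : ℕ) (G : Type) [Group G] : Prop :=
  ∃ C : Subgroup G, C.Normal ∧ IsCyclic C ∧ (Nat.card C).Coprime p ∧ ∃ k, C.index = p ^ k

variable {p : ℕ} [Fact p.Prime]

theorem IsHyperelementary.subgroup (h : IsHyperelementary p G) (K : Subgroup G) :
    IsHyperelementary p K := by
  obtain ⟨C, hn, hc, hcop, k, hk⟩ := h
  have hinj : Function.Injective (K.subtype.subgroupComap C) := by
    rintro ⟨x, hx⟩ ⟨y, hy⟩ e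
    exact Subtype.ext (Subtype.ext (congrArg (fun z : C => (z : G)) e))
  refine ⟨C.subgroupOf K, inferInstance, isCyclic_of_injective _ hinj,
    hcop.coprime_dvd_left (Subgroup.card_dvd_of_injective _ hinj), ?_⟩
  have h1 : C.relIndex K ∣ p ^ k := hk ▸ Subgroup.relIndex_dvd_index_of_normal C K
  obtain ⟨j, -, hj⟩ := (Nat.dvd_prime_pow Fact.out).mp h1
  exact ⟨j, hj⟩

theorem IsHyperelementary.quotient (h : IsHyperelementary p G) (N : Subgroup G) [N.Normal] :
    IsHyperelementary p (G ⧸ N) := by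
  obtain ⟨C, hn, hc, hcop, k, hk⟩ := h
  refine ⟨C.map (QuotientGroup.mk' N), hn.map _ (QuotientGroup.mk'_surjective N),
    isCyclic_of_surjective _ ((QuotientGroup.mk' N).subgroupMap_surjective C),
    hcop.coprime_dvd_left (C.card_map_dvd _), ?_⟩
  have h1 := C.index_map_dvd (QuotientGroup.mk'_surjective N)
  rw [hk] at h1
  obtain ⟨j, -, hj⟩ := (Nat.dvd_prime_pow Fact.out).mp h1
  exact ⟨j, hj⟩

variable [Finite G] {C L : Subgroup G}

theorem le_center_of_totient_le_two {p : ℕ} [C.Normal] [IsCyclic C] (hp : Odd p) {k : ℕ}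
    (hk : C.index = p ^ k) (hC : (Nat.card C).totient ∣ 2) : C ≤ Subgroup.center G := by
  let ρ : G →* MulAut C := MulAut.conjNormal
  have h1 : Nat.card ρ.range ∣ p ^ k := by
    rw [← hk, ← Subgroup.index_ker]
    refine Subgroup.index_dvd_of_le fun c hc => ?_
    rw [MonoidHom.mem_ker]
    ext x
    have : (⟨c, hc⟩ : C) * x = x * ⟨c, hc⟩ := by
      let _ := IsCyclic.commGroup (α := C)
      exact mul_comm _ _
    have := congrArg Subtype.val this
    change c * x * c⁻¹ = x
    rw [mul_inv_eq_iff_eq_mul]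
    exact this
  have h2 : Nat.card ρ.range ∣ 2 :=
    (Subgroup.card_subgroup_dvd_card _).trans (IsCyclic.card_mulAut C ▸ hC)
  have h3 : (p ^ k).Coprime 2 := (Nat.coprime_two_right.mpr hp).pow_left k
  have h4 : ρ.range = ⊥ :=
    Subgroup.card_eq_one.mp (Nat.eq_one_of_dvd_coprimes h3 h1 h2)
  intro c hc
  rw [Subgroup.mem_center_iff]
  intro g
  have h5 : ρ g = 1 := by
    have : ρ g ∈ ρ.range := ⟨g, rfl⟩
    rwa [h4, Subgroup.mem_bot] at this
  have h6 : g * c * g⁻¹ = c := congrArg Subtype.val (show ρ g ⟨c, hc⟩ = ⟨c, hc⟩ by rw [h5]; rfl)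
  rwa [mul_inv_eq_iff_eq_mul] at h6

theorem GoodBelow.of_le_center (h : GoodBelow G) (hp : Odd p) [IsCyclic C]
    (hcop : (Nat.card C).Coprime p) {k : ℕ} (hk : C.index = p ^ k) (hC : C ≤ Subgroup.center G)
    (hC' : C ≠ ⊥) (hL : L ⊓ C = ⊥) : indHom L.subtype 1 ∈ goodGroup G := by
  have hpp := (Fact.out : p.Prime)
  have hCn : C.Normal := ⟨fun c hc g => by
    rwa [Subgroup.mem_center_iff.mp (hC hc) g, mul_inv_cancel_right]⟩
  have hLp : IsPGroup p L := by
    have h1 : Nat.card L ∣ p ^ k := by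
      rw [← hk, ← Subgroup.relIndex_bot_left, ← hL, Subgroup.inf_relIndex_left]
      exact Subgroup.relIndex_dvd_index_of_normal C L
    obtain ⟨j, -, hj⟩ := (Nat.dvd_prime_pow hpp).mp h1
    exact IsPGroup.iff_card.mpr ⟨j, hj⟩
  obtain ⟨P, hLP⟩ := hLp.exists_le_sylow
  obtain ⟨m, hm⟩ := IsPGroup.iff_card.mp P.isPGroup'
  have hsup : C ⊔ P = ⊤ := by
    rw [← Subgroup.index_eq_one]
    have h1 : (C ⊔ P : Subgroup G).index ∣ p ^ k := hk ▸ Subgroup.index_dvd_of_le le_sup_left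
    have h2 : (C ⊔ P : Subgroup G).index ∣ (P : Subgroup G).index :=
      Subgroup.index_dvd_of_le le_sup_right
    exact Nat.eq_one_of_dvd_coprimes
      (((Nat.Prime.coprime_iff_not_dvd hpp).mpr P.not_dvd_index).pow_left k) h1 h2
  have hPn : (P : Subgroup G).Normal := by
    rw [← Subgroup.normalizer_eq_top_iff, eq_top_iff, ← hsup]
    exact sup_le (hC.trans (Subgroup.center_le_normalizer _)) Subgroup.le_normalizer
  by_cases hPb : (P : Subgroup G) = ⊥
  · rw [hPb, sup_bot_eq] at hsup
    have : IsCyclic G := by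
      subst hsup
      exact isCyclic_of_surjective (⊤ : Subgroup G).subtype fun x => ⟨⟨x, trivial⟩, rfl⟩
    exact permGroup_le_goodGroup_of_base (Or.inl this) (indHom_subtype_one_mem _)
  · refine h.mem_of_odd hLP (fun hPt => hC' ?_) hPb (hm ▸ hp.pow)
    have h1 : Nat.card C ∣ p ^ m := by
      have := Subgroup.card_subgroup_dvd_card C
      rwa [← hm, hPt, Subgroup.card_top]
    exact Subgroup.card_eq_one.mp
      (Nat.eq_one_of_dvd_coprimes (hcop.pow_right m) dvd_rfl h1)

theorem GoodBelow.of_sup_ne_top (h : GoodBelow G) [C.Normal] [IsCyclic C] {A : Subgroup G}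
    (hA : A ≤ C) (hA2 : 2 < Nat.card A) (hAL : A ⊔ L ≠ ⊤) : indHom L.subtype 1 ∈ goodGroup G := by
  refine indHom_subtype_one_mem_goodGroup_of_ker le_sup_right (h.1 _ hAL) fun ε => ?_
  have := normal_of_le_of_isCyclic (A := ε.ker.map (A ⊔ L).subtype ⊓ A) (inf_le_right.trans hA)
  refine h.mem_of_normal_le (N := ε.ker.map (A ⊔ L).subtype ⊓ A) (fun hb => ?_) inf_le_left
  let ε' : A →* ℤˣ := ε.comp (Subgroup.inclusion le_sup_left)
  have hinj : Function.Injective ε' := by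
    refine (injective_iff_map_eq_one _).mpr fun a ha => ?_
    have : (a : G) ∈ ε.ker.map (A ⊔ L).subtype ⊓ A :=
      ⟨⟨Subgroup.inclusion le_sup_left a, ha, rfl⟩, a.2⟩
    rw [hb, Subgroup.mem_bot] at this
    exact Subtype.ext this
  have h1 := Nat.card_le_card_of_injective ε' hinj
  rw [Nat.card_eq_fintype_card (α := ℤˣ), Fintype.card_units_int] at h1
  omega

end Hyperelementary

section Frobenius

theorem exists_mulAut_mulEquiv_units (q : ℕ) :
    ∃ E : MulAut (Multiplicative (ZMod q)) ≃* (ZMod q)ˣ,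
      ∀ (f : MulAut (Multiplicative (ZMod q))) (x : Multiplicative (ZMod q)),
        f x = .ofAdd ((E f : ZMod q) * x.toAdd) := by
  let E : MulAut (Multiplicative (ZMod q)) ≃* (ZMod q)ˣ := (MulAutMultiplicative (ZMod q)).trans
    (AddEquiv.toMultiplicative (ZMod.AddAutEquivUnits q))
  refine ⟨E, fun f x => ?_⟩
  conv_lhs => rw [← E.symm_apply_apply f]
  rfl

variable {G : Type} [Group G] [Finite G] {C L : Subgroup G}

theorem GoodBelow.of_prime (h : GoodBelow G) [C.Normal] (hq : (Nat.card C).Prime)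
    (hodd : Odd (Nat.card C)) (hdis : L ⊓ C = ⊥) (hsup : C ⊔ L = ⊤) :
    indHom L.subtype 1 ∈ goodGroup G := by
  set q := Nat.card C with hqC
  have : Fact q.Prime := ⟨hq⟩
  obtain ⟨E, hE⟩ := exists_mulAut_mulEquiv_units q
  let κ₀ : Multiplicative (ZMod q) ≃* C :=
    mulEquivOfPrimeCardEq (p := q) (by rw [Nat.card_congr Multiplicative.toAdd, Nat.card_zmod]) rfl
  let v : L →* (ZMod q)ˣ := E.toMonoidHom.comp
    ((MulAut.congr κ₀.symm).toMonoidHom.comp (MulAut.conjNormal.comp L.subtype))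
  have hker : ∀ x ∈ v.ker, ∀ c ∈ C, (x : G) * c = c * x := by
    intro x hx c hc
    have h1 : E ((MulAut.congr κ₀.symm) (MulAut.conjNormal (x : G))) = 1 := hx
    rw [EmbeddingLike.map_eq_one_iff, EmbeddingLike.map_eq_one_iff] at h1
    have h2 : (x : G) * c * (x : G)⁻¹ = c := by
      simpa using congrArg Subtype.val (DFunLike.congr_fun h1 ⟨c, hc⟩)
    rwa [mul_inv_eq_iff_eq_mul] at h2
  have hN : (v.ker.map L.subtype).Normal := by
    rw [← Subgroup.normalizer_eq_top_iff, eq_top_iff, ← hsup]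
    refine sup_le (fun c hc => ?_) ?_
    · rw [Subgroup.mem_normalizer_iff]
      have h1 : ∀ y ∈ v.ker.map L.subtype, y * c = c * y := by
        rintro _ ⟨x, hx, rfl⟩
        exact hker x hx c hc
      intro y
      constructor
      · intro hy
        rwa [← h1 y hy, mul_inv_cancel_right]
      · intro hy
        have h2 := h1 _ hy
        rw [inv_mul_cancel_right, mul_right_inj] at h2
        rwa [← h2] at hy
    · have h1 := Subgroup.le_normalizer_map (H := v.ker) L.subtype
      rw [Subgroup.normalizer_eq_top] at h1
      rwa [← MonoidHom.range_eq_map, Subgroup.range_subtype] at h1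
  have hNL : v.ker.map L.subtype ≤ L := by
    rintro _ ⟨x, -, rfl⟩
    exact x.2
  by_cases hNb : v.ker.map L.subtype = ⊥
  swap
  · exact h.mem_of_normal_le hNb hNL
  have hv : Function.Injective v := by
    rw [← MonoidHom.ker_eq_bot_iff]
    exact (Subgroup.map_eq_bot_iff_of_injective _ L.subtype_injective).mp hNb
  have hκ : Function.Injective (C.subtype.comp κ₀.toMonoidHom) :=
    C.subtype_injective.comp κ₀.injective
  refine indHom_subtype_one_mem_goodGroup_of_frobenius (κ := C.subtype.comp κ₀.toMonoidHom) hodd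
    hκ hv (fun x i => ?_) ?_ ?_
  · have h1 := hE ((MulAut.congr κ₀.symm) (MulAut.conjNormal (x : G))) i
    change (x : G) * κ₀ i * (x : G)⁻¹ = κ₀ (.ofAdd ((v x : ZMod q) * i.toAdd))
    change _ = (κ₀ (Multiplicative.ofAdd
      ((E ((MulAut.congr κ₀.symm) (MulAut.conjNormal (x : G))) : ZMod q) * i.toAdd)) : G)
    rw [← h1]
    simp
  · have h1 : Subgroup.IsComplement' C L :=
      Subgroup.isComplement'_of_disjoint_and_mul_eq_univ (disjoint_iff.mpr (inf_comm C L ▸ hdis))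
        (by rw [← Subgroup.normal_mul, hsup, Subgroup.coe_top])
    exact Function.Bijective.comp (g := fun x : C × L => (x.1 : G) * x.2) h1
      (f := Prod.map κ₀ id) (κ₀.bijective.prodMap Function.bijective_id)
  · rw [indHom_one_eq (L := C) hκ]
    · refine h.mem_of_normal_le (fun hC => ?_) le_rfl
      rw [← Subgroup.card_eq_one] at hC
      exact hq.one_lt.ne' hC
    · rw [MonoidHom.range_comp, MonoidHom.range_eq_top.mpr κ₀.surjective, ← MonoidHom.range_eq_map,
        Subgroup.range_subtype]

end Frobenius

section Induction

variable {G : Type} [Group G] [Finite G] {p : ℕ} [Fact p.Prime]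

theorem GoodBelow.mem_of_isHyperelementary (h : GoodBelow G) (hG : IsHyperelementary p G)
    (L : Subgroup G) : indHom L.subtype 1 ∈ goodGroup G := by
  by_cases hL : L = ⊤
  · subst hL
    have : indHom (⊤ : Subgroup G).subtype (1 : (⊤ : Subgroup G) → ℂ) = 1 := by
      cases nonempty_fintype G
      ext g
      rw [indHom_subtype_apply]
      simp [← Nat.card_eq_fintype_card, natCard_ne_zero_complex G]
    rw [this]
    exact one_mem_goodGroup
  obtain ⟨C, hCn, hCc, hcop, k, hk⟩ := hG
  by_cases hCb : C = ⊥
  · rw [hCb, Subgroup.index_bot] at hk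
    exact h.of_isPGroup (IsPGroup.iff_card.mpr ⟨k, hk⟩) hL
  have hLCn : (L ⊓ C).Normal := normal_of_le_of_isCyclic inf_le_right
  by_cases hLC : L ⊓ C = ⊥
  swap
  · exact h.mem_of_normal_le hLC inf_le_left
  have hC1 : Nat.card C ≠ 1 := fun h1 => hCb (Subgroup.card_eq_one.mp h1)
  have hC0 : Nat.card C ≠ 0 := Nat.card_pos.ne'
  by_cases hC24 : Nat.card C = 2 ∨ Nat.card C = 4
  · have h2 : (2 : ℕ).Coprime p := by
      rcases hC24 with h1 | h1
      · rwa [h1] at hcop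
      · exact (h1 ▸ hcop).coprime_dvd_left (by norm_num)
    have hp : Odd p := Nat.coprime_two_left.mp h2
    refine h.of_le_center hp hcop hk (le_center_of_totient_le_two hp hk ?_) hCb hLC
    rcases hC24 with h1 | h1 <;> rw [h1] <;> decide
  push Not at hC24
  by_cases hA : ∃ A ≤ C, 2 < Nat.card A ∧ A ⊔ L ≠ ⊤
  · obtain ⟨A, hAC, hA2, hAL⟩ := hA
    exact h.of_sup_ne_top hAC hA2 hAL
  push Not at hA
  have hsup : C ⊔ L = ⊤ := hA C le_rfl (by omega)
  have hdvd : ∀ d, d ∣ Nat.card C → 2 < d → d = Nat.card C := by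
    intro d hd hd2
    obtain ⟨c, hc⟩ := IsCyclic.exists_ofOrder_eq_natCard (α := C)
    obtain ⟨e, he⟩ := hd
    have he0 : e ≠ 0 := by
      rintro rfl
      exact hC0 (by rw [he, mul_zero])
    have hcard : Nat.card (Subgroup.zpowers ((c : G) ^ e)) = d := by
      rw [Nat.card_zpowers, orderOf_pow_of_dvd he0, Subgroup.orderOf_coe, hc, he,
        Nat.mul_div_cancel _ (Nat.pos_of_ne_zero he0)]
      rw [Subgroup.orderOf_coe, hc, he]
      exact dvd_mul_left _ _
    have hAC : Subgroup.zpowers ((c : G) ^ e) ≤ C := by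
      rw [Subgroup.zpowers_le]
      exact C.pow_mem c.2 e
    have hAn := normal_of_le_of_isCyclic hAC
    have hcompl : ∀ A : Subgroup G, A.Normal → A ≤ C → A ⊔ L = ⊤ →
        Nat.card A * Nat.card L = Nat.card G := by
      intro A hAn hAC hAL
      refine (Subgroup.isComplement'_of_disjoint_and_mul_eq_univ ?_ ?_).card_mul_card
      · rw [disjoint_iff, eq_bot_iff, ← hLC, inf_comm]
        exact inf_le_inf_left L hAC
      · rw [← Subgroup.normal_mul, hAL, Subgroup.coe_top]
    have h1 := hcompl _ hAn hAC (hA _ hAC (by rwa [hcard]))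
    have h2 := hcompl C hCn le_rfl hsup
    rw [hcard, ← h2] at h1
    exact Nat.eq_of_mul_eq_mul_right Nat.card_pos h1
  have hprime : (Nat.card C).Prime := by
    rw [Nat.prime_def]
    refine ⟨by omega, fun m hm => ?_⟩
    by_contra! hm'
    have hm2 : m ≤ 2 := by
      by_contra! hm2
      exact hm'.2 (hdvd m hm hm2)
    obtain ⟨e, he⟩ := hm
    have : m = 2 := by
      interval_cases m
      · exact absurd he (by omega)
      · exact absurd rfl hm'.1
      · rfl
    subst this
    have he2 := hdvd e ⟨2, by omega⟩
    omega
  exact h.of_prime hprime (hprime.odd_of_ne_two hC24.1) hLC hsup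

theorem permGroup_le_goodGroup_of_isHyperelementary (hG : IsHyperelementary p G) :
    permGroup G ≤ goodGroup G := by
  induction hn : Nat.card G using Nat.strong_induction_on generalizing G with
  | _ n ih =>
    subst hn
    have hbelow : GoodBelow G := by
      refine ⟨fun K hK => ih _ ?_ (hG.subgroup K) rfl, fun N _ hN => ih _ ?_ (hG.quotient N) rfl⟩
      · refine lt_of_le_of_ne (Subgroup.card_le_card_group K) fun h => hK ?_
        exact K.card_eq_iff_eq_top.mp h
      · rw [← N.card_mul_index]
        have h1 : 1 < Nat.card N := (Subgroup.one_lt_card_iff_ne_bot N).mpr hN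
        have h2 : 0 < N.index := Nat.pos_of_ne_zero N.index_ne_zero_of_finite
        change N.index < _
        nlinarith
    rw [permGroup, AddSubgroup.closure_le]
    rintro _ ⟨L, rfl⟩
    exact hbelow.mem_of_isHyperelementary hG L

end Induction

section Solomon

variable {G : Type} [Group G] [Finite G]

theorem one_mem_nonUnitalSubring_of_forall_prime {X : Type*} [Finite X]
    {T : NonUnitalSubring (X → ℤ)} (hT : ∀ x, ∀ p : ℕ, p.Prime → ∃ t ∈ T, ¬ (p : ℤ) ∣ t x) :
    (1 : X → ℤ) ∈ T := by
  have h1 : ∀ x, ∃ t ∈ T, t x = 1 := by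
    intro x
    let I : AddSubgroup ℤ := T.toAddSubgroup.map (Pi.evalAddMonoidHom (fun _ : X => ℤ) x)
    obtain ⟨d, hd⟩ := Int.subgroup_cyclic I
    have hd1 : d.natAbs = 1 := by
      by_contra hne
      obtain ⟨p, hp, hpd⟩ := Nat.exists_prime_and_dvd hne
      obtain ⟨t, ht, htp⟩ := hT x p hp
      have h2 : t x ∈ AddSubgroup.closure {d} := hd ▸ ⟨t, ht, rfl⟩
      obtain ⟨m, hm⟩ := AddSubgroup.mem_closure_singleton.mp h2
      refine htp ((Int.natCast_dvd.mpr hpd).trans ⟨m, ?_⟩)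
      rw [← hm, smul_eq_mul, mul_comm]
    have h3 : (1 : ℤ) ∈ I := by
      rw [hd, AddSubgroup.mem_closure_singleton]
      rcases Int.natAbs_eq_iff.mp hd1 with h | h
      · exact ⟨1, by simp [h]⟩
      · exact ⟨-1, by simp [h]⟩
    exact h3
  choose t ht ht1 using h1
  have := Fintype.ofFinite X
  have h2 : ∀ s : Finset X, 1 - ∏ x ∈ s, (1 - t x) ∈ T := by
    intro s
    induction s using Finset.induction_on with
    | empty => simp
    | insert a s ha ih =>
      rw [Finset.prod_insert ha]
      have : 1 - (1 - t a) * ∏ x ∈ s, (1 - t x) =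
          (1 - ∏ x ∈ s, (1 - t x)) + t a - t a * (1 - ∏ x ∈ s, (1 - t x)) := by ring
      rw [this]
      exact T.sub_mem (T.add_mem ih (ht a)) (T.mul_mem (ht a) ih)
  have h3 : ∏ x, (1 - t x) = 0 := by
    ext y
    rw [Finset.prod_apply]
    exact Finset.prod_eq_zero (Finset.mem_univ y) (by simp [ht1])
  simpa [h3] using h2 Finset.univ

theorem mem_normalizer_of_conj_mem {C : Subgroup G} {g : G} (h : ∀ c ∈ C, g⁻¹ * c * g ∈ C) :
    g ∈ Subgroup.normalizer (C : Set G) := by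
  rw [← inv_mem_iff, Subgroup.mem_normalizer_iff]
  have hmap : C.map (MulAut.conj g⁻¹).toMonoidHom ≤ C := by
    rintro _ ⟨c, hc, rfl⟩
    simpa using h c hc
  have heq := Subgroup.eq_of_le_of_card_ge hmap
    (Nat.card_congr (C.equivMapOfInjective _ (MulAut.conj g⁻¹).injective).toEquiv).le
  intro c
  refine ⟨fun hc => by simpa using h c hc, fun hc => ?_⟩
  rw [← heq] at hc
  obtain ⟨d, hd, hdc⟩ := hc
  have : d = c := (MulAut.conj g⁻¹).injective hdc
  exact this ▸ hd

theorem exists_isHyperelementary_not_dvd (x : G) (p : ℕ) [Fact p.Prime] :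
    ∃ H : Subgroup G, IsHyperelementary p H ∧
      ¬ p ∣ Nat.card {y : G ⧸ H // x • y = y} := by
  have hp : p.Prime := Fact.out
  obtain ⟨k, m, hpm, hx⟩ := Nat.exists_eq_pow_mul_and_not_dvd (orderOf_pos x).ne' p hp.ne_one
  set z := x ^ p ^ k with hz
  have hzm : orderOf z = m := by
    rw [hz, orderOf_pow_of_dvd (pow_pos hp.pos k).ne' (hx ▸ dvd_mul_right _ _), hx,
      Nat.mul_div_cancel_left _ (pow_pos hp.pos k)]
  set C := Subgroup.zpowers z with hC
  have hCm : Nat.card C = m := by rw [hC, Nat.card_zpowers, hzm]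
  have hcop : m.Coprime p := ((Nat.Prime.coprime_iff_not_dvd hp).mpr hpm).symm
  set N := Subgroup.normalizer (C : Set G) with hN
  have hCN : C ≤ N := Subgroup.le_normalizer
  obtain ⟨P⟩ : Nonempty (Sylow p N) := inferInstance
  have hCn : (C.subgroupOf N).Normal := Subgroup.normal_in_normalizer
  set K : Subgroup N := C.subgroupOf N ⊔ P with hK
  set H : Subgroup G := K.map N.subtype with hH
  have hHN : H ≤ N := by
    rintro _ ⟨n, -, rfl⟩
    exact n.2
  have hHK : H.subgroupOf N = K := Subgroup.comap_map_eq_self_of_injective N.subtype_injective K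
  have hCH : C ≤ H := by
    rw [← Subgroup.map_subgroupOf_eq_of_le hCN]
    exact Subgroup.map_mono le_sup_left
  have hidx : ∃ j, (C.subgroupOf H).index = p ^ j := by
    change ∃ j, C.relIndex H = p ^ j
    rw [← Subgroup.relIndex_subgroupOf hHN, hHK, hK, Subgroup.relIndex_sup_left]
    obtain ⟨i, hi⟩ := IsPGroup.iff_card.mp P.isPGroup'
    have h1 := Subgroup.index_dvd_card ((C.subgroupOf N).subgroupOf P)
    rw [hi] at h1
    obtain ⟨j, -, hj⟩ := (Nat.dvd_prime_pow hp).mp h1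
    exact ⟨j, hj⟩
  have hCHn : (C.subgroupOf H).Normal := Subgroup.normal_subgroupOf_of_le_normalizer hHN
  have hCHm : Nat.card (C.subgroupOf H) = m := by
    rw [Nat.card_congr (Subgroup.subgroupOfEquivOfLe hCH).toEquiv, hCm]
  refine ⟨H, ⟨C.subgroupOf H, hCHn, ?_, hCHm ▸ hcop, hidx⟩, ?_⟩
  · exact isCyclic_of_surjective (Subgroup.subgroupOfEquivOfLe hCH).symm
      (Subgroup.subgroupOfEquivOfLe hCH).symm.surjective
  have hmemC : ∀ h ∈ H, h ^ m = 1 → h ∈ C := by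
    intro h hh hm
    obtain ⟨j, hj⟩ := hidx
    let h' : H := ⟨h, hh⟩
    have h1 : (QuotientGroup.mk h' : H ⧸ C.subgroupOf H) ^ m = 1 := by
      rw [← QuotientGroup.mk_pow, show h' ^ m = 1 from Subtype.ext hm, QuotientGroup.mk_one]
    have h2 : (QuotientGroup.mk h' : H ⧸ C.subgroupOf H) ^ p ^ j = 1 := by
      rw [← hj]
      exact pow_card_eq_one'
    have h3 := Nat.eq_one_of_dvd_coprimes (hcop.pow_right j) (orderOf_dvd_of_pow_eq_one h1)
      (orderOf_dvd_of_pow_eq_one h2)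
    rw [orderOf_eq_one_iff, QuotientGroup.eq_one_iff] at h3
    exact h3
  have hfix : {y : G ⧸ H | z • y = y} = MulAction.orbit N ((1 : G) : G ⧸ H) := by
    ext y
    obtain ⟨g, rfl⟩ := QuotientGroup.mk_surjective y
    have h1 : z • (g : G ⧸ H) = g ↔ g⁻¹ * z * g ∈ H := by
      rw [MulAction.Quotient.smul_coe, smul_eq_mul, eq_comm, QuotientGroup.eq, mul_assoc]
    rw [Set.mem_ofPred_eq, h1]
    constructor
    · intro hg
      have hgC : g⁻¹ * z * g ∈ C := by
        refine hmemC _ hg ?_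
        have := conj_pow (i := m) (a := g⁻¹) (b := z)
        rw [inv_inv] at this
        rw [this, ← hzm, pow_orderOf_eq_one, mul_one, inv_mul_cancel]
      have hgN : g ∈ N := by
        refine mem_normalizer_of_conj_mem fun c hc => ?_
        obtain ⟨i, rfl⟩ := Subgroup.mem_zpowers_iff.mp hc
        have := conj_zpow (i := i) (a := g⁻¹) (b := z)
        rw [inv_inv] at this
        rw [← this]
        exact C.zpow_mem hgC i
      exact ⟨⟨g, hgN⟩, by
        change ((g * 1 : G) : G ⧸ H) = g
        rw [mul_one]⟩
    · rintro ⟨n, hn⟩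
      change ((n * 1 : G) : G ⧸ H) = g at hn
      rw [mul_one, QuotientGroup.eq] at hn
      have hgN : g ∈ N := by
        have := N.mul_mem n.2 (hHN hn)
        rwa [mul_inv_cancel_left] at this
      have := (Subgroup.mem_normalizer_iff.mp (N.inv_mem hgN) z).mp (Subgroup.mem_zpowers z)
      rw [inv_inv] at this
      exact hCH this
  have hstab : MulAction.stabilizer N ((1 : G) : G ⧸ H) = K := by
    rw [← hHK]
    ext n
    rw [MulAction.mem_stabilizer_iff, Subgroup.mem_subgroupOf]
    change ((n * 1 : G) : G ⧸ H) = (1 : G) ↔ _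
    rw [mul_one, eq_comm, QuotientGroup.eq, inv_one, one_mul]
  have hcard : Nat.card {y : G ⧸ H // z • y = y} = K.index := by
    rw [← hstab, MulAction.index_stabilizer, ← hfix]
    rfl
  have hKp : ¬ p ∣ K.index := fun h =>
    P.not_dvd_index (h.trans (Subgroup.index_dvd_of_le le_sup_right))
  let f : Function.End {y : G ⧸ H // z • y = y} := fun y => ⟨x • y.1, by
    rw [← mul_smul, ((Commute.refl x).pow_left (p ^ k)).eq, mul_smul, y.2]⟩
  have hfpow : ∀ (n : ℕ) y, ((f ^ n) y).1 = x ^ n • y.1 := by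
    intro n
    induction n with
    | zero =>
      intro y
      rw [pow_zero x, one_smul]
      rfl
    | succ n ih =>
      intro y
      rw [pow_succ, pow_succ, mul_smul]
      exact ih (f y)
  have hf : f ^ p ^ k = 1 := by
    funext y
    exact Subtype.ext ((hfpow _ y).trans y.2)
  have := Fintype.ofFinite {y : G ⧸ H // z • y = y}
  have hmod := Equiv.Perm.card_fixedPoints_modEq hf
  rw [← Nat.card_eq_fintype_card, ← Nat.card_eq_fintype_card, hcard] at hmod
  let e : Function.fixedPoints f ≃ {y : G ⧸ H // x • y = y} :=
    { toFun := fun y => ⟨y.1.1, congrArg Subtype.val y.2⟩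
      invFun := fun y => ⟨⟨y.1, by
        exact Subgroup.pow_mem (MulAction.stabilizer G y.1) y.2 (p ^ k)⟩, Subtype.ext y.2⟩
      left_inv := fun y => rfl
      right_inv := fun y => rfl }
  rw [Nat.card_congr e] at hmod
  exact fun h => hKp ((hmod.dvd_iff dvd_rfl).mpr h)

/-- Multiplication by `t` maps permutation characters of degree `0` and trivial determinant to
permutation characters in `basicGroup`. -/
def basicMultiplier (G : Type) [Group G] [Finite G] : NonUnitalSubring (G → ℤ) where
  carrier := {t | ∀ f ∈ permGroup G, f 1 = 0 → HasDet f 1 →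
    (fun g => (t g : ℂ) * f g) ∈ permGroup G ⊓ basicGroup G}
  zero_mem' f _ _ _ := by
    convert (permGroup G ⊓ basicGroup G).zero_mem using 1
    ext g
    simp
  add_mem' {s t} hs ht f hf h0 hdet := by
    convert (permGroup G ⊓ basicGroup G).add_mem (hs f hf h0 hdet) (ht f hf h0 hdet) using 1
    ext g
    simp [add_mul]
  neg_mem' {s} hs f hf h0 hdet := by
    convert (permGroup G ⊓ basicGroup G).neg_mem (hs f hf h0 hdet) using 1
    ext g
    simp
  mul_mem' {s t} hs ht f hf h0 hdet := by
    obtain ⟨h1, h2⟩ := ht f hf h0 hdet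
    convert hs _ h1 (basicGroup.apply_one h2) (basicGroup.hasDet h2) using 1
    ext g
    simp [mul_assoc]

theorem card_fixed_mem_basicMultiplier {p : ℕ} [Fact p.Prime] {H : Subgroup G}
    (hH : IsHyperelementary p H) :
    (fun x => (Nat.card {y : G ⧸ H // x • y = y} : ℤ)) ∈ basicMultiplier G := by
  intro f hf h0 hdet
  have h1 : (fun g => (((Nat.card {y : G ⧸ H // g • y = y} : ℕ) : ℤ) : ℂ) * f g) =
      indHom H.subtype (f ∘ H.subtype) := by
    have := indHom_mul_comp H.subtype 1 f hdet.conj_eq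
    rw [one_mul, indHom_subtype_one] at this
    rw [this]
    ext g
    rw [Int.cast_natCast]
    rfl
  rw [h1]
  have h2 := permGroup.comp hf H.subtype
  refine ⟨permGroup.ind h2 H.subtype_injective, basicGroup.ind ?_ H.subtype_injective⟩
  exact goodGroup.mem_basicGroup (permGroup_le_goodGroup_of_isHyperelementary hH h2)
    (by simpa using h0) (hdet.comp H.subtype)

theorem permGroup.mem_basicGroup {f : G → ℂ} (hf : f ∈ permGroup G) (h0 : f 1 = 0)
    (hdet : HasDet f 1) : f ∈ basicGroup G := by
  have h1 : (1 : G → ℤ) ∈ basicMultiplier G := by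
    refine one_mem_nonUnitalSubring_of_forall_prime fun x p hp => ?_
    have : Fact p.Prime := ⟨hp⟩
    obtain ⟨H, hH, hx⟩ := exists_isHyperelementary_not_dvd x p
    exact ⟨_, card_fixed_mem_basicMultiplier hH, by rwa [Int.natCast_dvd_natCast]⟩
  simpa using (h1 f hf h0 hdet).2

end Solomon

section PermChar

variable {G : Type} [Group G] [Fintype G]

theorem indChar_eq_indHom (H : Subgroup G) (f : H → ℂ) : indChar H f = indHom H.subtype f := by
  funext g
  rw [indHom_subtype_apply]
  rfl

theorem IsPermChar.mem_permGroup {f : G → ℂ} (hf : IsPermChar f) : f ∈ permGroup G := by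
  have h : Submodule.span ℤ {f : G → ℂ | ∃ H : Subgroup G, f = indChar H 1} ≤
      (permGroup G).toIntSubmodule := by
    rw [Submodule.span_le]
    rintro _ ⟨H, rfl⟩
    rw [indChar_eq_indHom]
    exact indHom_subtype_one_mem H
  exact h hf

end PermChar

/-- **Corollary 2.9.** Let `G` be a finite group and `𝒫` a set of real-valued generalised
characters of `G` such that (i) `Ind_H^G τ ∈ 𝒫` for every subgroup `H` and real generalised
character `τ` of `H` of degree 0 and trivial determinant that factors through a quotient of
`H` that is cyclic or isomorphic to `C₂ × C₂`, `D₈`, or `D_{2p}` for an odd prime `p`, and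
(ii) `𝒫` is closed under `ℤ`-linear combinations.  Then `𝒫` contains every permutation
character of `G` of degree 0 and trivial determinant. -/
theorem statement2 (G : Type) [Group G] [Fintype G] (P : Set (G → ℂ))
    (hP : ∀ f ∈ P, IsGenChar f ∧ ∀ g : G, starRingEnd ℂ (f g) = f g)
    (h1 : ∀ (H : Subgroup G) (N : Subgroup ↥H) [N.Normal] (τ : ↥H → ℂ),
      IsGenChar τ → (∀ h : ↥H, starRingEnd ℂ (τ h) = τ h) → τ 1 = 0 → HasTrivialDet τ →
      (IsCyclic (↥H ⧸ N) ∨ IsTargetGroup (↥H ⧸ N)) →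
      (∃ τ' : (↥H ⧸ N) → ℂ, τ = fun h => τ' (QuotientGroup.mk h)) →
      indChar H τ ∈ P)
    (h2 : ∀ (ι : Type) (s : Finset ι) (n : ι → ℤ) (τ : ι → G → ℂ),
      (∀ i ∈ s, τ i ∈ P) → (∑ i ∈ s, n i • τ i) ∈ P) :
    ∀ f : G → ℂ, IsPermChar f → f 1 = 0 → HasTrivialDet f → f ∈ P := by
  intro f hf hf0 hfdet
  let A : AddSubgroup (G → ℂ) :=
    { carrier := P
      zero_mem' := by simpa using h2 Empty ∅ (fun _ => 0) (fun _ => 0) (by simp)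
      add_mem' := fun {a b} ha hb => by
        simpa using h2 Bool Finset.univ (fun _ => 1) (fun i => cond i a b)
          (fun i _ => by cases i <;> assumption)
      neg_mem' := fun {a} ha => by
        simpa using h2 Unit Finset.univ (fun _ => -1) (fun _ => a) (fun _ _ => ha) }
  have hle : basicGroup G ≤ A := by
    rw [basicGroup, AddSubgroup.closure_le]
    rintro _ ⟨φ, π, τ, hφ, hπ, hQ, hreal, h0, hdet⟩
    let e := MonoidHom.ofInjective hφ
    let π' := π.comp e.symm.toMonoidHom
    have hπ' : Function.Surjective π' := hπ.comp e.symm.surjective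
    let i := QuotientGroup.quotientKerEquivOfSurjective π' hπ'
    have hdet' : HasDet (τ ∘ π') 1 := hdet.comp π'
    have key := h1 φ.range π'.ker (τ ∘ π') hdet'.isGenChar (fun h => hreal _) (by simpa using h0)
      (hasTrivialDet_iff.mpr hdet') ?_ ⟨τ ∘ i, rfl⟩
    · rw [indHom_eq_indHom_range hφ]
      rwa [indChar_eq_indHom] at key
    · rcases hQ with hQ | hQ | hQ | ⟨q, hq, hq', hQ⟩
      · exact .inl (isCyclic_of_surjective i.symm i.symm.surjective)
      · exact .inr (.inl (hQ.map i.trans))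
      · exact .inr (.inr (.inl (hQ.map i.trans)))
      · exact .inr (.inr (.inr ⟨q, hq, hq', hQ.map i.trans⟩))
  exact hle (permGroup.mem_basicGroup hf.mem_permGroup hf0 (hasTrivialDet_iff.mp hfdet))
end

section
/- Let G be a finite group and ρ ∈ 𝒮_G a permutation character of degree 0 and trivial determinant. If ρ is a ℤ-linear combination of linear (degree-1) characters of G, then ρ ∈ 𝒫_G. -/
open scoped Classical

/-- A linear character, viewed as a complex-valued function. -/
def linearChar {G : Type} [Group G] (χ : G →* ℂˣ) : G → ℂ := fun g => χ g

/-- The diagonal representation attached to a finite family of linear characters. -/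
noncomputable def diagRep {G : Type} [Group G] {n : ℕ} (χ : Fin n → G →* ℂˣ) : FDRep ℂ G :=
  FDRep.of (V := Fin n → ℂ)
    { toFun := fun g => Matrix.toLin' (Matrix.diagonal fun i => (χ i g : ℂ))
      map_one' := by simp [Matrix.toLin'_one, Module.End.one_eq_id]
      map_mul' := fun g h => by
        rw [Module.End.mul_eq_comp, ← Matrix.toLin'_mul, Matrix.diagonal_mul_diagonal]
        simp }

lemma diagRep_ρ {G : Type} [Group G] {n : ℕ} (χ : Fin n → G →* ℂˣ) (g : G) :
    (diagRep χ).ρ g = Matrix.toLin' (Matrix.diagonal fun i => (χ i g : ℂ)) := rfl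

lemma character_diagRep {G : Type} [Group G] {n : ℕ} (χ : Fin n → G →* ℂˣ) (g : G) :
    (diagRep χ).character g = ∑ i, (χ i g : ℂ) := by
  refine (Matrix.trace_toLin'_eq (Matrix.diagonal fun i => (χ i g : ℂ))).trans ?_
  simp [Matrix.trace_diagonal]

lemma detRep_diagRep {G : Type} [Group G] {n : ℕ} (χ : Fin n → G →* ℂˣ) (g : G) :
    detRep (diagRep χ) g = ∏ i, (χ i g : ℂ) := by
  refine (LinearMap.det_toLin' (Matrix.diagonal fun i => (χ i g : ℂ))).trans ?_
  simp

lemma isChar_linearChar {G : Type} [Group G] (χ : G →* ℂˣ) : IsChar (linearChar χ) :=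
  ⟨diagRep ![χ], funext fun g => by simp [character_diagRep, linearChar]⟩

lemma exists_linearChar_eq {G : Type} [Group G] {f : G → ℂ} (hf : IsChar f) (h1 : f 1 = 1) :
    ∃ χ : G →* ℂˣ, f = linearChar χ := by
  obtain ⟨V, rfl⟩ := hf
  have hd : Module.finrank ℂ V = 1 := by
    have := FDRep.char_one V
    rw [h1] at this
    exact_mod_cast this.symm
  refine ⟨((LinearMap.det : (V →ₗ[ℂ] V) →* ℂ).comp V.ρ).toHomUnits, funext fun g => ?_⟩
  let b := Module.finBasisOfFinrankEq ℂ V hd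
  have htr : V.character g = LinearMap.trace ℂ V (V.ρ g) := rfl
  change V.character g = LinearMap.det (V.ρ g)
  rw [htr, LinearMap.trace_eq_matrix_trace ℂ b, ← LinearMap.det_toMatrix b,
    Matrix.det_fin_one, Matrix.trace_fin_one]

lemma conj_unitsHom {G : Type} [Group G] [Finite G] (χ : G →* ℂˣ) (g : G) :
    starRingEnd ℂ (χ g : ℂ) = (χ⁻¹ g : ℂˣ) := by
  have h : (χ g : ℂ) ^ Nat.card G = 1 := by
    rw [← Units.val_pow_eq_pow_val, ← map_pow, pow_card_eq_one']; simp
  have hn := Complex.norm_eq_one_of_pow_eq_one h Nat.card_pos.ne'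
  rw [MonoidHom.inv_apply, Units.val_inv_eq_inv_val, Complex.inv_eq_conj hn]

lemma conjFun_linearChar {G : Type} [Group G] [Finite G] (χ : G →* ℂˣ) :
    conjFun (linearChar χ) = linearChar χ⁻¹ :=
  funext fun g => conj_unitsHom χ g

lemma conjFun_indChar_one {G : Type} [Group G] [Fintype G] (H : Subgroup G) :
    conjFun (indChar H 1) = indChar H 1 := by
  funext g
  simp only [conjFun, indChar, map_mul, map_inv₀, map_natCast, map_sum]
  congr 2
  funext x
  split_ifs <;> simp

lemma conjFun_of_isPermChar {G : Type} [Group G] [Fintype G] {f : G → ℂ} (hf : IsPermChar f) :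
    conjFun f = f := by
  induction hf using Submodule.span_induction with
  | mem x hx => obtain ⟨H, rfl⟩ := hx; exact conjFun_indChar_one H
  | zero => funext g; simp [conjFun]
  | add x y _ _ hx hy =>
    funext g
    simpa [conjFun] using congrArg₂ (· + ·) (congrFun hx g) (congrFun hy g)
  | smul a x _ hx =>
    funext g
    simpa [conjFun] using congrArg (fun z => (a : ℂ) * z) (congrFun hx g)

lemma linearIndependent_linearChar (G : Type) [Group G] :
    LinearIndependent ℤ (linearChar : (G →* ℂˣ) → G → ℂ) := by
  have h := (linearIndependent_monoidHom G ℂ).comp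
    (fun χ : G →* ℂˣ => (Units.coeHom ℂ).comp χ) (fun χ ψ h => by
      ext g; exact DFunLike.congr_fun h g)
  exact h.restrict_scalars (R := ℤ) (fun a b h => by simpa using h)

lemma linearIndependent_powers :
    LinearIndependent ℤ (fun (z : ℂˣ) (k : ℕ) => (z : ℂ) ^ k) := by
  have h := (linearIndependent_monoidHom (Multiplicative ℕ) ℂ).comp
    (fun z : ℂˣ => powersHom ℂ (z : ℂ)) (fun z w h => Units.ext ((powersHom ℂ).injective h))
  have hℤ := h.restrict_scalars (R := ℤ) (fun a b h => by simpa using h)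
  exact hℤ

/-- An endomorphism of finite order is diagonalisable. -/
lemma exists_eigenvalues_of_pow_eq_one {V : Type} [AddCommGroup V] [Module ℂ V]
    [Module.Finite ℂ V] (f : V →ₗ[ℂ] V) {m : ℕ} (hm : m ≠ 0) (hf : f ^ m = 1) :
    ∃ (n : ℕ) (d : Fin n → ℂˣ), (∀ k, LinearMap.trace ℂ V (f ^ k) = ∑ i, (d i : ℂ) ^ k) ∧
      LinearMap.det f = ∏ i, (d i : ℂ) := by
  have hss : Module.End.IsSemisimple f := by
    refine Module.End.isSemisimple_of_squarefree_aeval_eq_zero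
      (p := Polynomial.X ^ m - 1) ?_ (by simp [hf])
    exact (Polynomial.separable_X_pow_sub_C (1 : ℂ) (by exact_mod_cast hm)
      one_ne_zero).squarefree
  have htop : Submodule.span ℂ {v : V | ∃ μ : ℂ, f v = μ • v} = ⊤ := by
    rw [eq_top_iff, ← Module.End.iSup_maxGenEigenspace_eq_top f]
    refine iSup_le fun μ => ?_
    rw [hss.isFinitelySemisimple.maxGenEigenspace_eq_eigenspace]
    exact fun v hv => Submodule.subset_span ⟨μ, Module.End.mem_eigenspace_iff.mp hv⟩
  obtain ⟨s, hs, hspan, hli⟩ := exists_linearIndependent ℂ {v : V | ∃ μ : ℂ, f v = μ • v}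
  let b₀ : Module.Basis s ℂ V := Module.Basis.mk hli (by simp [hspan, htop])
  have : Fintype s := FiniteDimensional.fintypeBasisIndex b₀
  let b := b₀.reindex (Fintype.equivFin s)
  have hb : ∀ i, ∃ μ : ℂ, f (b i) = μ • b i := fun i => by
    have : b i ∈ {v : V | ∃ μ : ℂ, f v = μ • v} := by
      simp only [b, b₀, Module.Basis.reindex_apply, Module.Basis.mk_apply]
      exact hs (Subtype.coe_prop _)
    exact this
  choose μ hμ using hb
  have hpow : ∀ k i, (f ^ k) (b i) = μ i ^ k • b i := fun k i => by
    induction k with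
    | zero => simp
    | succ k ih => rw [pow_succ', Module.End.mul_apply, ih, map_smul, hμ, smul_smul, pow_succ]
  have hμm : ∀ i, μ i ^ m = 1 := fun i => by
    have h := hpow m i
    rw [hf, Module.End.one_apply] at h
    exact (smul_left_injective ℂ (b.ne_zero i) (by simpa using h)).symm
  have hmat : ∀ k, LinearMap.toMatrix b b (f ^ k) = Matrix.diagonal fun i => μ i ^ k := fun k => by
    ext i j
    rw [LinearMap.toMatrix_apply, hpow, Matrix.diagonal_apply]
    by_cases h : i = j
    · simp [h]
    · simp [h]
  refine ⟨_, fun i => Units.mk0 (μ i) (fun h => by simpa [h, hm] using hμm i), fun k => ?_, ?_⟩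
  · rw [LinearMap.trace_eq_matrix_trace ℂ b, hmat, Matrix.trace_diagonal]
    rfl
  · rw [← LinearMap.det_toMatrix b, ← pow_one f, hmat, Matrix.det_diagonal]
    simp

/-- The determinant of a formal combination of linear characters. -/
noncomputable def formalDet (A : Type*) [CommGroup A] : (A →₀ ℤ) →ₗ[ℤ] Additive A :=
  Finsupp.linearCombination ℤ Additive.ofMul

lemma formalDet_eq_one_of_hasTrivialDet {G : Type} [Group G] [Finite G] (n : (G →* ℂˣ) →₀ ℤ)
    (h : HasTrivialDet (Finsupp.linearCombination ℤ linearChar n)) :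
    formalDet _ n = 0 := by
  obtain ⟨V, W, hVW, hdet⟩ := h
  suffices ∀ g, (formalDet _ n).toMul g = 1 from
    Additive.toMul.injective (MonoidHom.ext this)
  intro g
  have hfin : ∀ U : FDRep ℂ G, U.ρ g ^ Nat.card G = 1 := fun U => by
    rw [← map_pow, pow_card_eq_one', map_one]
  obtain ⟨p, a, hatr, hadet⟩ :=
    exists_eigenvalues_of_pow_eq_one (V.ρ g) Nat.card_pos.ne' (hfin V)
  obtain ⟨q, b, hbtr, hbdet⟩ :=
    exists_eigenvalues_of_pow_eq_one (W.ρ g) Nat.card_pos.ne' (hfin W)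
  have hchar : ∀ (U : FDRep ℂ G) k, U.character (g ^ k) = LinearMap.trace ℂ U (U.ρ g ^ k) :=
    fun U k => by rw [← map_pow]; rfl
  have hc : ∑ i, Finsupp.single (a i) (1 : ℤ) - ∑ j, Finsupp.single (b j) 1
      - n.mapDomain (fun χ => χ g) = 0 := by
    refine (linearIndependent_iff.mp linearIndependent_powers) _ (funext fun k => ?_)
    have hk := congrFun hVW (g ^ k)
    rw [Pi.sub_apply, hchar, hchar, hatr, hbtr] at hk
    rw [map_sub, map_sub, map_sum, map_sum, Finsupp.linearCombination_mapDomain]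
    simp only [Finsupp.linearCombination_single, one_smul, Pi.sub_apply, Finset.sum_apply,
      Pi.zero_apply]
    rw [← hk, sub_eq_zero]
    simp [Finsupp.linearCombination_apply, Finsupp.sum, linearChar]
  have hδ := congrArg (formalDet ℂˣ) hc
  have hn : formalDet ℂˣ (n.mapDomain fun χ => χ g) =
      Additive.ofMul ((formalDet _ n).toMul g) := by
    rw [formalDet, formalDet, Finsupp.linearCombination_mapDomain]
    change _ = (MonoidHom.toAdditive (MonoidHom.eval g)) _
    simp [Finsupp.linearCombination_apply, Finsupp.sum, map_sum]
  rw [map_zero, map_sub, hn, sub_eq_zero, map_sub, map_sum, map_sum] at hδ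
  simp only [formalDet, Finsupp.linearCombination_single, one_smul] at hδ
  have hdg := hdet g
  have hWm : LinearMap.det (W.ρ g) ^ Nat.card G = 1 := by rw [← map_pow, hfin, map_one]
  rw [detRep, detRep, ← Complex.inv_eq_conj
    (Complex.norm_eq_one_of_pow_eq_one hWm Nat.card_pos.ne'), hadet, hbdet] at hdg
  have hres : (∏ i, a i) / ∏ j, b j = 1 := Units.ext (by
    simpa [div_eq_mul_inv, Units.coe_prod] using hdg)
  rw [← hres]
  apply Additive.ofMul.injective
  rw [formalDet, ← hδ, ofMul_div, ofMul_prod, ofMul_prod]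

/-- `𝒫_G` as an additive subgroup. -/
def memPSubgroup (G : Type) [Group G] [Fintype G] : AddSubgroup (G → ℂ) where
  carrier := PG G
  zero_mem' := memP.zero
  add_mem' := memP.add _ _
  neg_mem' := memP.neg _

lemma indChar_top {G : Type} [Group G] [Fintype G] (f : (⊤ : Subgroup G) → ℂ)
    (hf : ∀ x g, f (x⁻¹ * g * x) = f g) (g : G) : indChar ⊤ f g = f ⟨g, Subgroup.mem_top g⟩ := by
  have h : ∀ x : G, (if h : x⁻¹ * g * x ∈ (⊤ : Subgroup G) then f ⟨x⁻¹ * g * x, h⟩ else 0)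
      = f ⟨g, Subgroup.mem_top g⟩ := fun x => by
    rw [dif_pos (Subgroup.mem_top _)]
    exact hf ⟨x, Subgroup.mem_top x⟩ ⟨g, Subgroup.mem_top g⟩
  rw [indChar, Finset.sum_congr rfl fun x _ => h x]
  simp

lemma linearChar_sub_one_add_inv_mem {G : Type} [Group G] [Fintype G] (χ : G →* ℂˣ) :
    (linearChar χ - 1) + (linearChar χ⁻¹ - 1) ∈ memPSubgroup G := by
  have hone : (1 : G → ℂ) = linearChar 1 := by funext g; simp [linearChar]
  have h := memP.conj_add (linearChar χ - 1)
    (sub_mem (Submodule.subset_span (isChar_linearChar χ))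
      (Submodule.subset_span (hone ▸ isChar_linearChar 1))) (by simp [linearChar])
  rw [← conjFun_linearChar]
  change memP G _
  convert h using 2
  funext g
  simp [conjFun]

lemma apply_eq_one_or_neg_one {H : Type} [Group H] {χ : H →* ℂˣ} (hχ : χ ^ 2 = 1) (h : H) :
    χ h = 1 ∨ χ h = -1 := by
  have : χ h ^ 2 = 1 := DFunLike.congr_fun hχ h
  rw [Units.ext_iff, Units.val_pow_eq_pow_val, Units.val_one, sq_eq_one_iff] at this
  exact this.imp Units.ext fun h => Units.ext (by simpa using h)

lemma exists_eq_neg_one_and_eq_one {H : Type} [Group H] {α β : H →* ℂˣ}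
    (hα : α ^ 2 = 1) (hβ : β ^ 2 = 1) (hα1 : α ≠ 1) (hαβ : α ≠ β) :
    ∃ h, α h = -1 ∧ β h = 1 := by
  obtain ⟨a, ha⟩ := DFunLike.ne_iff.mp hα1
  obtain ⟨c, hc⟩ := DFunLike.ne_iff.mp hαβ
  replace ha : α a = -1 := (apply_eq_one_or_neg_one hα a).resolve_left ha
  rcases apply_eq_one_or_neg_one hβ a with hba | hba
  · exact ⟨a, ha, hba⟩
  rcases apply_eq_one_or_neg_one hα c with hac | hac <;>
    rcases apply_eq_one_or_neg_one hβ c with hbc | hbc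
  · exact absurd (hac.trans hbc.symm) hc
  · exact ⟨a * c, by simp [ha, hac], by simp [hba, hbc]⟩
  · exact ⟨c, hac, hbc⟩
  · exact absurd (hac.trans hbc.symm) hc

lemma isTargetGroup_quotient_ker {H : Type} [Group H] {α β : H →* ℂˣ}
    (hα : α ^ 2 = 1) (hβ : β ^ 2 = 1) (hα1 : α ≠ 1) (hβ1 : β ≠ 1) (hαβ : α ≠ β) :
    IsTargetGroup (H ⧸ (α.prod β).ker) := by
  have hrange : (α.prod β).range =
      (Subgroup.zpowers (-1 : ℂˣ)).prod (Subgroup.zpowers (-1 : ℂˣ)) := by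
    refine le_antisymm ?_ ?_
    · rintro _ ⟨h, rfl⟩
      have hmem : ∀ {χ : H →* ℂˣ}, χ ^ 2 = 1 → χ h ∈ Subgroup.zpowers (-1 : ℂˣ) := fun hχ => by
        rcases apply_eq_one_or_neg_one hχ h with h | h <;> rw [h]
        · exact one_mem _
        · exact Subgroup.mem_zpowers _
      exact Subgroup.mem_prod.mpr ⟨hmem hα, hmem hβ⟩
    · obtain ⟨a, ha, ha'⟩ := exists_eq_neg_one_and_eq_one hα hβ hα1 hαβ
      obtain ⟨b, hb, hb'⟩ := exists_eq_neg_one_and_eq_one hβ hα hβ1 hαβ.symm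
      rw [Subgroup.prod_le_iff]
      constructor
      · rw [Subgroup.map_le_iff_le_comap, Subgroup.zpowers_le]
        exact ⟨a, Prod.ext ha ha'⟩
      · rw [Subgroup.map_le_iff_le_comap, Subgroup.zpowers_le]
        exact ⟨b, Prod.ext hb' hb⟩
  have hcard : Nat.card (H ⧸ (α.prod β).ker) = 4 := by
    have horder : orderOf (-1 : ℂˣ) = 2 := by
      rw [← orderOf_units, Units.val_neg, Units.val_one, orderOf_neg_one, ringChar.eq_zero]
      rfl
    rw [← Subgroup.index_eq_card, Subgroup.index_ker, hrange,
      Nat.card_congr (Subgroup.prodEquiv _ _).toEquiv, Nat.card_prod, Nat.card_zpowers, horder]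
  have hexp : Monoid.exponent (H ⧸ (α.prod β).ker) = 2 := by
    have hdvd : Monoid.exponent (H ⧸ (α.prod β).ker) ∣ 2 := by
      refine Monoid.exponent_dvd_of_forall_pow_eq_one fun x => ?_
      induction x using QuotientGroup.induction_on with
      | H h =>
        rw [← QuotientGroup.mk_pow, QuotientGroup.eq_one_iff, MonoidHom.mem_ker, map_pow]
        exact Prod.ext (DFunLike.congr_fun hα h) (DFunLike.congr_fun hβ h)
    refine ((Nat.dvd_prime Nat.prime_two).mp hdvd).resolve_left fun h => ?_
    have := Monoid.exp_eq_one_iff.mp h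
    have := Nat.card_of_subsingleton (1 : H ⧸ (α.prod β).ker)
    omega
  have : IsKleinFour (H ⧸ (α.prod β).ker) := ⟨hcard, hexp⟩
  exact Or.inl IsKleinFour.nonempty_mulEquiv

lemma linearChar_one {G : Type} [Group G] : linearChar (1 : G →* ℂˣ) = 1 := by
  funext g
  simp [linearChar]

lemma linearChar_add_sub_mul_mem {G : Type} [Group G] [Fintype G] {α β : G →* ℂˣ}
    (hα : α ^ 2 = 1) (hβ : β ^ 2 = 1) :
    (linearChar α - 1) + (linearChar β - 1) - (linearChar (α * β) - 1) ∈ memPSubgroup G := by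
  by_cases hα1 : α = 1
  · have : α * β = β := by subst hα1; exact one_mul β
    rw [this, hα1, linearChar_one]
    simp
  by_cases hβ1 : β = 1
  · have : α * β = α := by subst hβ1; exact mul_one α
    rw [this, hβ1, linearChar_one]
    simp
  by_cases hαβ : α = β
  · have h := linearChar_sub_one_add_inv_mem α
    have hmul : α * α = 1 := (sq α).symm.trans hα
    have hinv : α⁻¹ = α := MonoidHom.ext fun g =>
      inv_eq_of_mul_eq_one_left (DFunLike.congr_fun hmul g)
    rw [hinv] at h
    rw [← hαβ, hmul, linearChar_one]
    simpa using h
  let i := (⊤ : Subgroup G).subtype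
  have hinj : Function.Injective fun χ : G →* ℂˣ => χ.comp i := fun χ ψ h => by
    ext g
    exact congrArg Units.val (DFunLike.congr_fun h ⟨g, Subgroup.mem_top g⟩)
  have hsq : ∀ {χ : G →* ℂˣ}, χ ^ 2 = 1 → (χ.comp i) ^ 2 = 1 := fun hχ =>
    MonoidHom.ext fun h => DFunLike.congr_fun hχ (i h)
  have h := memP.ind ⊤ ((α.comp i).prod (β.comp i)).ker (diagRep ![α.comp i, β.comp i])
    (by rw [character_diagRep]; norm_num)
    (isTargetGroup_quotient_ker (hsq hα) (hsq hβ) (fun h => hα1 (hinj h))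
      (fun h => hβ1 (hinj h)) (fun h => hαβ (hinj h)))
    (fun n hn => by
      rw [MonoidHom.mem_ker, MonoidHom.prod_apply, Prod.mk_eq_one] at hn
      have hdiag : (fun j => ((![α.comp i, β.comp i] j n : ℂˣ) : ℂ)) = fun _ => 1 := by
        funext j
        fin_cases j
        · exact congrArg Units.val hn.1
        · exact congrArg Units.val hn.2
      rw [diagRep_ρ, hdiag, Matrix.diagonal_one]
      exact Matrix.toLin'_one)
  change memP G _
  convert h using 1
  funext g
  rw [indChar_top]
  · simp [character_diagRep, detRep_diagRep, linearChar, i]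
    ring
  · intro x g
    simp [character_diagRep, detRep_diagRep, mul_comm]

lemma zsmul_sub_zpow_mem {X A : Type*} [CommGroup X] [AddCommGroup A] {P : AddSubgroup A}
    {Ψ : X → A} (hmul : ∀ x y, x ^ 2 = 1 → y ^ 2 = 1 → Ψ x + Ψ y - Ψ (x * y) ∈ P)
    {x : X} (hx : x ^ 2 = 1) (k : ℤ) : k • Ψ x - Ψ (x ^ k) ∈ P := by
  have h1 : Ψ 1 ∈ P := by simpa using hmul 1 1 (one_pow 2) (one_pow 2)
  have h2 : Ψ x + Ψ x ∈ P := by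
    have h := add_mem (hmul x x hx hx) h1
    rwa [← sq, hx, sub_add_cancel] at h
  have hz : ∀ j : ℤ, x ^ (2 * j) = 1 := fun j => by
    rw [zpow_mul, zpow_ofNat, hx, one_zpow]
  have hj : ∀ j : ℤ, (2 * j) • Ψ x ∈ P := fun j => by
    rw [two_mul, add_smul, ← smul_add]
    exact zsmul_mem h2 j
  obtain ⟨j, rfl | rfl⟩ := Int.even_or_odd' k
  · rw [hz]
    exact sub_mem (hj j) h1
  · rw [zpow_add, hz, zpow_one, one_mul, add_smul, one_smul, add_sub_cancel_right]
    exact hj j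

/-- If `Ψ` is, modulo `P`, odd and additive on elements of order dividing two, then an
inversion-invariant combination of values of `Ψ` depends, modulo `P`, only on the corresponding
product. -/
lemma linearCombination_sub_formalDet_mem {X A : Type*} [CommGroup X] [AddCommGroup A]
    {P : AddSubgroup A} {Ψ : X → A} (hinv : ∀ x, Ψ x + Ψ x⁻¹ ∈ P)
    (hmul : ∀ x y, x ^ 2 = 1 → y ^ 2 = 1 → Ψ x + Ψ y - Ψ (x * y) ∈ P)
    (n : X →₀ ℤ) (hn : ∀ x, n x⁻¹ = n x) :
    Finsupp.linearCombination ℤ Ψ n - Ψ (formalDet X n).toMul ∈ P ∧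
      (formalDet X n).toMul ^ 2 = 1 := by
  induction hc : n.support.card using Nat.strong_induction_on generalizing n with
  | _ c ih =>
  by_cases h0 : n = 0
  · have h1 : Ψ 1 ∈ P := by simpa using hmul 1 1 (one_pow 2) (one_pow 2)
    simpa [h0] using h1
  obtain ⟨x, hx⟩ := Finsupp.support_nonempty_iff.mpr h0
  have hxn := Finsupp.mem_support_iff.mp hx
  have step : ∀ m : X →₀ ℤ, (∀ y, n y = 0 → m y = 0) → m x = n x →
      (n - m).support.card < c := fun m hm hmx => by
    rw [← hc]
    refine Finset.card_lt_card ((Finset.ssubset_iff_of_subset fun y hy => ?_).mpr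
      ⟨x, hx, by simp [hmx]⟩)
    rw [Finsupp.mem_support_iff] at hy ⊢
    exact fun h => hy (by simp [h, hm y h])
  by_cases hsq : x ^ 2 = 1
  · have hxinv : x⁻¹ = x := inv_eq_of_mul_eq_one_left (by rw [← sq, hsq])
    obtain ⟨h1, h2⟩ := ih _ (step (Finsupp.single x (n x))
      (fun y hy => Finsupp.single_eq_of_ne (by rintro rfl; exact hxn hy)) (by simp))
      (n - Finsupp.single x (n x)) (fun y => by
        have : x = y⁻¹ ↔ x = y := by rw [← inv_eq_iff_eq_inv, hxinv]
        simp [hn, Finsupp.single_apply, this]) rfl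
    set n' := n - Finsupp.single x (n x) with hn'
    have hadd : n = n' + Finsupp.single x (n x) := by simp [hn']
    have hδ : (formalDet X n).toMul = (formalDet X n').toMul * x ^ n x := by
      conv_lhs => rw [hadd]
      rw [formalDet, map_add, Finsupp.linearCombination_single]
      rfl
    have hk2 : (x ^ n x) ^ 2 = 1 := by
      rw [← zpow_natCast, ← zpow_mul, mul_comm, zpow_mul, zpow_natCast, hsq, one_zpow]
    refine ⟨?_, by rw [hδ, mul_pow, h2, hk2, one_mul]⟩
    have hL : Finsupp.linearCombination ℤ Ψ n =
        Finsupp.linearCombination ℤ Ψ n' + n x • Ψ x := by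
      conv_lhs => rw [hadd]
      rw [map_add, Finsupp.linearCombination_single]
    rw [hδ, hL]
    convert add_mem (add_mem h1 (zsmul_sub_zpow_mem hmul hsq (n x))) (hmul _ _ h2 hk2) using 1
    abel
  · have hne : x ≠ x⁻¹ := fun h => hsq (by rw [sq, ← eq_inv_iff_mul_eq_one, ← h])
    let m : X →₀ ℤ := Finsupp.single x (n x) + Finsupp.single x⁻¹ (n x)
    obtain ⟨h1, h2⟩ := ih _ (step m
      (fun y hy => by
        have e1 : y ≠ x := by rintro rfl; exact hxn hy
        have e2 : y ≠ x⁻¹ := by rintro rfl; exact hxn (hn x ▸ hy)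
        simp [m, e1, e2])
      (by simp [m, hne]))
      (n - m) (fun y => by
        have e : x = y⁻¹ ↔ x⁻¹ = y := inv_eq_iff_eq_inv.symm
        simp [m, hn, Finsupp.single_apply, e, add_comm]) rfl
    have hadd : n = (n - m) + m := by simp
    have hδ : formalDet X n = formalDet X (n - m) := by
      conv_lhs => rw [hadd]
      rw [map_add, add_eq_left]
      simp [formalDet, m]
    have hL : Finsupp.linearCombination ℤ Ψ n =
        Finsupp.linearCombination ℤ Ψ (n - m) + n x • (Ψ x + Ψ x⁻¹) := by
      conv_lhs => rw [hadd]
      rw [map_add, map_add, Finsupp.linearCombination_single, Finsupp.linearCombination_single,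
        smul_add]
    rw [hδ, hL, add_sub_right_comm]
    exact ⟨add_mem h1 (zsmul_mem (hinv x) _), h2⟩

lemma inv_apply_of_conjFun_eq {G : Type} [Group G] [Finite G] {n : (G →* ℂˣ) →₀ ℤ}
    (h : conjFun (Finsupp.linearCombination ℤ linearChar n) =
      Finsupp.linearCombination ℤ linearChar n) (χ : G →* ℂˣ) : n χ⁻¹ = n χ := by
  have hinj : Function.Injective fun χ : G →* ℂˣ => χ⁻¹ := fun α β h =>
    MonoidHom.ext fun g => inv_injective (DFunLike.congr_fun h g)
  have hsymm : n.mapDomain (fun χ => χ⁻¹) = n := by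
    refine linearIndependent_linearChar G ?_
    rw [← h, Finsupp.linearCombination_mapDomain]
    funext g
    simp only [conjFun, Finsupp.linearCombination_apply, Finsupp.sum, Function.comp_def,
      Finset.sum_apply, Pi.smul_apply, ← conjFun_linearChar, map_sum, map_zsmul]
  have := Finsupp.mapDomain_apply hinj n χ
  rwa [hsymm] at this

lemma linearCombination_linearChar_sub_one {G : Type} [Group G] {n : (G →* ℂˣ) →₀ ℤ}
    (hdeg : Finsupp.linearCombination ℤ linearChar n 1 = 0) :
    Finsupp.linearCombination ℤ (fun χ : G →* ℂˣ => linearChar χ - 1) n =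
      Finsupp.linearCombination ℤ linearChar n := by
  funext g
  have h1 : (∑ χ ∈ n.support, (n χ : ℂ)) = 0 := by
    simpa [Finsupp.linearCombination_apply, Finsupp.sum, linearChar] using hdeg
  simp [Finsupp.linearCombination_apply, Finsupp.sum, mul_sub, h1]

lemma linearCombination_linearChar_mem {G : Type} [Group G] [Fintype G] {n : (G →* ℂˣ) →₀ ℤ}
    (hsymm : ∀ χ, n χ⁻¹ = n χ)
    (hdeg : Finsupp.linearCombination ℤ linearChar n 1 = 0) (hdet : formalDet _ n = 0) :
    Finsupp.linearCombination ℤ linearChar n ∈ memPSubgroup G := by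
  have hinv := linearChar_sub_one_add_inv_mem (G := G)
  have hmul := fun (α β : G →* ℂˣ) => linearChar_add_sub_mul_mem (α := α) (β := β)
  generalize memPSubgroup G = P at *
  have h : Finsupp.linearCombination ℤ (fun χ : G →* ℂˣ => linearChar χ - 1) n -
      (linearChar (formalDet _ n).toMul - 1) ∈ P := by
    refine (linearCombination_sub_formalDet_mem
      (Ψ := fun χ : G →* ℂˣ => linearChar χ - 1) ?_ ?_ n ?_).1
    · intro χ
      exact hinv χ
    · intro α β
      exact hmul α β
    · intro χ
      exact hsymm χ
  have hone : linearChar (formalDet _ n).toMul - 1 = 0 := by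
    rw [hdet, sub_eq_zero]
    exact linearChar_one
  rwa [linearCombination_linearChar_sub_one hdeg, hone, sub_zero] at h

/-- **Lemma 2.3.** If `ρ ∈ 𝒮_G` is a `ℤ`-linear combination of linear (degree-1) characters
of `G`, then `ρ ∈ 𝒫_G`. -/
theorem statement8 (G : Type) [Group G] [Fintype G] (ρ : G → ℂ) (hρ : ρ ∈ SG G)
    (hlin : ρ ∈ Submodule.span ℤ {f : G → ℂ | IsChar f ∧ f 1 = 1}) : ρ ∈ PG G := by
  obtain ⟨hperm, hdeg, hdet⟩ := hρ
  obtain ⟨n, rfl⟩ : ∃ n : (G →* ℂˣ) →₀ ℤ, Finsupp.linearCombination ℤ linearChar n = ρ := by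
    change ρ ∈ LinearMap.range (Finsupp.linearCombination ℤ linearChar)
    rw [Finsupp.range_linearCombination]
    refine Submodule.span_mono ?_ hlin
    rintro f ⟨hf, h1⟩
    obtain ⟨χ, rfl⟩ := exists_linearChar_eq hf h1
    exact ⟨χ, rfl⟩
  exact linearCombination_linearChar_mem (inv_apply_of_conjFun_eq (conjFun_of_isPermChar hperm))
    hdeg (formalDet_eq_one_of_hasTrivialDet n hdet)
end

section
/- If G is a finite group of odd order, then 𝒮_G ⊆ 𝒫_G. -/
open scoped Classical

/-- The trace of the powers of an endomorphism of finite order, as a sum over its eigenvalues. -/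
lemma exists_trace_pow_eq_sum {V : Type*} [AddCommGroup V] [Module ℂ V] [FiniteDimensional ℂ V]
    {f : Module.End ℂ V} {n : ℕ} (hn : n ≠ 0) (hf : f ^ n = 1) :
    ∃ (s : Finset ℂ) (d : ℂ → ℕ), (∀ μ ∈ s, μ ^ n = 1) ∧
      ∀ k : ℕ, LinearMap.trace ℂ V (f ^ k) = ∑ μ ∈ s, μ ^ k * d μ := by
  have hss : f.IsSemisimple := by
    refine Module.End.isSemisimple_of_squarefree_aeval_eq_zero (p := Polynomial.X ^ n - 1)
      (Polynomial.X_pow_sub_one_separable_iff.mpr (by exact_mod_cast hn)).squarefree ?_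
    simp [hf]
  have htop : ⨆ μ : ℂ, f.eigenspace μ = ⊤ :=
    hss.iSup_maxGenEigenspace_eq_top_iff.mp (Module.End.iSup_maxGenEigenspace_eq_top f)
  have hint : DirectSum.IsInternal f.eigenspace :=
    DirectSum.isInternal_submodule_of_iSupIndep_of_iSup_eq_top f.eigenspaces_iSupIndep htop
  have hfin : {μ : ℂ | f.eigenspace μ ≠ ⊥}.Finite :=
    WellFoundedGT.finite_ne_bot_of_iSupIndep f.eigenspaces_iSupIndep
  have hpow : ∀ (μ : ℂ) (k : ℕ) (v : V), v ∈ f.eigenspace μ → (f ^ k) v = μ ^ k • v := by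
    intro μ k v hv
    rw [Module.End.mem_eigenspace_iff] at hv
    induction k with
    | zero => simp
    | succ k ih => rw [pow_succ, Module.End.mul_apply, hv, map_smul, ih, smul_smul, pow_succ']
  refine ⟨hfin.toFinset, fun μ => Module.finrank ℂ (f.eigenspace μ), fun μ hμ => ?_, fun k => ?_⟩
  · rw [Set.Finite.mem_toFinset] at hμ
    obtain ⟨v, hv, hv0⟩ := (Submodule.ne_bot_iff _).mp hμ
    have h := hpow μ n v hv
    rw [hf, Module.End.one_apply] at h
    have h' : (μ ^ n - 1) • v = 0 := by rw [sub_smul, one_smul, ← h, sub_self]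
    exact sub_eq_zero.mp ((smul_eq_zero.mp h').resolve_right hv0)
  · have hmaps : ∀ μ : ℂ, Set.MapsTo (f ^ k) (f.eigenspace μ) (f.eigenspace μ) := by
      intro μ v hv
      rw [hpow μ k v hv]
      exact Submodule.smul_mem _ _ hv
    rw [LinearMap.trace_eq_sum_trace_restrict' hint hfin hmaps]
    refine Finset.sum_congr rfl fun μ _ => ?_
    have : (f ^ k).restrict (hmaps μ) = μ ^ k • LinearMap.id := by
      ext v
      exact hpow μ k v v.2
    rw [this, map_smul, LinearMap.trace_id, smul_eq_mul]

/-- Splitting a sum over a finite set along a fixed-point-free involution. -/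
lemma Finset.exists_sum_eq_sum_add_involution {α M : Type*} [AddCommMonoid M] (s : Finset α)
    (σ : α → α) (hmem : ∀ x ∈ s, σ x ∈ s) (hinv : ∀ x ∈ s, σ (σ x) = x)
    (hne : ∀ x ∈ s, σ x ≠ x) (F : α → M) :
    ∃ t ⊆ s, ∑ x ∈ s, F x = ∑ x ∈ t, (F x + F (σ x)) := by
  induction s using Finset.strongInduction with
  | H s ih =>
    obtain rfl | ⟨a, ha⟩ := s.eq_empty_or_nonempty
    · exact ⟨∅, by simp⟩
    have hσa : σ a ∈ s.erase a := Finset.mem_erase.mpr ⟨hne a ha, hmem a ha⟩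
    have hsub : (s.erase a).erase (σ a) ⊆ s :=
      (Finset.erase_subset _ _).trans (Finset.erase_subset _ _)
    obtain ⟨t, hts, ht⟩ := ih ((s.erase a).erase (σ a))
      ((Finset.erase_ssubset hσa).trans (Finset.erase_ssubset ha))
      (fun x hx => by
        simp only [Finset.mem_erase] at hx ⊢
        obtain ⟨h₁, h₂, h₃⟩ := hx
        refine ⟨fun h => h₂ ?_, fun h => h₁ ?_, hmem x h₃⟩
        · rw [← hinv x h₃, h, hinv a ha]
        · rw [← hinv x h₃, h])
      (fun x hx => hinv x (hsub hx)) (fun x hx => hne x (hsub hx))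
    have hat : a ∉ t := fun h => by simpa using hts h
    refine ⟨insert a t, Finset.insert_subset ha (hts.trans hsub), ?_⟩
    rw [Finset.sum_insert hat, ← ht, add_assoc, Finset.add_sum_erase _ _ hσa,
      Finset.add_sum_erase _ _ ha]

lemma even_of_eq_two_mul_isIntegral {z : ℤ} {s : ℂ} (hs : IsIntegral ℤ s) (h : (z : ℂ) = 2 * s) :
    Even z := by
  have hq : s = algebraMap ℚ ℂ (z / 2) := by
    simp only [eq_ratCast, Rat.cast_div, Rat.cast_intCast, Rat.cast_ofNat]
    rw [h]; ring
  rw [hq, isIntegral_algebraMap_iff (algebraMap ℚ ℂ).injective] at hs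
  obtain ⟨m, hm⟩ := IsIntegrallyClosed.isIntegral_iff.mp hs
  refine ⟨m, ?_⟩
  have : (z : ℚ) = m + m := by
    simp only [algebraMap_int_eq, eq_intCast] at hm
    rw [hm]; ring
  exact_mod_cast this

section FunctionInner

variable {G : Type}

lemma conjFun_conjFun (f : G → ℂ) : conjFun (conjFun f) = f := by
  ext g; simp [conjFun]

variable [Fintype G]

/-- The Hermitian inner product of two functions on a finite group. -/
noncomputable def charInner (f h : G → ℂ) : ℂ :=
  (Nat.card G : ℂ)⁻¹ * ∑ g : G, f g * starRingEnd ℂ (h g)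

lemma charInner_sum_left {ι : Type*} (s : Finset ι) (c : ι → ℂ) (F : ι → G → ℂ) (h : G → ℂ) :
    charInner (∑ i ∈ s, c i • F i) h = ∑ i ∈ s, c i * charInner (F i) h := by
  simp only [charInner, Finset.sum_apply, Pi.smul_apply, smul_eq_mul, Finset.sum_mul,
    Finset.mul_sum]
  rw [Finset.sum_comm]
  refine Finset.sum_congr rfl fun i _ => Finset.sum_congr rfl fun g _ => by ring

lemma charInner_conjFun (f h : G → ℂ) :
    charInner (conjFun f) (conjFun h) = starRingEnd ℂ (charInner f h) := by
  simp [charInner, conjFun]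

lemma charInner_sub_self (f h : G → ℂ) :
    charInner (f - h) (f - h) =
      charInner f f - charInner f h - charInner h f + charInner h h := by
  simp only [charInner, ← mul_sub, ← mul_add, ← Finset.sum_sub_distrib, ← Finset.sum_add_distrib]
  congr 1
  refine Finset.sum_congr rfl fun g _ => ?_
  simp only [Pi.sub_apply, map_sub]
  ring

lemma charInner_self_eq_ofReal (f : G → ℂ) :
    charInner f f = (((Nat.card G : ℝ)⁻¹ * ∑ g : G, ‖f g‖ ^ 2 : ℝ) : ℂ) := by
  simp [charInner, Complex.mul_conj']

end FunctionInner

section Characters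

variable {G : Type} [Group G]

lemma FDRep.exists_character_pow_eq_sum [Finite G] (V : FDRep ℂ G) (g : G) :
    ∃ (s : Finset ℂ) (d : ℂ → ℕ), (∀ μ ∈ s, μ ^ Nat.card G = 1) ∧
      ∀ k : ℕ, V.character (g ^ k) = ∑ μ ∈ s, μ ^ k * d μ := by
  obtain ⟨s, d, hs, hd⟩ := exists_trace_pow_eq_sum (f := V.ρ g) (n := Nat.card G)
    Nat.card_pos.ne' (by rw [← map_pow, pow_card_eq_one', map_one])
  refine ⟨s, d, hs, fun k => ?_⟩
  rw [← hd k, FDRep.character, map_pow]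

lemma FDRep.isIntegral_character [Finite G] (V : FDRep ℂ G) (g : G) :
    IsIntegral ℤ (V.character g) := by
  obtain ⟨s, d, hs, hd⟩ := V.exists_character_pow_eq_sum g
  have h := hd 1
  simp only [pow_one] at h
  rw [h]
  refine IsIntegral.sum _ fun μ hμ => IsIntegral.mul ?_ ?_
  · exact IsIntegral.of_pow Nat.card_pos (by rw [hs μ hμ]; exact isIntegral_one)
  · exact isIntegral_algebraMap (R := ℤ) (x := (d μ : ℤ))

lemma FDRep.character_inv [Finite G] (V : FDRep ℂ G) (g : G) :
    V.character g⁻¹ = starRingEnd ℂ (V.character g) := by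
  obtain ⟨s, d, hs, hd⟩ := V.exists_character_pow_eq_sum g
  have hcard : Nat.card G - 1 + 1 = Nat.card G := Nat.sub_add_cancel Nat.card_pos
  have hg : g⁻¹ = g ^ (Nat.card G - 1) := by
    rw [inv_eq_iff_mul_eq_one, ← pow_succ', hcard, pow_card_eq_one']
  have h := hd 1
  simp only [pow_one] at h
  rw [hg, hd, h, map_sum]
  refine Finset.sum_congr rfl fun μ hμ => ?_
  have hμ1 : ‖μ‖ = 1 := Complex.norm_eq_one_of_pow_eq_one (hs μ hμ) Nat.card_pos.ne'
  have hμ0 : μ ≠ 0 := norm_ne_zero_iff.mp (by simp [hμ1])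
  rw [map_mul, Complex.conj_natCast]
  congr 1
  have h1 : μ * μ ^ (Nat.card G - 1) = 1 := by rw [← pow_succ', hcard, hs μ hμ]
  have h2 : μ * starRingEnd ℂ μ = 1 := by rw [Complex.mul_conj', hμ1]; simp
  exact mul_left_cancel₀ hμ0 (h1.trans h2.symm)

variable [Fintype G]

/-- `f` is an irreducible character, i.e. a character of norm one. -/
def IsIrrChar (f : G → ℂ) : Prop := IsChar f ∧ charInner f f = 1

lemma charInner_self_eq_zero {f : G → ℂ} (h : charInner f f = 0) : f = 0 := by
  rw [charInner_self_eq_ofReal, Complex.ofReal_eq_zero] at h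
  have hc : (Nat.card G : ℝ)⁻¹ ≠ 0 := by simp
  have h' := (mul_eq_zero.mp h).resolve_left hc
  rw [Finset.sum_eq_zero_iff_of_nonneg fun _ _ => by positivity] at h'
  ext g
  simpa using h' g (Finset.mem_univ g)

lemma IsChar.exists_charInner_eq_natCast {f h : G → ℂ} (hf : IsChar f) (hh : IsChar h) :
    ∃ n : ℕ, charInner f h = n := by
  obtain ⟨V, rfl⟩ := hf
  obtain ⟨W, rfl⟩ := hh
  have : Invertible (Nat.card G : ℂ) := invertibleOfNonzero (by simp)
  exact ⟨_, by
    simpa only [charInner, FDRep.character_inv] using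
      FDRep.scalar_product_char_eq_finrank_equivariant W V⟩

lemma IsChar.conjFun {f : G → ℂ} (hf : IsChar f) : IsChar (conjFun f) := by
  obtain ⟨V, rfl⟩ := hf
  refine ⟨FDRep.of (Representation.dual V.ρ), ?_⟩
  ext g
  rw [FDRep.char_dual, FDRep.character_inv]
  rfl

lemma IsIrrChar.conjFun {f : G → ℂ} (hf : IsIrrChar f) : IsIrrChar (conjFun f) :=
  ⟨hf.1.conjFun, by rw [charInner_conjFun, hf.2, map_one]⟩

lemma isIrrChar_one : IsIrrChar (1 : G → ℂ) := by
  refine ⟨⟨FDRep.of (Representation.trivial ℂ G ℂ), ?_⟩, ?_⟩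
  · ext g
    simp [FDRep.character]
  · simp [charInner]

lemma IsIrrChar.charInner_eq_zero {f h : G → ℂ} (hf : IsIrrChar f) (hh : IsIrrChar h)
    (hne : f ≠ h) : charInner f h = 0 := by
  obtain ⟨n, hn⟩ := hf.1.exists_charInner_eq_natCast hh.1
  have hn' : charInner h f = n := by
    have : charInner h f = starRingEnd ℂ (charInner f h) := by
      simp [charInner, mul_comm]
    rw [this, hn, Complex.conj_natCast]
  have hsub := charInner_sub_self f h
  rw [hf.2, hh.2, hn, hn'] at hsub
  have hreal := charInner_self_eq_ofReal (f - h)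
  rw [hsub] at hreal
  have hreal' : (1 - n - n + 1 : ℝ) = (Nat.card G : ℝ)⁻¹ * ∑ g : G, ‖(f - h) g‖ ^ 2 := by
    exact_mod_cast hreal
  have hnonneg : (0 : ℝ) ≤ 1 - n - n + 1 := by rw [hreal']; positivity
  have hle : n ≤ 1 := by
    have : (n : ℝ) ≤ 1 := by linarith
    exact_mod_cast this
  interval_cases n
  · simpa using hn
  · refine absurd (sub_eq_zero.mp (charInner_self_eq_zero (f := f - h) ?_)) hne
    rw [hsub]; norm_num

lemma IsIrrChar.eq_one_of_conjFun_eq (hodd : Odd (Nat.card G)) {f : G → ℂ} (hf : IsIrrChar f)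
    (hreal : _root_.conjFun f = f) : f = 1 := by
  by_contra hne
  have hreal' : ∀ g, starRingEnd ℂ (f g) = f g := fun g => congrFun hreal g
  have hc0 : (Nat.card G : ℂ) ≠ 0 := by simp
  have horth := hf.charInner_eq_zero isIrrChar_one hne
  have hnorm := hf.2
  simp only [charInner, hreal', Pi.one_apply, map_one, mul_one] at horth hnorm
  have hsum : ∑ g : G, f g = 0 := (mul_eq_zero.mp horth).resolve_left (inv_ne_zero hc0)
  have hsq : ∑ g : G, f g * f g = Nat.card G := by
    rw [inv_mul_eq_one₀ hc0] at hnorm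
    exact hnorm.symm
  obtain ⟨V, hV⟩ := hf.1
  have hint : ∀ g, IsIntegral ℤ (f g) := fun g => hV ▸ V.isIntegral_character g
  have hinv : ∀ g, f g⁻¹ = f g := fun g => by
    rw [← hreal' g, ← hV, V.character_inv]
  have hdeg : f 1 = (Module.finrank ℂ V : ℂ) := hV ▸ V.char_one
  have hfixed : ∀ g ∈ Finset.univ.erase (1 : G), g⁻¹ ≠ g := by
    intro g hg h
    refine Finset.ne_of_mem_erase hg ?_
    have h2 : g ^ 2 = 1 := by rw [pow_two]; nth_rw 1 [← h]; simp
    have hord : orderOf g ∣ Nat.gcd 2 (Nat.card G) :=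
      Nat.dvd_gcd (orderOf_dvd_of_pow_eq_one h2) (orderOf_dvd_natCard g)
    rw [Nat.coprime_two_left.mpr hodd, Nat.dvd_one, orderOf_eq_one_iff] at hord
    exact hord
  have hhalf : ∀ F : G → ℂ, (∀ g, IsIntegral ℤ (F g)) → (∀ g, F g⁻¹ = F g) →
      ∃ s : ℂ, IsIntegral ℤ s ∧ ∑ g, F g = F 1 + 2 * s := by
    intro F hF hFinv
    obtain ⟨t, -, ht⟩ := Finset.exists_sum_eq_sum_add_involution (Finset.univ.erase (1 : G))
      (fun g => g⁻¹) (by simp) (by simp) hfixed F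
    refine ⟨∑ g ∈ t, F g, IsIntegral.sum _ fun g _ => hF g, ?_⟩
    rw [← Finset.add_sum_erase _ _ (Finset.mem_univ 1), ht, Finset.mul_sum]
    simp only [hFinv, two_mul]
  obtain ⟨s₁, hs₁, h₁⟩ := hhalf f hint hinv
  obtain ⟨s₂, hs₂, h₂⟩ := hhalf (fun g => f g * f g) (fun g => (hint g).mul (hint g))
    (fun g => by simp only [hinv])
  rw [hsum, hdeg] at h₁
  rw [hsq] at h₂
  simp only [hdeg] at h₂
  have hd : Even (Module.finrank ℂ V : ℤ) := by
    refine even_of_eq_two_mul_isIntegral hs₁.neg ?_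
    push_cast
    linear_combination -h₁
  have hG : Even ((Nat.card G : ℤ) - Module.finrank ℂ V * Module.finrank ℂ V) := by
    refine even_of_eq_two_mul_isIntegral hs₂ ?_
    push_cast
    linear_combination h₂
  have hcard : Even (Nat.card G : ℤ) := by
    have := hG.add (hd.mul_right (Module.finrank ℂ V : ℤ))
    rwa [sub_add_cancel] at this
  exact Nat.not_even_iff_odd.mpr hodd (by exact_mod_cast hcard)

lemma Representation.character_mem_span_isIrrChar {V : Type} [AddCommGroup V] [Module ℂ V]
    [FiniteDimensional ℂ V] (ρ : Representation ℂ G V) :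
    ρ.character ∈ Submodule.span ℤ {f : G → ℂ | IsIrrChar f} := by
  induction hn : Module.finrank ℂ V using Nat.strong_induction_on generalizing V with
  | _ n ih =>
    obtain rfl | hpos := Nat.eq_zero_or_pos n
    · have := Module.finrank_zero_iff.mp hn
      have h0 : ρ.character = 0 := by
        ext g
        rw [Representation.character, Subsingleton.elim (ρ g) 0, map_zero, Pi.zero_apply]
      rw [h0]
      exact Submodule.zero_mem _
    have : Invertible (Nat.card G : ℂ) := invertibleOfNonzero (by simp)
    have : Nontrivial V := Module.nontrivial_of_finrank_pos (R := ℂ) (hn ▸ hpos)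
    by_cases hirr : ρ.IsIrreducible
    · refine Submodule.subset_span ⟨⟨FDRep.of ρ, rfl⟩, ?_⟩
      have h := Representation.card_inv_mul_sum_char_mul_char_eq_finrank ρ ρ
      have hinv : ∀ g, ρ.character g⁻¹ = starRingEnd ℂ (ρ.character g) :=
        fun g => (FDRep.of ρ).character_inv g
      simp only [hinv] at h
      rw [charInner, h]
      simp
    · obtain ⟨σ, hbot, htop⟩ : ∃ σ : Subrepresentation ρ, σ ≠ ⊥ ∧ σ ≠ ⊤ := by
        by_contra! h
        have : Nontrivial (Subrepresentation ρ) := by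
          refine ⟨⊥, ⊤, fun h => ?_⟩
          exact bot_ne_top (α := Submodule ℂ V) (congrArg Subrepresentation.toSubmodule h)
        exact hirr ⟨fun σ => or_iff_not_imp_left.mpr (h σ)⟩
      obtain ⟨τ, hτ⟩ := exists_isCompl σ
      have hc : IsCompl σ.toSubmodule τ.toSubmodule := by
        constructor
        · rw [disjoint_iff, ← Subrepresentation.toSubmodule_inf, hτ.inf_eq_bot]; rfl
        · rw [codisjoint_iff, ← Subrepresentation.toSubmodule_sup, hτ.sup_eq_top]; rfl
      have hdim := Submodule.finrank_add_eq_of_isCompl hc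
      have hσ : 0 < Module.finrank ℂ σ.toSubmodule := by
        rw [Module.finrank_pos_iff, Submodule.nontrivial_iff_ne_bot]
        exact fun h => hbot (Subrepresentation.toSubmodule_injective h)
      have hσ' : Module.finrank ℂ σ.toSubmodule < Module.finrank ℂ V :=
        Submodule.finrank_lt fun h => htop (Subrepresentation.toSubmodule_injective h)
      have hadd : ρ.character = σ.toRepresentation.character + τ.toRepresentation.character := by
        ext g
        have hconj : (Submodule.prodEquivOfIsCompl _ _ hc).conj
            ((σ.toRepresentation g).prodMap (τ.toRepresentation g)) = ρ g := by
          ext v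
          obtain ⟨⟨a, b⟩, rfl⟩ := (Submodule.prodEquivOfIsCompl _ _ hc).surjective v
          rw [LinearEquiv.conj_apply_apply, LinearEquiv.symm_apply_apply]
          simp only [LinearMap.prodMap_apply, Submodule.coe_prodEquivOfIsCompl', map_add]
          rfl
        rw [Pi.add_apply, Representation.character, ← hconj, LinearMap.trace_conj',
          LinearMap.trace_prodMap']
        rfl
      rw [hadd]
      exact Submodule.add_mem _ (ih _ (by omega) σ.toRepresentation rfl)
        (ih _ (by omega) τ.toRepresentation rfl)

/-- In a group of odd order every real-valued generalised character of degree zero has the form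
`τ + τ̄`, with `τ` a generalised character of degree zero. -/
lemma IsGenChar.exists_eq_add_conjFun (hodd : Odd (Nat.card G)) {f : G → ℂ} (hf : IsGenChar f)
    (hreal : conjFun f = f) (hdeg : f 1 = 0) :
    ∃ τ : G → ℂ, IsGenChar τ ∧ τ 1 = 0 ∧ f = τ + conjFun τ := by
  have hspan : f ∈ Submodule.span ℤ {f : G → ℂ | IsIrrChar f} := by
    refine Submodule.span_le.mpr ?_ hf
    rintro _ ⟨V, rfl⟩
    exact Representation.character_mem_span_isIrrChar V.ρ
  obtain ⟨c, hcs, hcf⟩ := Submodule.mem_span_set.mp hspan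
  have hirr : ∀ χ ∈ c.support, IsIrrChar χ := fun χ hχ => hcs hχ
  have hfsum : f = ∑ χ ∈ c.support, (c χ : ℂ) • χ := by
    rw [← hcf, Finsupp.sum]
    exact Finset.sum_congr rfl fun χ _ => (Int.cast_smul_eq_zsmul ℂ _ _).symm
  have hcoef : ∀ χ, IsIrrChar χ → charInner f χ = c χ := by
    intro χ hχ
    rw [hfsum, charInner_sum_left _ _ (fun χ => χ), Finset.sum_eq_single χ, hχ.2, mul_one]
    · intro ψ hψ hne
      rw [(hirr ψ hψ).charInner_eq_zero hχ hne, mul_zero]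
    · intro h
      rw [Finsupp.notMem_support_iff.mp h, Int.cast_zero, zero_mul]
  have hsymm : ∀ χ, IsIrrChar χ → c (conjFun χ) = c χ := by
    intro χ hχ
    have h := hcoef _ hχ.conjFun
    rw [← hreal, charInner_conjFun, hcoef χ hχ, map_intCast] at h
    exact_mod_cast h.symm
  have hfone : f = (c 1 : ℂ) • (1 : G → ℂ) + ∑ χ ∈ c.support.erase 1, (c χ : ℂ) • χ := by
    by_cases h1 : (1 : G → ℂ) ∈ c.support
    · rw [Finset.add_sum_erase _ (fun χ : G → ℂ => (c χ : ℂ) • χ) h1, ← hfsum]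
    · rw [Finset.erase_eq_of_notMem h1, ← hfsum, Finsupp.notMem_support_iff.mp h1]
      simp
  have hirr' : ∀ χ ∈ c.support.erase 1, IsIrrChar χ :=
    fun χ hχ => hirr χ (Finset.mem_of_mem_erase hχ)
  obtain ⟨t, hts, ht⟩ := Finset.exists_sum_eq_sum_add_involution (c.support.erase 1) conjFun
    (fun χ hχ => by
      refine Finset.mem_erase.mpr ⟨fun h => Finset.ne_of_mem_erase hχ ?_, ?_⟩
      · rw [← conjFun_conjFun χ, h]
        ext g
        simp [conjFun]
      · rw [Finsupp.mem_support_iff, hsymm χ (hirr' χ hχ), ← Finsupp.mem_support_iff]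
        exact Finset.mem_of_mem_erase hχ)
    (fun χ _ => conjFun_conjFun χ)
    (fun χ hχ h => Finset.ne_of_mem_erase hχ ((hirr' χ hχ).eq_one_of_conjFun_eq hodd h))
    (fun χ => (c χ : ℂ) • χ)
  have hgen : IsGenChar (∑ χ ∈ t, c χ • χ) := Submodule.sum_mem _ fun χ hχ =>
    Submodule.smul_mem _ _ (Submodule.subset_span (hirr' χ (hts hχ)).1)
  have hint : ∀ ψ : G → ℂ, IsGenChar ψ → ∃ d : ℤ, ψ 1 = d := by
    intro ψ hψ
    induction hψ using Submodule.span_induction with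
    | mem ψ h => obtain ⟨V, rfl⟩ := h; exact ⟨Module.finrank ℂ V, by simp⟩
    | zero => exact ⟨0, by simp⟩
    | add ψ φ _ _ h₁ h₂ =>
      obtain ⟨a, ha⟩ := h₁
      obtain ⟨b, hb⟩ := h₂
      exact ⟨a + b, by simp [ha, hb]⟩
    | smul n ψ _ h => obtain ⟨a, ha⟩ := h; exact ⟨n * a, by simp [ha]⟩
  obtain ⟨d, hd⟩ := hint _ hgen
  have hf' : f = (c 1 : ℂ) • (1 : G → ℂ) + (∑ χ ∈ t, c χ • χ + conjFun (∑ χ ∈ t, c χ • χ)) := by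
    rw [hfone, ht]
    congr 1
    have hconj : conjFun (∑ χ ∈ t, c χ • χ) = ∑ χ ∈ t, c χ • conjFun χ := by
      ext g
      simp [conjFun, Finset.sum_apply]
    rw [hconj, ← Finset.sum_add_distrib]
    refine Finset.sum_congr rfl fun χ hχ => ?_
    rw [hsymm χ (hirr' χ (hts hχ)), Int.cast_smul_eq_zsmul, Int.cast_smul_eq_zsmul]
  have hc1 : (c 1 : ℂ) = -2 * d := by
    have h := congrFun hf' 1
    rw [hdeg] at h
    simp only [Pi.add_apply, Pi.smul_apply, Pi.one_apply, smul_eq_mul, mul_one, conjFun, hd,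
      map_intCast] at h
    linear_combination -h
  refine ⟨∑ χ ∈ t, c χ • χ - d • 1, Submodule.sub_mem _ hgen (Submodule.smul_mem _ _
    (Submodule.subset_span isIrrChar_one.1)), ?_, ?_⟩
  · rw [Pi.sub_apply, hd]
    simp
  · rw [hf', hc1, ← Int.cast_smul_eq_zsmul ℂ d]
    ext g
    simp only [Pi.add_apply, Pi.sub_apply, Pi.smul_apply, Pi.one_apply, conjFun, map_sub,
      smul_eq_mul, mul_one, map_intCast]
    ring

lemma IsPermChar.conjFun_eq {f : G → ℂ} (hf : IsPermChar f) : conjFun f = f := by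
  induction hf using Submodule.span_induction with
  | mem f h =>
    obtain ⟨H, rfl⟩ := h
    ext g
    simp [conjFun, indChar]
  | zero => ext g; simp [conjFun]
  | add f h _ _ hf hh =>
    ext g
    simpa [conjFun] using congrArg₂ (· + ·) (congrFun hf g) (congrFun hh g)
  | smul n f _ hf =>
    ext g
    simpa [conjFun] using congrArg ((n : ℂ) * ·) (show starRingEnd ℂ (f g) = f g from congrFun hf g)

end Characters

/-- **Lemma 2.4.** If `G` has odd order then `𝒮_G ⊆ 𝒫_G`. -/
theorem statement9 (G : Type) [Group G] [Fintype G] (hodd : Odd (Nat.card G)) :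
    SG G ⊆ PG G := by
  rintro f ⟨hperm, hdeg, V, W, rfl, -⟩
  have hgen : IsGenChar (V.character - W.character) :=
    Submodule.sub_mem _ (Submodule.subset_span ⟨V, rfl⟩) (Submodule.subset_span ⟨W, rfl⟩)
  obtain ⟨τ, hτ, hτ1, h⟩ := hgen.exists_eq_add_conjFun hodd hperm.conjFun_eq hdeg
  rw [h]
  exact memP.conj_add τ hτ hτ1
end
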